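/- arXiv:2410.04394 — 2 statements merged into one kernel-verified Lean document; each statement's English description precedes it below -/
import Mathlib

section
/- Let q ≥ 2, C ≥ 1, K ≥ 1, let d ≥ 3 be an integer, let α, ε ∈ (0,1], let L ≥ 1, and set Γ := 2^115 · q^10 · C^2 · K^3 · d^25 · L^8 / (α^14 · ε^18). Let G be a d-regular simple graph on [n] that satisfies the long-range expansion property Expan(α,ε,L). Then for every k ≥ 1, every norm ‖·‖_X on ℝ^k for which the standard basis is K-unconditional and which has cotype q with constant C, and every map f : [n] → ℝ^k, one has (1/n²)·∑_{v,w∈[n]} ‖f(v)−f(w)‖_X ≤ (Γ/|E_G|)·∑_{{w,w'}∈E_G} ‖f(w)−f(w')‖_X. -/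
open Finset

attribute [local instance] Classical.propDecidable

noncomputable section

/-- Distance (in `ℕ∞`) from a vertex to a finite set of vertices. -/
def vertexSetDist {n : ℕ} (G : SimpleGraph (Fin n)) (v : Fin n) (S : Finset (Fin n)) : ℕ∞ :=
  S.inf fun w => G.edist v w

/-- Distance (in `ℕ∞`) from a vertex to an (unordered) edge. -/
def edgeDist {n : ℕ} (G : SimpleGraph (Fin n)) (v : Fin n) (e : Sym2 (Fin n)) : ℕ∞ :=
  Sym2.lift ⟨fun a b => min (G.edist v a) (G.edist v b), fun _ _ => min_comm _ _⟩ e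

/-- Distance (in `ℕ∞`) from an (unordered) edge to a finite set of vertices. -/
def edgeSetDist {n : ℕ} (G : SimpleGraph (Fin n)) (e : Sym2 (Fin n)) (S : Finset (Fin n)) : ℕ∞ :=
  S.inf fun v => edgeDist G v e

/-- Part (A) of the long-range expansion property. -/
def ExpanA (n d : ℕ) (G : SimpleGraph (Fin n)) (α : ℝ) : Prop :=
  ∀ S : Finset (Fin n), S.Nonempty → ∀ ℓ : ℕ, 1 ≤ ℓ →
    min (3 * (n : ℝ) / 4) (α * ((d : ℝ) - 1) ^ ℓ * S.card) ≤
      ((univ.filter fun v => vertexSetDist G v S ≤ (ℓ : ℕ∞)).card : ℝ)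

/-- Part (B) of the long-range expansion property. -/
def ExpanB (n d : ℕ) (G : SimpleGraph (Fin n)) [DecidableRel G.Adj] (α ε L : ℝ) : Prop :=
  ∀ S : Finset (Fin n), S.Nonempty → ∀ ℓ : ℕ, 1 ≤ ℓ →
    α * ((d : ℝ) - 1) ^ (ℓ - 1) * S.card ≤ 3 * n / 4 →
    ∃ v ∈ S,
      (((G.edgeFinset.filter fun e =>
            L * ((d : ℝ) - 1 - ε) ^ ℓ ≤
              ((S.filter fun u => edgeDist G u e ≤ ((ℓ - 1 : ℕ) : ℕ∞)).card : ℝ)).filter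
          fun e => edgeDist G v e ≤ ((ℓ - 1 : ℕ) : ℕ∞)).card : ℝ) ≤
        L * ((d : ℝ) - 1 - ε) ^ ℓ

/-- The long-range expansion property `Expan(α, ε, L)`. -/
def Expan (n d : ℕ) (G : SimpleGraph (Fin n)) [DecidableRel G.Adj] (α ε L : ℝ) : Prop :=
  ExpanA n d G α ∧ ExpanB n d G α ε L

/-- `N` is a norm on `ℝ^k`. -/
def IsNorm (k : ℕ) (N : (Fin k → ℝ) → ℝ) : Prop :=
  (∀ x, N x = 0 ↔ x = 0) ∧ (∀ (c : ℝ) (x), N (c • x) = |c| * N x) ∧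
    ∀ x y, N (x + y) ≤ N x + N y

/-- The standard basis of `ℝ^k` is `K`-unconditional for `N`. -/
def UncondConst (k : ℕ) (N : (Fin k → ℝ) → ℝ) (K : ℝ) : Prop :=
  ∀ (σ : Fin k → Bool) (a : Fin k → ℝ),
    N (fun j => (if σ j then (1 : ℝ) else -1) * a j) ≤ K * N a

/-- `N` is a `1`-unconditional norm on `ℝ^k`: `‖y‖ = ‖|y|‖`. -/
def OneUnconditional (k : ℕ) (N : (Fin k → ℝ) → ℝ) : Prop :=
  ∀ y, N y = N fun j => |y j|

/-- `N` has cotype `q` with constant `C`. -/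
def HasCotype (k : ℕ) (N : (Fin k → ℝ) → ℝ) (q C : ℝ) : Prop :=
  ∀ (m : ℕ) (x : Fin m → Fin k → ℝ),
    1 / C ^ q * ∑ i, N (x i) ^ q ≤
      1 / 2 ^ m * ∑ σ : Fin m → Bool, N (∑ i, (if σ i then (1 : ℝ) else -1) • x i) ^ q

/-- The collection of vectors `Y` has restricted cotype `q` with constant `C` w.r.t. `N`. -/
def RestrictedCotype (k : ℕ) (N : (Fin k → ℝ) → ℝ) (q C : ℝ) (Y : Set (Fin k → ℝ)) : Prop :=
  ∀ (m : ℕ), 0 < m → ∀ y : Fin m → Fin k → ℝ, Function.Injective y → (∀ i, y i ∈ Y) →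
    1 / C ^ q * ∑ i, N (y i) ^ q ≤
      1 / 2 ^ m * ∑ σ : Fin m → Bool, N (∑ i, (if σ i then (1 : ℝ) else -1) • y i) ^ q

/-- For an edge `e = {a, b}`, the value `N (f a - f b)` (well-defined when `N` is a norm). -/
def edgeNorm {n k : ℕ} (N : (Fin k → ℝ) → ℝ) (f : Fin n → Fin k → ℝ) (e : Sym2 (Fin n)) : ℝ :=
  Sym2.lift ⟨fun a b => min (N (f a - f b)) (N (f b - f a)), fun _ _ => min_comm _ _⟩ e

/-- Coordinate projection `P_J`. -/
def proj {k : ℕ} (J : Finset (Fin k)) (y : Fin k → ℝ) : Fin k → ℝ :=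
  fun j => if j ∈ J then y j else 0

/-- Indicator vector `χ_J ∈ ℝ^k`. -/
def chi {k : ℕ} (J : Finset (Fin k)) : Fin k → ℝ := fun j => if j ∈ J then 1 else 0

/-- The sequence `a_ℓ = (6/π²) ℓ⁻²`. -/
def aseq (ℓ : ℕ) : ℝ := 6 / Real.pi ^ 2 * (1 / (ℓ : ℝ) ^ 2)

/-- The set of edges `E(S, j; ℓ)`: edges within distance `ℓ - 1` of `S` with a jump in the
`j`-th coordinate. -/
def jumpEdges {n k : ℕ} (G : SimpleGraph (Fin n)) [DecidableRel G.Adj]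
    (f : Fin n → Fin k → ℝ) (j : Fin k) (S : Finset (Fin n)) (ℓ : ℕ) :
    Finset (Sym2 (Fin n)) :=
  G.edgeFinset.filter fun e =>
    edgeSetDist G e S ≤ ((ℓ - 1 : ℕ) : ℕ∞) ∧
      Sym2.lift ⟨fun a b => f a j ≠ f b j, fun _ _ => propext ne_comm⟩ e

/-- The scale `ℓ_{v,j}`. -/
def lvj {n k : ℕ} (G : SimpleGraph (Fin n)) [DecidableRel G.Adj]
    (f : Fin n → Fin k → ℝ) (α : ℝ) (d : ℕ) (v : Fin n) (j : Fin k) : ℕ :=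
  sInf {ℓ : ℕ | 1 ≤ ℓ ∧
    α * aseq ℓ / 6 * ((d : ℝ) - 1) ^ (ℓ - 1) ≤ ((jumpEdges G f j {v} ℓ).card : ℝ)}

/-- The set `V_+(j; ℓ)`. -/
def Vplus {n k : ℕ} (G : SimpleGraph (Fin n)) [DecidableRel G.Adj]
    (f : Fin n → Fin k → ℝ) (α : ℝ) (d : ℕ) (j : Fin k) (ℓ : ℕ) : Finset (Fin n) :=
  univ.filter fun v => f v j = 1 ∧ lvj G f α d v j = ℓ

/-- The set `V_-(j; ℓ)`. -/
def Vminus {n k : ℕ} (G : SimpleGraph (Fin n)) [DecidableRel G.Adj]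
    (f : Fin n → Fin k → ℝ) (α : ℝ) (d : ℕ) (j : Fin k) (ℓ : ℕ) : Finset (Fin n) :=
  univ.filter fun v => f v j = -1 ∧ lvj G f α d v j = ℓ

/-- The scale-`ℓ` support `J(v, ℓ)`. -/
def Jset {n k : ℕ} (G : SimpleGraph (Fin n)) [DecidableRel G.Adj]
    (f : Fin n → Fin k → ℝ) (α : ℝ) (d : ℕ) (v : Fin n) (ℓ : ℕ) : Finset (Fin k) :=
  univ.filter fun j => f v j ≠ 0 ∧ lvj G f α d v j = ℓ

/-- The scale-`ℓ` mutual support `J(v, ℓ, e)`, relative to a family `Ẽ(v, j)` of edge sets. -/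
def JsetE {n k : ℕ} (G : SimpleGraph (Fin n)) [DecidableRel G.Adj]
    (f : Fin n → Fin k → ℝ) (α : ℝ) (d : ℕ) (Et : Fin n → Fin k → Finset (Sym2 (Fin n)))
    (v : Fin n) (ℓ : ℕ) (e : Sym2 (Fin n)) : Finset (Fin k) :=
  (Jset G f α d v ℓ).filter fun j => e ∈ Et v j

end

theorem aux_edgeDist_mk {n : ℕ} (G : SimpleGraph (Fin n)) (v a b : Fin n) :
    edgeDist G v s(a, b) = min (G.edist v a) (G.edist v b) := rfl

theorem aux_edgeDist_adj {n : ℕ} (G : SimpleGraph (Fin n)) {v w : Fin n} (h : G.Adj v w)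
    (e : Sym2 (Fin n)) : edgeDist G v e ≤ edgeDist G w e + 1 := by
  induction e using Sym2.ind with
  | _ a b =>
    rw [aux_edgeDist_mk, aux_edgeDist_mk]
    have h1 : G.edist v w = 1 := SimpleGraph.edist_eq_one_iff_adj.2 h
    have key : ∀ c, G.edist v c ≤ G.edist w c + 1 := by
      intro c
      have := SimpleGraph.edist_triangle (G := G) (u := v) (v := w) (w := c)
      rw [h1] at this
      rwa [add_comm] at this
    rcases le_total (G.edist w a) (G.edist w b) with h2 | h2
    · rw [min_eq_left h2]; exact (min_le_left _ _).trans (key a)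
    · rw [min_eq_right h2]; exact (min_le_right _ _).trans (key b)

theorem aux_edist_step {n : ℕ} (G : SimpleGraph (Fin n)) {v a : Fin n} {r : ℕ}
    (h : G.edist v a = ((r + 1 : ℕ) : ℕ∞)) : ∃ w, G.Adj v w ∧ G.edist w a ≤ (r : ℕ∞) := by
  obtain ⟨p, hp⟩ := SimpleGraph.exists_walk_of_edist_eq_coe h
  cases p with
  | nil => simp at hp
  | cons hadj p =>
    refine ⟨_, hadj, (SimpleGraph.edist_le p).trans ?_⟩
    simp at hp
    exact_mod_cast hp.le

theorem aux_edgeDist_step {n : ℕ} (G : SimpleGraph (Fin n)) {v : Fin n} {e : Sym2 (Fin n)} {r : ℕ}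
    (h : edgeDist G v e = ((r + 1 : ℕ) : ℕ∞)) :
    ∃ w, G.Adj v w ∧ edgeDist G w e = (r : ℕ∞) := by
  have main : ∃ w, G.Adj v w ∧ edgeDist G w e ≤ (r : ℕ∞) := by
    induction e using Sym2.ind with
    | _ a b =>
      rw [aux_edgeDist_mk] at h
      rcases le_total (G.edist v a) (G.edist v b) with h2 | h2
      · rw [min_eq_left h2] at h
        obtain ⟨w, hw, hw'⟩ := aux_edist_step G h
        exact ⟨w, hw, (min_le_left _ _).trans hw'⟩
      · rw [min_eq_right h2] at h
        obtain ⟨w, hw, hw'⟩ := aux_edist_step G h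
        exact ⟨w, hw, (min_le_right _ _).trans hw'⟩
  obtain ⟨w, hw, hle⟩ := main
  refine ⟨w, hw, le_antisymm hle ?_⟩
  have := aux_edgeDist_adj G hw e
  rw [h] at this
  push_cast at this
  exact (ENat.add_le_add_iff_right (by simp)).1 this

noncomputable def aSph {n : ℕ} (G : SimpleGraph (Fin n)) (e : Sym2 (Fin n)) (r : ℕ) : Finset (Fin n) :=
  univ.filter fun v => edgeDist G v e = (r : ℕ∞)

noncomputable def aBall {n : ℕ} (G : SimpleGraph (Fin n)) (e : Sym2 (Fin n)) (r : ℕ) : Finset (Fin n) :=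
  univ.filter fun v => edgeDist G v e ≤ (r : ℕ∞)

theorem aux_edgeDist_eq_zero {n : ℕ} (G : SimpleGraph (Fin n)) (v a b : Fin n) :
    edgeDist G v s(a, b) = 0 ↔ v = a ∨ v = b := by
  rw [aux_edgeDist_mk]
  simp

theorem aux_sph {n d : ℕ} (G : SimpleGraph (Fin n)) [DecidableRel G.Adj]
    (hreg : ∀ v, G.degree v = d) (e : Sym2 (Fin n)) (he : e ∈ G.edgeSet) (r : ℕ) :
    (aSph G e (r + 1)).card ≤ (aSph G e r).card * (d - 1) := by
  have hsub : aSph G e (r + 1) ⊆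
      (aSph G e r).biUnion fun w => (G.neighborFinset w).filter fun v => v ∈ aSph G e (r + 1) := by
    intro v hv
    have hv' := hv
    simp only [aSph, mem_filter, mem_univ, true_and] at hv'
    obtain ⟨w, hw, hwe⟩ := aux_edgeDist_step G hv'
    simp only [mem_biUnion, mem_filter, SimpleGraph.mem_neighborFinset]
    exact ⟨w, by simp [aSph, hwe], hw.symm, hv⟩
  refine (card_le_card hsub).trans ?_
  refine card_biUnion_le_card_mul _ _ _ ?_
  intro w hw
  simp only [aSph, mem_filter, mem_univ, true_and] at hw
  have hex : ∃ u, G.Adj w u ∧ u ∉ aSph G e (r + 1) := by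
    cases r with
    | zero =>
      induction e using Sym2.ind with
      | _ a b =>
        have hab : G.Adj a b := he
        have : w = a ∨ w = b := (aux_edgeDist_eq_zero G w a b).1 (by simpa using hw)
        rcases this with rfl | rfl
        · refine ⟨b, hab, ?_⟩
          simp only [aSph, mem_filter, mem_univ, true_and]
          rw [(aux_edgeDist_eq_zero G b w b).2 (Or.inr rfl)]; simp
        · refine ⟨a, hab.symm, ?_⟩
          simp only [aSph, mem_filter, mem_univ, true_and]
          rw [(aux_edgeDist_eq_zero G a a w).2 (Or.inl rfl)]; simp
    | succ r =>
      obtain ⟨u, hu, hue⟩ := aux_edgeDist_step G hw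
      refine ⟨u, hu, ?_⟩
      simp only [aSph, mem_filter, mem_univ, true_and]
      rw [hue]
      norm_cast
      omega
  obtain ⟨u, hu, hu'⟩ := hex
  have h1 : ((G.neighborFinset w).filter fun v => v ∈ aSph G e (r + 1)) ⊆
      (G.neighborFinset w).erase u := by
    intro v hv
    simp only [mem_filter] at hv
    rw [mem_erase]
    exact ⟨fun h => hu' (h ▸ hv.2), hv.1⟩
  refine (card_le_card h1).trans ?_
  rw [card_erase_of_mem (by simpa using hu), SimpleGraph.card_neighborFinset_eq_degree, hreg]

theorem aux_sph_card {n d : ℕ} (G : SimpleGraph (Fin n)) [DecidableRel G.Adj]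
    (hreg : ∀ v, G.degree v = d) (e : Sym2 (Fin n)) (he : e ∈ G.edgeSet) (r : ℕ) :
    (aSph G e r).card ≤ 2 * (d - 1) ^ r := by
  induction r with
  | zero =>
    induction e using Sym2.ind with
    | _ a b =>
      have : aSph G s(a, b) 0 ⊆ {a, b} := by
        intro v hv
        simp only [aSph, mem_filter, mem_univ, true_and] at hv
        have := (aux_edgeDist_eq_zero G v a b).1 (by simpa using hv)
        simpa using this
      simpa using (card_le_card this).trans card_le_two
  | succ r ih =>
    refine (aux_sph G hreg e he r).trans ?_
    rw [pow_succ, ← mul_assoc]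
    exact Nat.mul_le_mul_right _ ih

theorem aux_geom (b r : ℕ) (hb : 2 ≤ b) : ∑ i ∈ range (r + 1), b ^ i ≤ 2 * b ^ r := by
  induction r with
  | zero => simp
  | succ r ih =>
    rw [sum_range_succ]
    have : 2 * b ^ r ≤ b ^ (r + 1) := by rw [pow_succ, mul_comm]; exact Nat.mul_le_mul_left _ hb
    omega

theorem aux_ball {n d : ℕ} (hd : 3 ≤ d) (G : SimpleGraph (Fin n)) [DecidableRel G.Adj]
    (hreg : ∀ v, G.degree v = d) (e : Sym2 (Fin n)) (he : e ∈ G.edgeSet) (r : ℕ) :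
    (aBall G e r).card ≤ 4 * (d - 1) ^ r := by
  have hsub : aBall G e r ⊆ (range (r + 1)).biUnion fun i => aSph G e i := by
    intro v hv
    simp only [aBall, mem_filter, mem_univ, true_and] at hv
    obtain ⟨m, hm⟩ := ENat.ne_top_iff_exists.1 (ne_top_of_le_ne_top (by simp) hv)
    rw [← hm] at hv
    simp only [mem_biUnion, mem_range, aSph, mem_filter, mem_univ, true_and]
    refine ⟨m, ?_, hm.symm⟩
    have : m ≤ r := by exact_mod_cast hv
    omega
  calc (aBall G e r).card ≤ _ := card_le_card hsub
    _ ≤ ∑ i ∈ range (r + 1), (aSph G e i).card := card_biUnion_le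
    _ ≤ ∑ i ∈ range (r + 1), 2 * (d - 1) ^ i := sum_le_sum fun i _ => aux_sph_card G hreg e he i
    _ = 2 * ∑ i ∈ range (r + 1), (d - 1) ^ i := by rw [mul_sum]
    _ ≤ 2 * (2 * (d - 1) ^ r) := Nat.mul_le_mul_left _ (aux_geom _ _ (by omega))
    _ = _ := by ring

/-- boundary edges -/
noncomputable def aBd {n : ℕ} (G : SimpleGraph (Fin n)) [DecidableRel G.Adj] (A : Finset (Fin n)) :
    Finset (Sym2 (Fin n)) :=
  G.edgeFinset.filter fun e =>
    Sym2.lift ⟨fun a b => (¬ (a ∈ A ↔ b ∈ A)), fun _ _ => propext (not_congr iff_comm)⟩ e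

theorem aux_mem_aBd {n : ℕ} (G : SimpleGraph (Fin n)) [DecidableRel G.Adj] (A : Finset (Fin n))
    (a b : Fin n) : s(a, b) ∈ aBd G A ↔ G.Adj a b ∧ ¬ (a ∈ A ↔ b ∈ A) := by
  simp [aBd]

theorem aux_walk {n : ℕ} (G : SimpleGraph (Fin n)) [DecidableRel G.Adj] (A : Finset (Fin n))
    {v s : Fin n} (p : G.Walk v s) (hv : v ∉ A) (hs : s ∈ A) :
    ∃ e ∈ aBd G A, ∃ i j : ℕ, i + j + 1 ≤ p.length ∧ edgeDist G s e ≤ (i : ℕ∞) ∧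
      edgeDist G v e ≤ (j : ℕ∞) := by
  induction p with
  | nil => exact absurd hs hv
  | @cons v w s h p ih =>
    by_cases hw : w ∈ A
    · refine ⟨s(v, w), (aux_mem_aBd G A v w).2 ⟨h, by simp [hv, hw]⟩, p.length, 0, by simp, ?_, ?_⟩
      · rw [aux_edgeDist_mk]
        refine (min_le_right _ _).trans ?_
        rw [SimpleGraph.edist_comm]
        exact SimpleGraph.edist_le p
      · rw [(aux_edgeDist_eq_zero G v v w).2 (Or.inl rfl)]; simp
    · obtain ⟨e, he, i, j, hij, h1, h2⟩ := ih hw hs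
      refine ⟨e, he, i, j + 1, by simp; omega, h1, ?_⟩
      refine (aux_edgeDist_adj G h e).trans ?_
      push_cast
      gcongr

noncomputable def aNear {n : ℕ} (G : SimpleGraph (Fin n)) [DecidableRel G.Adj] (r : ℕ) (v : Fin n) :
    Finset (Sym2 (Fin n)) :=
  G.edgeFinset.filter fun e => edgeDist G v e ≤ (r : ℕ∞)

theorem aux_outside {n d : ℕ} (hd : 3 ≤ d) (G : SimpleGraph (Fin n)) [DecidableRel G.Adj]
    (hreg : ∀ v, G.degree v = d) (A S : Finset (Fin n)) (hS : S ⊆ A) (ℓ : ℕ) :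
    (univ.filter fun v => vertexSetDist G v S ≤ (ℓ : ℕ∞)).card ≤
      A.card + ∑ i ∈ range ℓ, (∑ s ∈ S, (aBd G A ∩ aNear G i s).card) *
        (4 * (d - 1) ^ (ℓ - 1 - i)) := by
  have hsub : (univ.filter fun v => vertexSetDist G v S ≤ (ℓ : ℕ∞)) ⊆
      A ∪ (range ℓ).biUnion fun i => (S.biUnion fun s => aBd G A ∩ aNear G i s).biUnion
        fun e => aBall G e (ℓ - 1 - i) := by
    intro v hv
    replace hv := (mem_filter.1 hv).2
    unfold vertexSetDist at hv
    rw [mem_union]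
    by_cases hvA : v ∈ A
    · exact Or.inl hvA
    right
    have hlt : (S.inf fun w => G.edist v w) < ((ℓ + 1 : ℕ) : ℕ∞) := by
      refine lt_of_le_of_lt hv ?_
      exact_mod_cast Nat.lt_succ_self ℓ
    rw [Finset.inf_lt_iff] at hlt
    obtain ⟨s, hs, hlt⟩ := hlt
    obtain ⟨p, hp⟩ := SimpleGraph.exists_walk_of_edist_ne_top (ne_top_of_lt hlt)
    rw [← hp] at hlt
    have hlen : p.length < ℓ + 1 := by exact_mod_cast hlt
    obtain ⟨e, he, i, j, hij, h1, h2⟩ := aux_walk G A p hvA (hS hs)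
    simp only [mem_biUnion, mem_range, mem_inter]
    refine ⟨i, by omega, e, ⟨s, hs, he, ?_⟩, ?_⟩
    · simp only [aNear, mem_filter]
      exact ⟨(mem_filter.1 he).1, h1⟩
    · simp only [aBall, mem_filter, mem_univ, true_and]
      refine h2.trans ?_
      exact_mod_cast (by omega : j ≤ ℓ - 1 - i)
  refine (card_le_card hsub).trans ((card_union_le _ _).trans ?_)
  gcongr
  refine card_biUnion_le.trans (sum_le_sum fun i _ => ?_)
  refine (card_biUnion_le_card_mul _ _ (4 * (d - 1) ^ (ℓ - 1 - i)) ?_).trans ?_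
  · intro e he
    simp only [mem_biUnion, mem_inter] at he
    obtain ⟨s, _, he, _⟩ := he
    exact aux_ball hd G hreg e (by simpa using (mem_filter.1 he).1) _
  · exact Nat.mul_le_mul_right _ card_biUnion_le

theorem aux_peel {V E : Type} [DecidableEq V] [DecidableEq E] (R : V → Finset E) (M : ℝ)
    (hM : 0 ≤ M) (S : Finset V)
    (h : ∀ S' ⊆ S, S'.Nonempty → ∃ v ∈ S',
      (((R v).filter fun e => M ≤ ((S'.filter fun u => e ∈ R u).card : ℝ)).card : ℝ) ≤ M) :
    ∃ Et : V → Finset E, (∀ v ∈ S, Et v ⊆ R v ∧ ((R v \ Et v).card : ℝ) ≤ M) ∧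
      ∀ e, ((S.filter fun v => e ∈ Et v).card : ℝ) ≤ M := by
  induction hc : S.card generalizing S with
  | zero =>
    rw [card_eq_zero] at hc
    subst hc
    exact ⟨R, by simp, fun e => by simpa using hM⟩
  | succ m ih =>
    obtain ⟨v, hv, hvM⟩ := h S subset_rfl (card_pos.1 (by omega))
    obtain ⟨Et, h1, h2⟩ := ih (S.erase v)
      (fun S' hS' hne => h S' (hS'.trans (erase_subset _ _)) hne)
      (by rw [card_erase_of_mem hv]; omega)
    refine ⟨Function.update Et v
      ((R v).filter fun e => ¬ M ≤ ((S.filter fun u => e ∈ R u).card : ℝ)), ?_, ?_⟩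
    · intro u hu
      by_cases huv : u = v
      · subst huv
        simp only [Function.update_self]
        refine ⟨filter_subset _ _, le_trans ?_ hvM⟩
        norm_cast
        apply card_le_card
        intro e he
        simp only [mem_sdiff, mem_filter, not_and, not_not] at he ⊢
        exact ⟨he.1, he.2 he.1⟩
      · rw [Function.update_of_ne huv]
        exact h1 u (mem_erase.2 ⟨huv, hu⟩)
    · intro e
      by_cases he : e ∈ (R v).filter fun e => ¬ M ≤ ((S.filter fun u => e ∈ R u).card : ℝ)
      · have he' := (mem_filter.1 he).2
        refine le_trans ?_ (not_le.1 he').le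
        norm_cast
        apply card_le_card
        intro u hu
        simp only [mem_filter] at hu ⊢
        refine ⟨hu.1, ?_⟩
        by_cases huv : u = v
        · subst huv; exact (mem_filter.1 he).1
        · rw [Function.update_of_ne huv] at hu
          exact (h1 u (mem_erase.2 ⟨huv, hu.1⟩)).1 hu.2
      · refine le_trans ?_ (h2 e)
        norm_cast
        apply card_le_card
        intro u hu
        simp only [mem_filter] at hu ⊢
        have huv : u ≠ v := by
          rintro rfl
          rw [Function.update_self] at hu
          exact he hu.2
        rw [Function.update_of_ne huv] at hu
        exact ⟨mem_erase.2 ⟨huv, hu.1⟩, hu.2⟩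

theorem aux_small {n d : ℕ} (hd : 3 ≤ d) (G : SimpleGraph (Fin n)) [DecidableRel G.Adj]
    (hreg : ∀ v, G.degree v = d) (α δ : ℝ) (hα : 0 < α ∧ α ≤ 1) (hδ : 0 < δ ∧ δ < 1)
    (hE : ExpanA n d G α) (A S : Finset (Fin n)) (hA : 2 * A.card ≤ n) (hS : S ⊆ A)
    (hne : S.Nonempty) (ℓ : ℕ)
    (hsm : ∀ s ∈ S, ∀ i < ℓ, ((aBd G A ∩ aNear G i s).card : ℝ) <
      α / 16 * (δ * (1 - δ) ^ i) * ((d : ℝ) - 1) ^ i) :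
    α * ((d : ℝ) - 1) ^ ℓ * S.card ≤ 3 * n / 4 := by
  have hA' : 2 * (A.card : ℝ) ≤ n := by exact_mod_cast hA
  have hSA : (S.card : ℝ) ≤ A.card := by exact_mod_cast card_le_card hS
  have hSp : (1 : ℝ) ≤ S.card := by exact_mod_cast hne.card_pos
  have hb : (2 : ℝ) ≤ (d : ℝ) - 1 := by
    have : (3 : ℝ) ≤ d := by exact_mod_cast hd
    linarith
  induction ℓ with
  | zero =>
    have : α * S.card ≤ 1 * S.card := by gcongr; exact hα.2
    simp only [pow_zero, mul_one]
    linarith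
  | succ ℓ ih =>
    have ih := ih (fun s hs i hi => hsm s hs i (by omega))
    by_contra hcon
    push Not at hcon
    have h1 := hE S hne (ℓ + 1) (by omega)
    rw [min_eq_left hcon.le] at h1
    have h2 := aux_outside hd G hreg A S hS (ℓ + 1)
    have h3 : ((univ.filter fun v => vertexSetDist G v S ≤ ((ℓ + 1 : ℕ) : ℕ∞)).card : ℝ) ≤
      (A.card + ∑ i ∈ range (ℓ + 1), (∑ s ∈ S, (aBd G A ∩ aNear G i s).card) *
        (4 * (d - 1) ^ (ℓ + 1 - 1 - i)) : ℕ) := by exact_mod_cast h2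
    have h4 := h1.trans h3
    push_cast [Nat.cast_sub (by omega : 1 ≤ d)] at h4
    have h5 : ∑ i ∈ range (ℓ + 1), (∑ s ∈ S, ((aBd G A ∩ aNear G i s).card : ℝ)) *
        (4 * ((d : ℝ) - 1) ^ (ℓ + 1 - 1 - i)) ≤
        ∑ i ∈ range (ℓ + 1), (S.card * α / 4 * ((d : ℝ) - 1) ^ ℓ) * (δ * (1 - δ) ^ i) := by
      refine sum_le_sum fun i hi => ?_
      have hi' : i < ℓ + 1 := mem_range.1 hi
      calc (∑ s ∈ S, ((aBd G A ∩ aNear G i s).card : ℝ)) * (4 * ((d : ℝ) - 1) ^ (ℓ + 1 - 1 - i))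
          ≤ (∑ s ∈ S, α / 16 * (δ * (1 - δ) ^ i) * ((d : ℝ) - 1) ^ i) *
            (4 * ((d : ℝ) - 1) ^ (ℓ + 1 - 1 - i)) := by
            gcongr with s hs
            exact (hsm s hs i hi').le
        _ = (S.card * α / 4 * (((d : ℝ) - 1) ^ i * ((d : ℝ) - 1) ^ (ℓ + 1 - 1 - i))) *
              (δ * (1 - δ) ^ i) := by
            rw [sum_const, nsmul_eq_mul]; ring
        _ = _ := by
            rw [← pow_add]
            congr 4
            omega
    have h6 : ∑ i ∈ range (ℓ + 1), (δ * (1 - δ) ^ i) ≤ 1 := by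
      rw [← mul_sum]
      have := mul_neg_geom_sum (1 - δ) (ℓ + 1)
      rw [sub_sub_cancel] at this
      rw [this]
      have : 0 ≤ (1 - δ) ^ (ℓ + 1) := pow_nonneg (by linarith [hδ.2]) _
      linarith
    rw [← mul_sum] at h5
    have h7 : (S.card * α / 4 * ((d : ℝ) - 1) ^ ℓ) * ∑ i ∈ range (ℓ + 1), (δ * (1 - δ) ^ i) ≤
        (S.card * α / 4 * ((d : ℝ) - 1) ^ ℓ) * 1 := by
      gcongr
      have := hα.1
      positivity
    have h8 : (S.card * α / 4 * ((d : ℝ) - 1) ^ ℓ) * 1 = (α * ((d : ℝ) - 1) ^ ℓ * S.card) / 4 := by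
      ring
    simp only [Nat.add_sub_cancel] at h5
    have hn : (0 : ℝ) < n := by linarith
    linarith

theorem aux_scale {n d : ℕ} (hd : 3 ≤ d) (G : SimpleGraph (Fin n)) [DecidableRel G.Adj]
    (hreg : ∀ v, G.degree v = d) (α δ : ℝ) (hα : 0 < α ∧ α ≤ 1) (hδ : 0 < δ ∧ δ < 1)
    (hE : ExpanA n d G α) (A : Finset (Fin n)) (hA : 2 * A.card ≤ n) (v : Fin n) (hv : v ∈ A) :
    ∃ r : ℕ, α / 16 * (δ * (1 - δ) ^ r) * ((d : ℝ) - 1) ^ r ≤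
      ((aBd G A ∩ aNear G r v).card : ℝ) := by
  by_contra hcon
  push Not at hcon
  have hb : (1 : ℝ) < (d : ℝ) - 1 := by
    have : (3 : ℝ) ≤ d := by exact_mod_cast hd
    linarith
  obtain ⟨m, hm⟩ := pow_unbounded_of_one_lt (3 * (n : ℝ) / 4 / α) hb
  have := aux_small hd G hreg α δ hα hδ hE A {v} hA (by simpa using hv) (by simp) m
    (fun s hs i _ => by rw [mem_singleton.1 hs]; exact hcon i)
  rw [div_lt_iff₀ hα.1] at hm
  simp at this
  linarith

theorem aux_data {n d : ℕ} (hd : 3 ≤ d) (G : SimpleGraph (Fin n)) [DecidableRel G.Adj]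
    (hreg : ∀ v, G.degree v = d) (α δ ε L : ℝ) (hα : 0 < α ∧ α ≤ 1) (hδ : 0 < δ ∧ δ < 1)
    (hε : 0 < ε ∧ ε ≤ 1) (hL : 1 ≤ L)
    (hE : Expan n d G α ε L) (A : Finset (Fin n)) (hA : 2 * A.card ≤ n) :
    ∃ (sc : Fin n → ℕ) (Et : Fin n → Finset (Sym2 (Fin n))),
      (∀ v ∈ A, Et v ⊆ aBd G A ∩ aNear G (sc v) v ∧
        α / 16 * (δ * (1 - δ) ^ sc v) * ((d : ℝ) - 1) ^ sc v / 2 ≤ ((Et v).card : ℝ)) ∧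
      ∀ r e, ((univ.filter fun v => v ∈ A ∧ sc v = r ∧ e ∈ Et v).card : ℝ) ≤
        128 / (α * (δ * (1 - δ) ^ r)) * (L * ((d : ℝ) - 1 - ε) ^ (r + 1)) := by
  have hd' : (3 : ℝ) ≤ d := by exact_mod_cast hd
  have hex := fun v (hv : v ∈ A) => aux_scale hd G hreg α δ hα hδ hE.1 A hA v hv
  let sc : Fin n → ℕ := fun v => if hv : v ∈ A then Nat.find (hex v hv) else 0
  have hsc1 : ∀ v ∈ A, α / 16 * (δ * (1 - δ) ^ sc v) * ((d : ℝ) - 1) ^ sc v ≤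
      ((aBd G A ∩ aNear G (sc v) v).card : ℝ) := by
    intro v hv
    simp only [sc, dif_pos hv]
    exact Nat.find_spec (hex v hv)
  have hsc2 : ∀ v ∈ A, ∀ i < sc v, ((aBd G A ∩ aNear G i v).card : ℝ) <
      α / 16 * (δ * (1 - δ) ^ i) * ((d : ℝ) - 1) ^ i := by
    intro v hv i hi
    simp only [sc, dif_pos hv] at hi
    exact not_le.1 (Nat.find_min (hex v hv) hi)
  have hr : ∀ r : ℕ, ∃ Et : Fin n → Finset (Sym2 (Fin n)),
      (∀ v ∈ A, sc v = r → Et v ⊆ aBd G A ∩ aNear G r v ∧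
        α / 16 * (δ * (1 - δ) ^ r) * ((d : ℝ) - 1) ^ r / 2 ≤ ((Et v).card : ℝ)) ∧
      ∀ e, ((univ.filter fun v => v ∈ A ∧ sc v = r ∧ e ∈ Et v).card : ℝ) ≤
        128 / (α * (δ * (1 - δ) ^ r)) * (L * ((d : ℝ) - 1 - ε) ^ (r + 1)) := by
    intro r
    set M := L * ((d : ℝ) - 1 - ε) ^ (r + 1) with hM
    have hM0 : 0 < M := by
      have : 0 < (d : ℝ) - 1 - ε := by linarith [hε.2]
      positivity
    set a := δ * (1 - δ) ^ r with ha
    have ha0 : 0 < a := mul_pos hδ.1 (pow_pos (by linarith [hδ.2]) _)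
    have ha1 : a ≤ 1 := by
      have : (1 - δ) ^ r ≤ 1 := pow_le_one₀ (by linarith [hδ.2]) (by linarith [hδ.1])
      calc a ≤ 1 * 1 := by
            rw [ha]; gcongr
            · exact pow_nonneg (by linarith [hδ.2]) _
            · exact hδ.2.le
        _ = 1 := by ring
    have hα0 := hα.1
    have haα : α * a ≤ 1 := by nlinarith [hα.2]
    by_cases hcase : M ≤ α / 16 * a * ((d : ℝ) - 1) ^ r / 2
    · obtain ⟨Et, h1, h2⟩ := aux_peel (aNear G r) M hM0.le (A.filter fun v => sc v = r) (by
        intro S' hS' hne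
        have hsm := aux_small hd G hreg α δ hα hδ hE.1 A S' hA
          (hS'.trans (filter_subset _ _)) hne r (by
            intro s hs i hi
            have := mem_filter.1 (hS' hs)
            exact hsc2 s this.1 i (by omega))
        obtain ⟨v, hv, hvM⟩ := hE.2 S' hne (r + 1) (by omega) (by simpa using hsm)
        refine ⟨v, hv, le_trans ?_ hvM⟩
        refine Nat.cast_le.2 (card_le_card ?_)
        intro e he
        simp only [aNear, mem_filter] at he
        simp only [mem_filter, Nat.add_sub_cancel]
        refine ⟨⟨he.1.1, le_trans he.2 ?_⟩, he.1.2⟩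
        refine Nat.cast_le.2 (card_le_card ?_)
        intro u hu
        simp only [mem_filter] at hu ⊢
        exact ⟨hu.1, hu.2.2⟩)
      refine ⟨fun v => Et v ∩ aBd G A, ?_, ?_⟩
      · intro v hv hvr
        obtain ⟨h3, h4⟩ := h1 v (mem_filter.2 ⟨hv, hvr⟩)
        refine ⟨fun e he => ?_, ?_⟩
        · rw [mem_inter] at he ⊢
          exact ⟨he.2, h3 he.1⟩
        · have h5 := hsc1 v hv
          rw [hvr] at h5
          have h6 : ((aBd G A ∩ aNear G r v).card : ℝ) ≤
              (Et v ∩ aBd G A).card + (aNear G r v \ Et v).card := by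
            norm_cast
            refine le_trans (card_le_card ?_) (card_union_le _ _)
            intro e he
            simp only [mem_inter, mem_union, mem_sdiff] at he ⊢
            by_cases h : e ∈ Et v
            · exact Or.inl ⟨h, he.1⟩
            · exact Or.inr ⟨he.2, h⟩
          linarith
      · intro e
        have h128 : 1 ≤ 128 / (α * a) := by
          rw [le_div_iff₀ (by positivity)]; linarith
        calc _ ≤ ((((A.filter fun v => sc v = r).filter fun v => e ∈ Et v).card : ℕ) : ℝ) := by
              norm_cast
              apply card_le_card
              intro v hv
              simp only [mem_filter, mem_inter, mem_univ, true_and] at hv ⊢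
              exact ⟨⟨hv.1, hv.2.1⟩, hv.2.2.1⟩
          _ ≤ M := h2 e
          _ ≤ 128 / (α * a) * M := le_mul_of_one_le_left hM0.le h128
    · push Not at hcase
      refine ⟨fun v => aBd G A ∩ aNear G r v, ?_, ?_⟩
      · intro v hv hvr
        refine ⟨subset_rfl, ?_⟩
        have h5 := hsc1 v hv
        rw [hvr] at h5
        refine le_trans ?_ h5
        have : 0 ≤ α / 16 * a * ((d : ℝ) - 1) ^ r := by
          have : 0 ≤ (d : ℝ) - 1 := by linarith
          positivity
        linarith
      · intro e
        by_cases he : e ∈ G.edgeFinset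
        · have h7 := aux_ball hd G hreg e (by simpa using he) r
          calc _ ≤ (((aBall G e r).card : ℕ) : ℝ) := by
                norm_cast
                apply card_le_card
                intro v hv
                simp only [mem_filter, mem_inter, mem_univ, true_and, aNear] at hv
                simp only [aBall, mem_filter, mem_univ, true_and]
                exact hv.2.2.2.2
            _ ≤ ((4 * (d - 1) ^ r : ℕ) : ℝ) := by exact_mod_cast h7
            _ = 128 / (α * a) * (α / 16 * a * ((d : ℝ) - 1) ^ r / 2) := by
                push_cast [Nat.cast_sub (by omega : 1 ≤ d)]
                field_simp
                ring
            _ ≤ _ := by gcongr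
        · have : (univ.filter fun v => v ∈ A ∧ sc v = r ∧ e ∈ aBd G A ∩ aNear G r v) = ∅ := by
            apply filter_false_of_mem
            intro v _ hv
            exact he (mem_filter.1 (mem_inter.1 hv.2.2).1).1
          rw [this]
          simp
          positivity
  choose Et hEt1 hEt2 using hr
  refine ⟨sc, fun v => Et (sc v) v, fun v hv => hEt1 (sc v) v hv rfl, fun r e => ?_⟩
  refine le_trans (le_of_eq ?_) (hEt2 r e)
  congr 2
  ext v
  simp only [mem_filter, mem_univ, true_and]
  constructor
  · rintro ⟨h1, h2, h3⟩; subst h2; exact ⟨h1, rfl, h3⟩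
  · rintro ⟨h1, h2, h3⟩; subst h2; exact ⟨h1, rfl, h3⟩

structure ALat {ι : Type} (ρ : (ι → ℝ) → ℝ) (q Q : ℝ) : Prop where
  nonneg : ∀ x, 0 ≤ ρ x
  sub : ∀ x y, ρ (x + y) ≤ ρ x + ρ y
  hom : ∀ (c : ℝ) x, 0 ≤ c → ρ (c • x) = c * ρ x
  mono : ∀ x y, (∀ j, 0 ≤ x j) → (∀ j, x j ≤ y j) → ρ x ≤ ρ y
  cot : ∀ (m : ℕ) (x : Fin m → ι → ℝ), (∀ i j, 0 ≤ x i j) →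
    ∑ i, ρ (x i) ^ q ≤ Q ^ q * ρ (∑ i, x i) ^ q

noncomputable def aInd {ι : Type} (p : ι → Prop) : ι → ℝ := fun j => if p j then 1 else 0

theorem aInd_nonneg {ι : Type} (p : ι → Prop) (j : ι) : 0 ≤ aInd p j := by
  unfold aInd; split_ifs <;> norm_num

theorem ALat.zero {ι : Type} {ρ : (ι → ℝ) → ℝ} {q Q : ℝ} (h : ALat ρ q Q) : ρ 0 = 0 := by
  have := h.hom 0 0 le_rfl
  simpa using this

theorem ALat.sum {ι : Type} {ρ : (ι → ℝ) → ℝ} {q Q : ℝ} (h : ALat ρ q Q) {T : Type}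
    (s : Finset T) (x : T → ι → ℝ) : ρ (∑ i ∈ s, x i) ≤ ∑ i ∈ s, ρ (x i) := by
  induction s using Finset.induction_on with
  | empty => simp [h.zero]
  | insert a s ha ih =>
    rw [sum_insert ha, sum_insert ha]
    exact (h.sub _ _).trans (by gcongr)

theorem aux_count {n R : ℕ} (u v : Fin n) (huv : u ≠ v) :
    (univ.filter fun c : Fin n → Fin R => c u = c v).card * R ≤ R ^ n := by
  have h1 : ((univ.filter fun c : Fin n → Fin R => c u = c v) ×ˢ (univ : Finset (Fin R))).card ≤
      (univ : Finset (Fin n → Fin R)).card := by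
    apply card_le_card_of_injOn (fun p => Function.update p.1 u p.2)
    · intro p _; simp
    · rintro ⟨c, s⟩ hc ⟨c', s'⟩ hc' heq
      simp only [coe_product, coe_filter, mem_univ, true_and, Set.mem_prod,
        Set.mem_ofPred_eq] at hc hc'
      replace hc := hc.1
      replace hc' := hc'.1
      simp only at heq
      have hs : s = s' := by simpa using congrFun heq u
      have ho : ∀ w, w ≠ u → c w = c' w := by
        intro w hw
        simpa [Function.update_of_ne hw] using congrFun heq w
      have hcc : c = c' := by
        funext w
        by_cases hw : w = u
        · rw [hw, hc, hc', ho v huv.symm]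
        · exact ho w hw
      rw [hs, hcc]
  rw [card_product] at h1
  simpa using h1

theorem aux_color {n : ℕ} {ι : Type} {ρ : (ι → ℝ) → ℝ} {q Q : ℝ} (h : ALat ρ q Q)
    (hq : 1 ≤ q) (hQ : 0 ≤ Q) (J : Fin n → ι → Prop) (U : ι → Prop) (hJU : ∀ v j, J v j → U j)
    (P : Finset (Fin n)) (hJP : ∀ v j, J v j → v ∈ P) (B M Y : ℝ) (hPB : (P.card : ℝ) ≤ B)
    (hM : ∀ j, ((univ.filter fun v => J v j).card : ℝ) ≤ M) (R : ℕ) (hR : 0 < R)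
    (hMR : 2 * M ≤ R) (hY : 0 ≤ Y) (hBY : B ^ (q - 1) * R ≤ Y ^ q) :
    ∑ v, ρ (aInd (J v)) ≤ 2 * (Y * (Q * ρ (aInd U))) := by
  have hq0 : 0 < q := by linarith
  let x : (Fin n → Fin R) → Fin n → ι → ℝ := fun c v =>
    aInd fun j => J v j ∧ ∀ u, u ≠ v → J u j → c u ≠ c v
  have step1 : ∀ c, ∑ v, ρ (x c v) ≤ Y * (Q * ρ (aInd U)) := by
    intro c
    let y : Fin R → Fin n → ι → ℝ := fun r v =>
      aInd fun j => c v = r ∧ J v j ∧ ∀ u, u ≠ v → J u j → c u ≠ r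
    have hy : ∀ r, ∑ v, ρ (y r v) ^ q ≤ Q ^ q * ρ (aInd U) ^ q := by
      intro r
      refine (h.cot n (y r) (fun i j => aInd_nonneg _ _)).trans ?_
      have hmono : ρ (∑ v, y r v) ≤ ρ (aInd U) := by
        apply h.mono
        · intro j
          rw [Finset.sum_apply]
          exact sum_nonneg fun v _ => aInd_nonneg _ _
        · intro j
          rw [Finset.sum_apply]
          by_cases hex : ∃ v, c v = r ∧ J v j ∧ ∀ u, u ≠ v → J u j → c u ≠ r
          · obtain ⟨v, hv⟩ := hex
            rw [sum_eq_single v]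
            · simp only [y, aInd, if_pos hv, if_pos (hJU v j hv.2.1)]; exact le_rfl
            · intro u _ huv
              simp only [y, aInd]
              rw [if_neg]
              rintro ⟨h1, h2, _⟩
              exact hv.2.2 u huv h2 h1
            · simp
          · rw [sum_eq_zero]
            · exact aInd_nonneg _ _
            · intro v _
              simp only [y, aInd]
              rw [if_neg]
              exact fun hv => hex ⟨v, hv⟩
      gcongr
      exact h.nonneg _
    have hxq : ∑ v, ρ (x c v) ^ q ≤ R * (Q ^ q * ρ (aInd U) ^ q) := by
      calc ∑ v, ρ (x c v) ^ q ≤ ∑ v, ∑ r, ρ (y r v) ^ q := by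
            refine sum_le_sum fun v _ => ?_
            have hxy : x c v = y (c v) v := by
              simp only [x, y, true_and]
            rw [hxy]
            exact single_le_sum (f := fun r => ρ (y r v) ^ q)
              (fun r _ => Real.rpow_nonneg (h.nonneg _) _) (mem_univ (c v))
        _ = ∑ r, ∑ v, ρ (y r v) ^ q := sum_comm
        _ ≤ ∑ r : Fin R, Q ^ q * ρ (aInd U) ^ q := sum_le_sum fun r _ => hy r
        _ = _ := by simp
    have hsumP : ∑ v, ρ (x c v) = ∑ v ∈ P, ρ (x c v) := by
      symm
      apply sum_subset (subset_univ _)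
      intro v _ hv
      have : x c v = 0 := by
        funext j
        simp only [x, aInd, Pi.zero_apply]
        rw [if_neg]
        exact fun hh => hv (hJP v j hh.1)
      rw [this, h.zero]
    have hpow : (∑ v, ρ (x c v)) ^ q ≤ (Y * (Q * ρ (aInd U))) ^ q := by
      calc (∑ v, ρ (x c v)) ^ q = (∑ v ∈ P, ρ (x c v)) ^ q := by rw [hsumP]
        _ ≤ (P.card : ℝ) ^ (q - 1) * ∑ v ∈ P, ρ (x c v) ^ q :=
            Real.rpow_sum_le_const_mul_sum_rpow_of_nonneg P hq (fun v _ => h.nonneg _)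
        _ ≤ B ^ (q - 1) * ∑ v, ρ (x c v) ^ q := by
            have h1 : ∑ v ∈ P, ρ (x c v) ^ q ≤ ∑ v, ρ (x c v) ^ q :=
              sum_le_sum_of_subset_of_nonneg (subset_univ _)
                (fun v _ _ => Real.rpow_nonneg (h.nonneg _) _)
            have h2 : (P.card : ℝ) ^ (q - 1) ≤ B ^ (q - 1) :=
              Real.rpow_le_rpow (by positivity) hPB (by linarith)
            have h3 : 0 ≤ ∑ v ∈ P, ρ (x c v) ^ q :=
              sum_nonneg fun v _ => Real.rpow_nonneg (h.nonneg _) _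
            exact mul_le_mul h2 h1 h3 (le_trans (by positivity) h2)
        _ ≤ B ^ (q - 1) * (R * (Q ^ q * ρ (aInd U) ^ q)) := by
            refine mul_le_mul_of_nonneg_left hxq (Real.rpow_nonneg (le_trans (by positivity) hPB) _)
        _ = (B ^ (q - 1) * R) * (Q ^ q * ρ (aInd U) ^ q) := by ring
        _ ≤ Y ^ q * (Q ^ q * ρ (aInd U) ^ q) := by
            refine mul_le_mul_of_nonneg_right hBY ?_
            exact mul_nonneg (Real.rpow_nonneg hQ _) (Real.rpow_nonneg (h.nonneg _) _)
        _ = _ := by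
            rw [Real.mul_rpow hY (mul_nonneg hQ (h.nonneg _)), Real.mul_rpow hQ (h.nonneg _)]
    exact (Real.rpow_le_rpow_iff (sum_nonneg fun v _ => h.nonneg _)
      (mul_nonneg hY (mul_nonneg hQ (h.nonneg _))) hq0).1 hpow
  have hRn : (0 : ℝ) < (R : ℝ) ^ n := by positivity
  have hRr : (0 : ℝ) < (R : ℝ) := by positivity
  have step2 : ∀ v, (R : ℝ) ^ n / 2 * ρ (aInd (J v)) ≤ ∑ c, ρ (x c v) := by
    intro v
    rw [← h.hom _ _ (by positivity)]
    refine le_trans (h.mono _ (∑ c, x c v) ?_ ?_) (h.sum _ _)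
    · intro j
      simp only [Pi.smul_apply, smul_eq_mul]
      exact mul_nonneg (by positivity) (aInd_nonneg _ _)
    · intro j
      rw [Finset.sum_apply]
      by_cases hv : J v j
      · have hs : ∑ c, x c v j = ((univ.filter fun c : Fin n → Fin R =>
            J v j ∧ ∀ u, u ≠ v → J u j → c u ≠ c v).card : ℝ) := by
          rw [card_filter]
          push_cast
          refine sum_congr rfl fun c _ => ?_
          simp only [x, aInd]
          congr
        rw [hs]
        simp only [Pi.smul_apply, smul_eq_mul, aInd, if_pos hv, mul_one]
        have hcov : (univ : Finset (Fin n → Fin R)) ⊆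
            (univ.filter fun c : Fin n → Fin R => J v j ∧ ∀ u, u ≠ v → J u j → c u ≠ c v) ∪
            ((univ.filter fun u => J u j).erase v).biUnion
              fun u => univ.filter fun c : Fin n → Fin R => c u = c v := by
          intro c _
          simp only [mem_union, mem_filter, mem_univ, true_and, mem_biUnion, mem_erase]
          by_cases hc : ∀ u, u ≠ v → J u j → c u ≠ c v
          · exact Or.inl ⟨hv, hc⟩
          · push Not at hc
            obtain ⟨u, h1, h2, h3⟩ := hc
            exact Or.inr ⟨u, ⟨h1, h2⟩, h3⟩
        have hc1 := (card_le_card hcov).trans (card_union_le _ _)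
        have hc2 : ((((univ.filter fun u => J u j).erase v).biUnion
              fun u => univ.filter fun c : Fin n → Fin R => c u = c v).card : ℝ) ≤
              (R : ℝ) ^ n / 2 := by
          calc _ ≤ ((∑ u ∈ (univ.filter fun u => J u j).erase v,
                (univ.filter fun c : Fin n → Fin R => c u = c v).card : ℕ) : ℝ) := by
                exact_mod_cast card_biUnion_le
            _ ≤ ∑ u ∈ (univ.filter fun u => J u j).erase v, (R : ℝ) ^ n / R := by
                push_cast
                refine sum_le_sum fun u hu => ?_
                rw [le_div_iff₀ hRr]
                exact_mod_cast aux_count u v (mem_erase.1 hu).1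
            _ = (((univ.filter fun u => J u j).erase v).card : ℝ) * ((R : ℝ) ^ n / R) := by simp
            _ ≤ M * ((R : ℝ) ^ n / R) := by
                gcongr
                refine le_trans ?_ (hM j)
                exact_mod_cast card_le_card (erase_subset _ _)
            _ ≤ (R / 2) * ((R : ℝ) ^ n / R) := by
                gcongr
                linarith
            _ = _ := by field_simp
        have hc3 : (R : ℝ) ^ n = ((univ : Finset (Fin n → Fin R)).card : ℝ) := by simp
        have hc4 : (R : ℝ) ^ n ≤
          ((univ.filter fun c : Fin n → Fin R => J v j ∧ ∀ u, u ≠ v → J u j → c u ≠ c v).card : ℝ) +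
          ((((univ.filter fun u => J u j).erase v).biUnion
              fun u => univ.filter fun c : Fin n → Fin R => c u = c v).card : ℝ) := by
          rw [hc3]
          exact_mod_cast hc1
        linarith
      · simp only [Pi.smul_apply, smul_eq_mul, aInd, if_neg hv, mul_zero]
        exact sum_nonneg fun c _ => aInd_nonneg _ _
  have step3 : (R : ℝ) ^ n / 2 * ∑ v, ρ (aInd (J v)) ≤ (R : ℝ) ^ n * (Y * (Q * ρ (aInd U))) := by
    calc (R : ℝ) ^ n / 2 * ∑ v, ρ (aInd (J v)) = ∑ v, (R : ℝ) ^ n / 2 * ρ (aInd (J v)) := mul_sum _ _ _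
      _ ≤ ∑ v, ∑ c, ρ (x c v) := sum_le_sum fun v _ => step2 v
      _ = ∑ c, ∑ v, ρ (x c v) := sum_comm
      _ ≤ ∑ c : Fin n → Fin R, Y * (Q * ρ (aInd U)) := sum_le_sum fun c _ => step1 c
      _ = _ := by simp
  have : (R : ℝ) ^ n * ∑ v, ρ (aInd (J v)) ≤ (R : ℝ) ^ n * (2 * (Y * (Q * ρ (aInd U)))) := by
    linarith
  exact le_of_mul_le_mul_left this hRn

theorem aux_num (d : ℕ) (hd : 3 ≤ d) (q α ε L δ : ℝ) (hq : 1 ≤ q) (hα : 0 < α ∧ α ≤ 1)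
    (hε : 0 < ε ∧ ε ≤ 1) (hL : 1 ≤ L) (hδ : δ = ε / (4 * d * q)) (r : ℕ) :
    3 * (128 / (α * (δ * (1 - δ) ^ r)) * (L * ((d : ℝ) - 1 - ε) ^ (r + 1))) ≤
      (4 * ((d : ℝ) - 1) ^ r) *
        ((96 * L * d / (α * δ)) * (1 - 3 * δ) ^ r) ^ q := by
  have hd' : (3 : ℝ) ≤ d := by exact_mod_cast hd
  obtain ⟨hα0, hα1⟩ := hα
  obtain ⟨hε0, hε1⟩ := hε
  have hq0 : 0 < q := by linarith
  have hδ0 : 0 < δ := by rw [hδ]; positivity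
  have hδdq : δ * d * q = ε / 4 := by rw [hδ]; field_simp
  have hδd : δ * d ≤ ε / 4 := by
    rw [← hδdq]; exact le_mul_of_one_le_right (by positivity) hq
  have hδ1 : δ ≤ 1 / 12 := by nlinarith
  have hz0 : 0 < 1 - 3 * δ := by linarith
  set D := 96 * L * d / (α * δ) with hD
  have hαδ : α * δ ≤ 1 := by nlinarith
  have hD1 : 1 ≤ D := by
    rw [hD, le_div_iff₀ (by positivity)]
    nlinarith
  have hDq : D ≤ D ^ q := by
    calc D = D ^ (1 : ℝ) := (Real.rpow_one D).symm
      _ ≤ D ^ q := Real.rpow_le_rpow_of_exponent_le hD1 hq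
  have hbern : 1 - 3 * δ * q ≤ (1 - 3 * δ) ^ q := by
    have := one_add_mul_self_le_rpow_one_add (s := -(3 * δ)) (by linarith) hq
    calc 1 - 3 * δ * q = 1 + q * -(3 * δ) := by ring
      _ ≤ (1 + -(3 * δ)) ^ q := this
      _ = _ := by ring_nf
  have hkey : (d : ℝ) - 1 - ε ≤ ((d : ℝ) - 1) * (1 - δ) * (1 - 3 * δ) ^ q := by
    calc (d : ℝ) - 1 - ε ≤ ((d : ℝ) - 1) * (1 - δ) * (1 - 3 * δ * q) := by
          have h1 : ((d : ℝ) - 1) * (δ + 3 * δ * q) ≤ ε := by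
            nlinarith [mul_pos hδ0 hq0]
          have h2 : 0 ≤ ((d : ℝ) - 1) * (δ * (3 * δ * q)) := by
            have : 0 ≤ (d : ℝ) - 1 := by linarith
            positivity
          nlinarith
      _ ≤ _ := by
          refine mul_le_mul_of_nonneg_left hbern ?_
          exact mul_nonneg (by linarith) (by linarith)
  have hbe : 0 ≤ (d : ℝ) - 1 - ε := by linarith
  have hpow : ((d : ℝ) - 1 - ε) ^ r ≤
      ((d : ℝ) - 1) ^ r * (1 - δ) ^ r * ((1 - 3 * δ) ^ r) ^ q := by
    calc ((d : ℝ) - 1 - ε) ^ r ≤ (((d : ℝ) - 1) * (1 - δ) * (1 - 3 * δ) ^ q) ^ r :=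
          pow_le_pow_left₀ hbe hkey r
      _ = _ := by
          rw [mul_pow, mul_pow]
          congr 1
          rw [← Real.rpow_natCast, ← Real.rpow_mul hz0.le, ← Real.rpow_natCast,
            ← Real.rpow_mul hz0.le, mul_comm q (r : ℝ)]
  have h1δ : 0 < (1 - δ) ^ r := pow_pos (by linarith) _
  have hzr : 0 ≤ ((1 - 3 * δ) ^ r) ^ q := Real.rpow_nonneg (pow_nonneg hz0.le _) _
  have hb0 : 0 ≤ ((d : ℝ) - 1) ^ r := pow_nonneg (by linarith) _
  rw [Real.mul_rpow (by linarith) (pow_nonneg hz0.le _)]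
  calc 3 * (128 / (α * (δ * (1 - δ) ^ r)) * (L * ((d : ℝ) - 1 - ε) ^ (r + 1)))
      = 384 * L / (α * (δ * (1 - δ) ^ r)) * (((d : ℝ) - 1 - ε) ^ r * ((d : ℝ) - 1 - ε)) := by
        rw [pow_succ]; ring
    _ ≤ 384 * L / (α * (δ * (1 - δ) ^ r)) *
        ((((d : ℝ) - 1) ^ r * (1 - δ) ^ r * ((1 - 3 * δ) ^ r) ^ q) * d) := by
        gcongr
        linarith
    _ = (4 * ((d : ℝ) - 1) ^ r) * (D * ((1 - 3 * δ) ^ r) ^ q) := by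
        rw [hD]; field_simp; ring
    _ ≤ _ := by gcongr

theorem aux_level {n d : ℕ} (hd : 3 ≤ d) (G : SimpleGraph (Fin n)) [DecidableRel G.Adj]
    (hreg : ∀ v, G.degree v = d) {ι : Type} {ρ : (ι → ℝ) → ℝ} {q Q : ℝ}
    (h : ALat ρ q Q) (hq : 1 ≤ q) (hQ : 0 ≤ Q)
    (α δ ε L : ℝ) (hα : 0 < α ∧ α ≤ 1)
    (hε : 0 < ε ∧ ε ≤ 1) (hL : 1 ≤ L) (hδ : δ = ε / (4 * d * q))
    (A : ι → Finset (Fin n)) (sc : ι → Fin n → ℕ) (Et : ι → Fin n → Finset (Sym2 (Fin n)))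
    (h1 : ∀ j, ∀ v ∈ A j, Et j v ⊆ aBd G (A j) ∩ aNear G (sc j v) v ∧
        α / 16 * (δ * (1 - δ) ^ sc j v) * ((d : ℝ) - 1) ^ sc j v / 2 ≤ ((Et j v).card : ℝ))
    (h2 : ∀ j r e, ((univ.filter fun v => v ∈ A j ∧ sc j v = r ∧ e ∈ Et j v).card : ℝ) ≤
        128 / (α * (δ * (1 - δ) ^ r)) * (L * ((d : ℝ) - 1 - ε) ^ (r + 1))) (r : ℕ) :
    ∑ v, ρ (aInd fun j => v ∈ A j ∧ sc j v = r) ≤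
      256 * (96 * L * d / (α * δ)) * Q / (α * δ) * (1 - δ) ^ r *
        ∑ e ∈ G.edgeFinset, ρ (aInd fun j => e ∈ aBd G (A j)) := by
  have hd' : (3 : ℝ) ≤ d := by exact_mod_cast hd
  have hb : (2 : ℝ) ≤ (d : ℝ) - 1 := by linarith
  have hb0 : 0 < ((d : ℝ) - 1) ^ r := pow_pos (by linarith) _
  have hα0 := hα.1
  have hε0 := hε.1
  have hq0 : 0 < q := by linarith
  have hδ0 : 0 < δ := by rw [hδ]; positivity
  have hδ1 : δ ≤ 1 / 12 := by
    rw [hδ, div_le_iff₀ (by positivity)]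
    nlinarith [hε.2]
  have h1δ : 0 < (1 - δ) ^ r := pow_pos (by linarith) _
  have hnum := aux_num d hd q α ε L δ hq hα hε hL hδ r
  set D := 96 * L * d / (α * δ) with hD
  have hD0 : 0 < D := by positivity
  set M := 128 / (α * (δ * (1 - δ) ^ r)) * (L * ((d : ℝ) - 1 - ε) ^ (r + 1)) with hM
  have hM1 : 1 ≤ M := by
    have ha1 : α * (δ * (1 - δ) ^ r) ≤ 1 := by
      have : (1 - δ) ^ r ≤ 1 := pow_le_one₀ (by linarith) (by linarith)
      have h3 : δ * (1 - δ) ^ r ≤ 1 := by nlinarith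
      have h4 : 0 < δ * (1 - δ) ^ r := by positivity
      nlinarith [hα.2]
    have h3 : 1 ≤ 128 / (α * (δ * (1 - δ) ^ r)) := by
      rw [le_div_iff₀ (by positivity)]; linarith
    have h4 : 1 ≤ ((d : ℝ) - 1 - ε) ^ (r + 1) := one_le_pow₀ (by linarith [hε.2])
    calc (1 : ℝ) = 1 * (1 * 1) := by ring
      _ ≤ M := by rw [hM]; gcongr
  set z := (1 - 3 * δ) ^ r with hz
  have hz0 : 0 < z := pow_pos (by linarith) _
  set B := 4 * ((d : ℝ) - 1) ^ r with hB
  have hB0 : 0 < B := by positivity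
  set τ := α / 16 * (δ * (1 - δ) ^ r) * ((d : ℝ) - 1) ^ r with hτ
  have hτ0 : 0 < τ := by positivity
  have hb1 : ∀ v, τ / 2 * ρ (aInd fun j => v ∈ A j ∧ sc j v = r) ≤
      ∑ e ∈ G.edgeFinset, ρ (aInd fun j => v ∈ A j ∧ sc j v = r ∧ e ∈ Et j v) := by
    intro v
    rw [← h.hom _ _ (by positivity)]
    refine le_trans (h.mono _ (∑ e ∈ G.edgeFinset,
      aInd fun j => v ∈ A j ∧ sc j v = r ∧ e ∈ Et j v) ?_ ?_) (h.sum _ _)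
    · intro j
      simp only [Pi.smul_apply, smul_eq_mul]
      exact mul_nonneg (by positivity) (aInd_nonneg _ _)
    · intro j
      rw [Finset.sum_apply]
      by_cases hv : v ∈ A j ∧ sc j v = r
      · simp only [Pi.smul_apply, smul_eq_mul, aInd, if_pos hv, mul_one]
        obtain ⟨h3, h4⟩ := h1 j v hv.1
        rw [hv.2] at h4
        refine h4.trans ?_
        have h5 : ((Et j v).card : ℝ) = ∑ e ∈ Et j v, (1 : ℝ) := by simp
        rw [h5]
        have hsub : Et j v ⊆ G.edgeFinset := fun e he =>
          (mem_filter.1 (mem_inter.1 (h3 he)).1).1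
        calc ∑ e ∈ Et j v, (1 : ℝ) ≤ ∑ e ∈ Et j v,
              (if v ∈ A j ∧ sc j v = r ∧ e ∈ Et j v then (1 : ℝ) else 0) := by
              refine sum_le_sum fun e he => ?_
              rw [if_pos ⟨hv.1, hv.2, he⟩]
          _ ≤ _ := by
              refine le_trans (sum_le_sum_of_subset_of_nonneg hsub ?_) (le_of_eq ?_)
              · intro e _ _; split_ifs <;> norm_num
              · refine sum_congr rfl fun e _ => ?_
                congr
      · simp only [Pi.smul_apply, smul_eq_mul, aInd, if_neg hv, mul_zero]
        exact sum_nonneg fun c _ => aInd_nonneg _ _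
  have hc1 : ∀ e ∈ G.edgeFinset,
      ∑ v, ρ (aInd fun j => v ∈ A j ∧ sc j v = r ∧ e ∈ Et j v) ≤
        2 * ((B * (D * z)) * (Q * ρ (aInd fun j => e ∈ aBd G (A j)))) := by
    intro e he
    refine aux_color h hq hQ (fun v j => v ∈ A j ∧ sc j v = r ∧ e ∈ Et j v)
      (fun j => e ∈ aBd G (A j)) ?_ (aBall G e r) ?_ B M (B * (D * z)) ?_ ?_ ⌈2 * M⌉₊ ?_ ?_ ?_ ?_
    · rintro v j ⟨h3, h4, h5⟩
      exact (mem_inter.1 ((h1 j v h3).1 h5)).1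
    · rintro v j ⟨h3, h4, h5⟩
      have := (mem_inter.1 ((h1 j v h3).1 h5)).2
      rw [h4] at this
      simp only [aBall, mem_filter, mem_univ, true_and]
      exact (mem_filter.1 this).2
    · have := aux_ball hd G hreg e (by simpa using he) r
      calc ((aBall G e r).card : ℝ) ≤ ((4 * (d - 1) ^ r : ℕ) : ℝ) := by exact_mod_cast this
        _ = B := by rw [hB]; push_cast [Nat.cast_sub (by omega : 1 ≤ d)]; ring
    · intro j
      refine le_trans (le_of_eq ?_) (h2 j r e)
      congr
    · exact Nat.ceil_pos.2 (by linarith)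
    · exact Nat.le_ceil _
    · positivity
    · have hR : ((⌈2 * M⌉₊ : ℕ) : ℝ) ≤ 3 * M := by
        have := Nat.ceil_lt_add_one (a := 2 * M) (by linarith)
        linarith
      calc B ^ (q - 1) * ((⌈2 * M⌉₊ : ℕ) : ℝ) ≤ B ^ (q - 1) * (B * (D * z) ^ q) := by
            gcongr
            exact hR.trans hnum
        _ = B ^ q * (D * z) ^ q := by
            rw [← mul_assoc]
            congr 1
            nth_rewrite 2 [← Real.rpow_one B]
            rw [← Real.rpow_add hB0]
            ring_nf
        _ = _ := by rw [Real.mul_rpow hB0.le (by positivity)]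
  set W := ∑ e ∈ G.edgeFinset, ρ (aInd fun j => e ∈ aBd G (A j)) with hW
  have hW0 : 0 ≤ W := sum_nonneg fun e _ => h.nonneg _
  have hfin : τ / 2 * ∑ v, ρ (aInd fun j => v ∈ A j ∧ sc j v = r) ≤ 2 * (B * (D * z)) * Q * W := by
    calc _ = ∑ v, τ / 2 * ρ (aInd fun j => v ∈ A j ∧ sc j v = r) := mul_sum _ _ _
      _ ≤ ∑ v, ∑ e ∈ G.edgeFinset, ρ (aInd fun j => v ∈ A j ∧ sc j v = r ∧ e ∈ Et j v) :=
          sum_le_sum fun v _ => hb1 v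
      _ = ∑ e ∈ G.edgeFinset, ∑ v, ρ (aInd fun j => v ∈ A j ∧ sc j v = r ∧ e ∈ Et j v) := sum_comm
      _ ≤ ∑ e ∈ G.edgeFinset, 2 * ((B * (D * z)) * (Q * ρ (aInd fun j => e ∈ aBd G (A j)))) :=
          sum_le_sum hc1
      _ = _ := by
          rw [hW, mul_sum]
          refine sum_congr rfl fun e _ => by ring
  have hzz : z ≤ (1 - δ) ^ r * (1 - δ) ^ r := by
    rw [hz, ← mul_pow]
    refine pow_le_pow_left₀ (by linarith) ?_ r
    nlinarith
  have hgoal : τ / 2 * (256 * D * Q / (α * δ) * (1 - δ) ^ r * W) =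
      2 * (B * (D * ((1 - δ) ^ r * (1 - δ) ^ r))) * Q * W := by
    rw [hτ, hB]
    field_simp
    ring
  refine le_of_mul_le_mul_left ?_ (by positivity : 0 < τ / 2)
  rw [hgoal]
  refine hfin.trans ?_
  gcongr

theorem aux_main {n d : ℕ} (hd : 3 ≤ d) (G : SimpleGraph (Fin n)) [DecidableRel G.Adj]
    (hreg : ∀ v, G.degree v = d) {ι : Type} [Fintype ι] {ρ : (ι → ℝ) → ℝ} {q Q : ℝ}
    (h : ALat ρ q Q) (hq : 1 ≤ q) (hQ : 0 ≤ Q)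
    (α δ ε L : ℝ) (hα : 0 < α ∧ α ≤ 1)
    (hε : 0 < ε ∧ ε ≤ 1) (hL : 1 ≤ L) (hδ : δ = ε / (4 * d * q))
    (hE : Expan n d G α ε L)
    (A : ι → Finset (Fin n)) (hA : ∀ j, 2 * (A j).card ≤ n) :
    ∑ v, ρ (aInd fun j => v ∈ A j) ≤
      256 * (96 * L * d / (α * δ)) * Q / (α * δ) / δ *
        ∑ e ∈ G.edgeFinset, ρ (aInd fun j => e ∈ aBd G (A j)) := by
  have hd' : (3 : ℝ) ≤ d := by exact_mod_cast hd
  have hα0 := hα.1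
  have hε0 := hε.1
  have hq0 : 0 < q := by linarith
  have hδ0 : 0 < δ := by rw [hδ]; positivity
  have hδ1 : δ ≤ 1 / 12 := by
    rw [hδ, div_le_iff₀ (by positivity)]
    nlinarith [hε.2]
  choose sc Et h1 h2 using fun j =>
    aux_data hd G hreg α δ ε L hα ⟨hδ0, by linarith⟩ hε hL hE (A j) (hA j)
  obtain ⟨Λ, hΛ⟩ : ∃ Λ, ∀ j v, sc j v < Λ :=
    ⟨(univ.sup fun p : ι × Fin n => sc p.1 p.2) + 1, fun j v =>
      Nat.lt_succ_of_le (le_sup (f := fun p : ι × Fin n => sc p.1 p.2) (mem_univ (j, v)))⟩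
  have hlev := aux_level hd G hreg h hq hQ α δ ε L hα hε hL hδ A sc Et h1 h2
  set W := ∑ e ∈ G.edgeFinset, ρ (aInd fun j => e ∈ aBd G (A j)) with hW
  have hW0 : 0 ≤ W := sum_nonneg fun e _ => h.nonneg _
  set H := 256 * (96 * L * d / (α * δ)) * Q / (α * δ) with hH
  have hH0 : 0 ≤ H := by positivity
  have hgeo : ∑ r ∈ range Λ, (1 - δ) ^ r ≤ 1 / δ := by
    rw [le_div_iff₀ hδ0, mul_comm]
    have := mul_neg_geom_sum (1 - δ) Λ
    rw [sub_sub_cancel] at this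
    rw [this]
    have : 0 ≤ (1 - δ) ^ Λ := pow_nonneg (by linarith) _
    linarith
  calc ∑ v, ρ (aInd fun j => v ∈ A j)
      ≤ ∑ v, ∑ r ∈ range Λ, ρ (aInd fun j => v ∈ A j ∧ sc j v = r) := by
        refine sum_le_sum fun v _ => ?_
        refine le_trans (h.mono _ (∑ r ∈ range Λ, aInd fun j => v ∈ A j ∧ sc j v = r)
          (fun j => aInd_nonneg _ _) ?_) (h.sum _ _)
        intro j
        rw [Finset.sum_apply]
        by_cases hv : v ∈ A j
        · refine le_trans ?_ (single_le_sum (f := fun r => aInd (fun j => v ∈ A j ∧ sc j v = r) j)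
            (fun r _ => aInd_nonneg _ _) (mem_range.2 (hΛ j v)))
          simp [aInd, hv]
        · simp only [aInd, if_neg hv]
          exact sum_nonneg fun c _ => aInd_nonneg _ _
    _ = ∑ r ∈ range Λ, ∑ v, ρ (aInd fun j => v ∈ A j ∧ sc j v = r) := sum_comm
    _ ≤ ∑ r ∈ range Λ, H * (1 - δ) ^ r * W := sum_le_sum fun r _ => hlev r
    _ = H * (∑ r ∈ range Λ, (1 - δ) ^ r) * W := by rw [← sum_mul, ← mul_sum]
    _ ≤ H * (1 / δ) * W := by gcongr
    _ = H / δ * W := by ring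

theorem aux_median {n : ℕ} (hn : 0 < n) (g : Fin n → ℝ) : ∃ a : ℝ,
    2 * (univ.filter fun v => a < g v).card ≤ n ∧ 2 * (univ.filter fun v => g v < a).card ≤ n := by
  have hne : (univ.image g).Nonempty := ⟨g ⟨0, hn⟩, mem_image_of_mem _ (mem_univ _)⟩
  let T := (univ.image g).filter fun a => 2 * (univ.filter fun v => a < g v).card ≤ n
  have hT : T.Nonempty := by
    refine ⟨(univ.image g).max' hne, mem_filter.2 ⟨max'_mem _ _, ?_⟩⟩
    rw [filter_false_of_mem]
    · simp
    · intro v _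
      exact not_lt.2 (le_max' _ _ (mem_image_of_mem _ (mem_univ _)))
  refine ⟨T.min' hT, (mem_filter.1 (min'_mem T hT)).2, ?_⟩
  set a := T.min' hT with ha
  let W := univ.filter fun v => g v < a
  by_cases hW : (W.image g).Nonempty
  · let b := (W.image g).max' hW
    have hbm : b ∈ W.image g := max'_mem _ _
    obtain ⟨u, hu, hub⟩ := mem_image.1 hbm
    have hba : b < a := by rw [← hub]; exact (mem_filter.1 hu).2
    have hbT : b ∉ T := fun hb => not_lt.2 (min'_le T b hb) hba
    have hb2 : ¬ 2 * (univ.filter fun v => b < g v).card ≤ n := fun hh =>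
      hbT (mem_filter.2 ⟨by rw [← hub]; exact mem_image_of_mem _ (mem_univ _), hh⟩)
    have hdisj : Disjoint (univ.filter fun v => g v < a) (univ.filter fun v => b < g v) := by
      rw [disjoint_left]
      intro v hv hv'
      have h1 : g v ≤ b := le_max' _ _ (mem_image_of_mem g hv)
      exact absurd (mem_filter.1 hv').2 (not_lt.2 h1)
    have := card_le_univ ((univ.filter fun v => g v < a) ∪ (univ.filter fun v => b < g v))
    rw [card_union_of_disjoint hdisj, Fintype.card_fin] at this
    omega
  · have : W = ∅ := by
      rw [not_nonempty_iff_eq_empty, image_eq_empty] at hW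
      exact hW
    change 2 * W.card ≤ n
    rw [this]; simp

theorem aux_layer {n : ℕ} (g : Fin n → ℝ) (hg : ∀ v, 0 ≤ g v) :
    ∃ (m : ℕ) (c : Fin m → ℝ) (B : Fin m → Finset (Fin n)), (∀ i, 0 ≤ c i) ∧
      (∀ i, B i ⊆ univ.filter fun v => 0 < g v) ∧
      (∀ v, ∑ i, c i * (if v ∈ B i then 1 else 0) = g v) ∧
      ∀ v w, ∑ i, c i * (if ¬ (v ∈ B i ↔ w ∈ B i) then 1 else 0) = |g v - g w| := by
  induction hc : (univ.filter fun v => 0 < g v).card using Nat.strong_induction_on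
    generalizing g with
  | _ N ih =>
    set s := univ.filter fun v => 0 < g v with hs
    have hms : ∀ v, v ∈ s ↔ 0 < g v := fun v => by simp [hs]
    have hz : ∀ v, v ∉ s → g v = 0 := fun v hv => le_antisymm (not_lt.1 fun h => hv ((hms v).2 h)) (hg v)
    by_cases hne : s.Nonempty
    · obtain ⟨u, hu, hmin⟩ := exists_min_image s g hne
      have hu0 : 0 < g u := (hms u).1 hu
      let g' : Fin n → ℝ := fun v => g v - g u * (if v ∈ s then 1 else 0)
      have hg'1 : ∀ v ∈ s, g' v = g v - g u := fun v hv => by simp [g', hv]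
      have hg'2 : ∀ v, v ∉ s → g' v = 0 := fun v hv => by simp [g', hv, hz v hv]
      have hg' : ∀ v, 0 ≤ g' v := by
        intro v
        by_cases hv : v ∈ s
        · rw [hg'1 v hv]; linarith [hmin v hv]
        · rw [hg'2 v hv]
      have hsub : (univ.filter fun v => 0 < g' v) ⊆ s := by
        intro v hv
        by_contra hvs
        have := (mem_filter.1 hv).2
        rw [hg'2 v hvs] at this
        exact lt_irrefl _ this
      have hlt : (univ.filter fun v => 0 < g' v).card < N := by
        rw [← hc]
        apply card_lt_card
        refine ⟨hsub, fun hh => ?_⟩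
        have := (mem_filter.1 (hh hu)).2
        rw [hg'1 u hu] at this
        simp at this
      obtain ⟨m, c, B, h1, h2, h3, h4⟩ := ih _ hlt g' hg' rfl
      refine ⟨m + 1, Fin.cons (g u) c, Fin.cons s B, ?_, ?_, ?_, ?_⟩
      · intro i
        refine Fin.cases ?_ (fun i => ?_) i
        · simpa using hu0.le
        · simpa using h1 i
      · intro i
        refine Fin.cases ?_ (fun i => ?_) i
        · simp
        · simpa using (h2 i).trans hsub
      · intro v
        rw [Fin.sum_univ_succ]
        simp only [Fin.cons_zero, Fin.cons_succ]
        rw [h3 v]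
        simp only [g']
        ring
      · intro v w
        rw [Fin.sum_univ_succ]
        simp only [Fin.cons_zero, Fin.cons_succ]
        rw [h4 v w]
        by_cases hv : v ∈ s <;> by_cases hw : w ∈ s
        · rw [hg'1 v hv, hg'1 w hw]; simp [hv, hw]
        · rw [hg'1 v hv, hg'2 w hw, hz w hw]
          simp only [hv, hw]
          have := hmin v hv
          simp
          rw [abs_of_nonneg (by linarith), abs_of_nonneg (hg v)]; ring
        · rw [hg'2 v hv, hg'1 w hw, hz v hv]
          simp only [hv, hw]
          have := hmin w hw
          simp
          rw [abs_of_nonpos (by linarith), abs_of_nonneg (hg w)]; ring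
        · rw [hg'2 v hv, hg'2 w hw, hz v hv, hz w hw]; simp [hv, hw]
    · refine ⟨0, fun i => i.elim0, fun i => i.elim0, fun i => i.elim0, fun i => i.elim0, ?_, ?_⟩
      · intro v
        rw [hz v fun h => hne ⟨v, h⟩]; simp
      · intro v w
        rw [hz v fun h => hne ⟨v, h⟩, hz w fun h => hne ⟨w, h⟩]; simp

theorem aux_signed {n : ℕ} (g : Fin n → ℝ) (h1 : 2 * (univ.filter fun v => 0 < g v).card ≤ n)
    (h2 : 2 * (univ.filter fun v => g v < 0).card ≤ n) :
    ∃ (I : Type) (_ : Fintype I) (c : I → ℝ) (B : I → Finset (Fin n)), (∀ i, 0 ≤ c i) ∧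
      (∀ i, 2 * (B i).card ≤ n) ∧
      (∀ v, |g v| ≤ ∑ i, c i * (if v ∈ B i then 1 else 0)) ∧
      ∀ v w, ∑ i, c i * (if ¬ (v ∈ B i ↔ w ∈ B i) then 1 else 0) ≤ |g v - g w| := by
  obtain ⟨m, c, B, p1, p2, p3, p4⟩ := aux_layer (fun v => max (g v) 0) (fun v => le_max_right _ _)
  obtain ⟨m', c', B', q1, q2, q3, q4⟩ :=
    aux_layer (fun v => max (-g v) 0) (fun v => le_max_right _ _)
  refine ⟨Fin m ⊕ Fin m', inferInstance, Sum.elim c c', Sum.elim B B', ?_, ?_, ?_, ?_⟩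
  · rintro (i | i)
    · exact p1 i
    · exact q1 i
  · rintro (i | i)
    · refine le_trans (Nat.mul_le_mul_left 2 (card_le_card ((p2 i).trans ?_))) h1
      intro v hv
      simpa using hv
    · refine le_trans (Nat.mul_le_mul_left 2 (card_le_card ((q2 i).trans ?_))) h2
      intro v hv
      simpa using hv
  · intro v
    have hs : ∑ i : Fin m ⊕ Fin m', (Sum.elim c c' i) * (if v ∈ Sum.elim B B' i then 1 else 0) =
        max (g v) 0 + max (-g v) 0 := by
      rw [Fintype.sum_sum_type, ← p3 v, ← q3 v]; rfl
    rw [hs]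
    rcases le_total 0 (g v) with h | h
    · rw [abs_of_nonneg h]; linarith [le_max_left (g v) 0, le_max_right (-g v) 0]
    · rw [abs_of_nonpos h]; linarith [le_max_right (g v) 0, le_max_left (-g v) 0]
  · intro v w
    have hs : ∑ i : Fin m ⊕ Fin m', (Sum.elim c c' i) *
        (if ¬ (v ∈ Sum.elim B B' i ↔ w ∈ Sum.elim B B' i) then 1 else 0) =
        |max (g v) 0 - max (g w) 0| + |max (-g v) 0 - max (-g w) 0| := by
      rw [Fintype.sum_sum_type, ← p4 v w, ← q4 v w]; rfl
    rw [hs]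
    rcases le_total 0 (g v) with h | h <;> rcases le_total 0 (g w) with h' | h'
    · rw [max_eq_left h, max_eq_left h', max_eq_right (by linarith), max_eq_right (by linarith)]
      simp
    · rw [max_eq_left h, max_eq_right h', max_eq_right (by linarith), max_eq_left (by linarith)]
      rw [abs_of_nonneg (by linarith), abs_of_nonpos (by linarith), abs_of_nonneg (by linarith)]
      linarith
    · rw [max_eq_right h, max_eq_left h', max_eq_left (by linarith), max_eq_right (by linarith)]
      rw [abs_of_nonpos (by linarith), abs_of_nonneg (by linarith), abs_of_nonpos (by linarith)]
      linarith
    · rw [max_eq_right h, max_eq_right h', max_eq_left (by linarith), max_eq_left (by linarith)]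
      rw [sub_self, abs_zero, zero_add, ← abs_neg]
      apply le_of_eq
      congr 1
      ring

noncomputable def aSg {k : ℕ} (σ : Fin k → Bool) (x : Fin k → ℝ) : Fin k → ℝ :=
  fun j => (if σ j then (1 : ℝ) else -1) * x j

noncomputable def aRen {k : ℕ} (N : (Fin k → ℝ) → ℝ) (x : Fin k → ℝ) : ℝ :=
  (univ : Finset (Fin k → Bool)).sup' univ_nonempty fun σ => N (aSg σ x)

theorem aRen_le {k : ℕ} {N : (Fin k → ℝ) → ℝ} {x : Fin k → ℝ} {t : ℝ}
    (h : ∀ σ, N (aSg σ x) ≤ t) : aRen N x ≤ t := sup'_le _ _ fun σ _ => h σ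

theorem le_aRen {k : ℕ} (N : (Fin k → ℝ) → ℝ) (x : Fin k → ℝ) (σ : Fin k → Bool) :
    N (aSg σ x) ≤ aRen N x := le_sup' (fun σ => N (aSg σ x)) (mem_univ σ)

theorem aRen_self {k : ℕ} (N : (Fin k → ℝ) → ℝ) (x : Fin k → ℝ) : N x ≤ aRen N x := by
  have := le_aRen N x (fun _ => true)
  have h2 : aSg (fun _ => true) x = x := by funext j; simp [aSg]
  rwa [h2] at this

theorem aRen_sg {k : ℕ} (N : (Fin k → ℝ) → ℝ) (x : Fin k → ℝ) (τ : Fin k → Bool) :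
    aRen N (aSg τ x) ≤ aRen N x := by
  refine aRen_le fun σ => ?_
  have : aSg σ (aSg τ x) = aSg (fun j => σ j == τ j) x := by
    funext j
    simp only [aSg]
    by_cases h1 : σ j = true <;> by_cases h2 : τ j = true <;> simp_all
  rw [this]
  exact le_aRen N x _

theorem aRen_add {k : ℕ} {N : (Fin k → ℝ) → ℝ} (hN : IsNorm k N) (x y : Fin k → ℝ) :
    aRen N (x + y) ≤ aRen N x + aRen N y := by
  refine aRen_le fun σ => ?_
  have : aSg σ (x + y) = aSg σ x + aSg σ y := by
    funext j; simp [aSg, mul_add]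
  rw [this]
  exact (hN.2.2 _ _).trans (add_le_add (le_aRen _ _ _) (le_aRen _ _ _))

theorem aRen_smul_le {k : ℕ} {N : (Fin k → ℝ) → ℝ} (hN : IsNorm k N) (c : ℝ) (hc : 0 ≤ c)
    (x : Fin k → ℝ) : aRen N (c • x) ≤ c * aRen N x := by
  refine aRen_le fun σ => ?_
  have : aSg σ (c • x) = c • aSg σ x := by
    funext j; simp [aSg]
  rw [this, hN.2.1, abs_of_nonneg hc]
  exact mul_le_mul_of_nonneg_left (le_aRen _ _ _) hc

theorem aux_norm_nonneg {k : ℕ} {N : (Fin k → ℝ) → ℝ} (hN : IsNorm k N) (x : Fin k → ℝ) :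
    0 ≤ N x := by
  have h1 := hN.2.2 x ((-1 : ℝ) • x)
  rw [hN.2.1] at h1
  have h2 : x + (-1 : ℝ) • x = 0 := by simp
  rw [h2, (hN.1 0).2 rfl] at h1
  norm_num at h1
  linarith

theorem aRen_nonneg {k : ℕ} {N : (Fin k → ℝ) → ℝ} (hN : IsNorm k N) (x : Fin k → ℝ) :
    0 ≤ aRen N x := (aux_norm_nonneg hN x).trans (aRen_self N x)

theorem aRen_smul {k : ℕ} {N : (Fin k → ℝ) → ℝ} (hN : IsNorm k N) (c : ℝ) (hc : 0 ≤ c)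
    (x : Fin k → ℝ) : aRen N (c • x) = c * aRen N x := by
  rcases hc.eq_or_lt with rfl | hc'
  · exact le_antisymm (aRen_smul_le hN 0 le_rfl x) (by rw [zero_mul]; exact aRen_nonneg hN _)
  · refine le_antisymm (aRen_smul_le hN c hc x) ?_
    have := aRen_smul_le hN c⁻¹ (by positivity) (c • x)
    rw [smul_smul, inv_mul_cancel₀ hc'.ne', one_smul] at this
    calc c * aRen N x ≤ c * (c⁻¹ * aRen N (c • x)) := by gcongr
      _ = _ := by field_simp

theorem aRen_K {k : ℕ} {N : (Fin k → ℝ) → ℝ} {K : ℝ} (hK : UncondConst k N K) (x : Fin k → ℝ) :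
    aRen N x ≤ K * N x := aRen_le fun σ => hK σ x

theorem aRen_mono {k : ℕ} {N : (Fin k → ℝ) → ℝ} (hN : IsNorm k N) (x y : Fin k → ℝ)
    (h : ∀ j, |x j| ≤ |y j|) : aRen N x ≤ aRen N y := by
  have key : ∀ s : Finset (Fin k), aRen N (fun j => if j ∈ s then x j else y j) ≤ aRen N y := by
    intro s
    induction s using Finset.induction_on with
    | empty => simp
    | insert a s ha ih =>
      set z : Fin k → ℝ := fun j => if j ∈ s then x j else y j with hz
      have hza : z a = y a := by simp [hz, ha]
      obtain ⟨t, ht0, ht1, ht⟩ : ∃ t : ℝ, 0 ≤ t ∧ t ≤ 1 ∧ x a = (2 * t - 1) * y a := by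
        by_cases hy : y a = 0
        · refine ⟨0, le_rfl, zero_le_one, ?_⟩
          have := h a
          rw [hy] at this
          simp at this
          simp [this, hy]
        · have h1 : |x a / y a| ≤ 1 := by
            rw [abs_div, div_le_one (abs_pos.2 hy)]; exact h a
          rw [abs_le] at h1
          refine ⟨(1 + x a / y a) / 2, by linarith, by linarith, ?_⟩
          field_simp
          ring
      have hdec : (fun j => if j ∈ insert a s then x j else y j) =
          t • z + (1 - t) • aSg (fun j => decide (j ≠ a)) z := by
        funext j
        by_cases hj : j = a
        · subst hj
          simp only [mem_insert_self, if_true, Pi.add_apply, Pi.smul_apply, smul_eq_mul, aSg, hza, ht]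
          simp
          ring
        · simp only [mem_insert, hj, false_or, Pi.add_apply, Pi.smul_apply, smul_eq_mul, aSg, hz]
          simp [hj]
          split_ifs <;> ring
      rw [hdec]
      refine (aRen_add hN _ _).trans ?_
      rw [aRen_smul hN t ht0, aRen_smul hN (1 - t) (by linarith)]
      have h2 := (aRen_sg N z (fun j => decide (j ≠ a))).trans ih
      have h3 : t * aRen N z ≤ t * aRen N y := by gcongr
      have h4 : (1 - t) * aRen N (aSg (fun j => decide (j ≠ a)) z) ≤ (1 - t) * aRen N y :=
        mul_le_mul_of_nonneg_left h2 (by linarith)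
      linarith
  simpa using key univ

theorem aux_cot {k : ℕ} {N : (Fin k → ℝ) → ℝ} (hN : IsNorm k N) {q C K : ℝ} (hq : 2 ≤ q)
    (hC : 1 ≤ C) (hK : 1 ≤ K) (hunc : UncondConst k N K) (hcot : HasCotype k N q C)
    (m : ℕ) (x : Fin m → Fin k → ℝ) (hx : ∀ i j, 0 ≤ x i j) :
    ∑ i, aRen N (x i) ^ q ≤ (C * K) ^ q * aRen N (∑ i, x i) ^ q := by
  have hCq : 0 < C ^ q := Real.rpow_pos_of_pos (by linarith) _
  have hKq : 0 < K ^ q := Real.rpow_pos_of_pos (by linarith) _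
  have h1 := hcot m x
  have h2 : 1 / 2 ^ m * ∑ σ : Fin m → Bool, N (∑ i, (if σ i then (1 : ℝ) else -1) • x i) ^ q ≤
      aRen N (∑ i, x i) ^ q := by
    have h3 : ∀ σ : Fin m → Bool, N (∑ i, (if σ i then (1 : ℝ) else -1) • x i) ^ q ≤
        aRen N (∑ i, x i) ^ q := by
      intro σ
      refine Real.rpow_le_rpow (aux_norm_nonneg hN _) ?_ (by linarith)
      refine (aRen_self N _).trans (aRen_mono hN _ _ fun j => ?_)
      rw [Finset.sum_apply, Finset.sum_apply, abs_of_nonneg (sum_nonneg fun i _ => hx i j)]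
      refine (abs_sum_le_sum_abs _ _).trans (sum_le_sum fun i _ => ?_)
      simp only [Pi.smul_apply, smul_eq_mul]
      rw [abs_mul, abs_of_nonneg (hx i j)]
      split_ifs <;> simp
    calc _ ≤ 1 / 2 ^ m * ∑ σ : Fin m → Bool, aRen N (∑ i, x i) ^ q := by
          exact mul_le_mul_of_nonneg_left (sum_le_sum fun σ _ => h3 σ) (by positivity)
      _ = _ := by simp
  have h4 := h1.trans h2
  calc ∑ i, aRen N (x i) ^ q ≤ ∑ i, K ^ q * N (x i) ^ q := by
        refine sum_le_sum fun i _ => ?_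
        rw [← Real.mul_rpow (by linarith) (aux_norm_nonneg hN _)]
        exact Real.rpow_le_rpow (aRen_nonneg hN _) (aRen_K hunc _) (by linarith)
    _ = (C ^ q * K ^ q) * (1 / C ^ q * ∑ i, N (x i) ^ q) := by
        rw [← mul_sum]; field_simp
    _ ≤ (C ^ q * K ^ q) * aRen N (∑ i, x i) ^ q := by gcongr
    _ = _ := by rw [Real.mul_rpow (by linarith) (by linarith)]

noncomputable def aT {k : ℕ} {I : Fin k → Type} [∀ j, Fintype (I j)] (c : ∀ j, I j → ℝ)
    (y : (Σ j, I j) → ℝ) : Fin k → ℝ := fun j => ∑ i, c j i * y ⟨j, i⟩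

theorem aux_alat {k : ℕ} {N : (Fin k → ℝ) → ℝ} (hN : IsNorm k N) {q C K : ℝ} (hq : 2 ≤ q)
    (hC : 1 ≤ C) (hK : 1 ≤ K) (hunc : UncondConst k N K) (hcot : HasCotype k N q C)
    {I : Fin k → Type} [∀ j, Fintype (I j)] (c : ∀ j, I j → ℝ) (hc : ∀ j i, 0 ≤ c j i) :
    ALat (fun y => aRen N (aT c y)) q (C * K) where
  nonneg x := aRen_nonneg hN _
  sub x y := by
    have : aT c (x + y) = aT c x + aT c y := by
      funext j; simp [aT, mul_add, sum_add_distrib]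
    rw [this]
    exact aRen_add hN _ _
  hom t x ht := by
    have : aT c (t • x) = t • aT c x := by
      funext j
      simp only [aT, Pi.smul_apply, smul_eq_mul, mul_sum]
      exact sum_congr rfl fun i _ => by ring
    rw [this]
    exact aRen_smul hN t ht _
  mono x y hx hxy := by
    refine aRen_mono hN _ _ fun j => ?_
    have h0 : 0 ≤ aT c x j := sum_nonneg fun i _ => mul_nonneg (hc j i) (hx _)
    have h1 : aT c x j ≤ aT c y j :=
      sum_le_sum fun i _ => mul_le_mul_of_nonneg_left (hxy _) (hc j i)
    rw [abs_of_nonneg h0, abs_of_nonneg (h0.trans h1)]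
    exact h1
  cot m x hx := by
    have : aT c (∑ i, x i) = ∑ i, aT c (x i) := by
      funext j
      simp only [aT, Finset.sum_apply, mul_sum]
      exact sum_comm
    rw [this]
    exact aux_cot hN hq hC hK hunc hcot m (fun i => aT c (x i))
      (fun i j => sum_nonneg fun l _ => mul_nonneg (hc j l) (hx i _))

theorem aux_const (q C K α ε L d : ℝ) (hq : 2 ≤ q) (hC : 1 ≤ C) (hK : 1 ≤ K) (hd : 3 ≤ d)
    (hα : 0 < α ∧ α ≤ 1) (hε : 0 < ε ∧ ε ≤ 1) (hL : 1 ≤ L) :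
    d * K * (256 * (96 * L * d / (α * (ε / (4 * d * q)))) * (C * K) / (α * (ε / (4 * d * q))) /
      (ε / (4 * d * q))) ≤
    2 ^ 115 * q ^ 10 * C ^ 2 * K ^ 3 * (d ^ 25 * L ^ 8 / (α ^ 14 * ε ^ 18)) := by
  obtain ⟨ha, ha1⟩ := hα
  obtain ⟨he, he1⟩ := hε
  have h1 : d * K * (256 * (96 * L * d / (α * (ε / (4 * d * q)))) * (C * K) /
      (α * (ε / (4 * d * q))) / (ε / (4 * d * q))) =
      1572864 * q ^ 3 * C ^ 1 * K ^ 2 * (d ^ 5 * L ^ 1 / (α ^ 2 * ε ^ 3)) := by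
    field_simp
    ring
  rw [h1]
  have e1 : q ^ 3 ≤ q ^ 10 := pow_le_pow_right₀ (by linarith) (by norm_num)
  have e2 : C ^ 1 ≤ C ^ 2 := pow_le_pow_right₀ hC (by norm_num)
  have e3 : K ^ 2 ≤ K ^ 3 := pow_le_pow_right₀ hK (by norm_num)
  have e4 : d ^ 5 ≤ d ^ 25 := pow_le_pow_right₀ (by linarith) (by norm_num)
  have e5 : L ^ 1 ≤ L ^ 8 := pow_le_pow_right₀ hL (by norm_num)
  have e6 : α ^ 14 ≤ α ^ 2 := pow_le_pow_of_le_one ha.le ha1 (by norm_num)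
  have e7 : ε ^ 18 ≤ ε ^ 3 := pow_le_pow_of_le_one he.le he1 (by norm_num)
  have e8 : (1572864 : ℝ) ≤ 2 ^ 115 := by norm_num
  have : 0 < q := by linarith
  have : 0 < d := by linarith
  gcongr

/-- Theorem 1.5 (nonlinear spectral gap via long-range expansion), case `p = 1`. -/
theorem stmt_0 {n d k : ℕ} (q C K α ε L : ℝ)
    (hq : 2 ≤ q) (hC : 1 ≤ C) (hK : 1 ≤ K) (hd : 3 ≤ d)
    (hα : 0 < α ∧ α ≤ 1) (hε : 0 < ε ∧ ε ≤ 1) (hL : 1 ≤ L)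
    (G : SimpleGraph (Fin n)) [DecidableRel G.Adj]
    (hreg : ∀ v, G.degree v = d)
    (hExp : Expan n d G α ε L)
    (hk : 1 ≤ k) (N : (Fin k → ℝ) → ℝ)
    (hN : IsNorm k N) (hunc : UncondConst k N K) (hcot : HasCotype k N q C)
    (f : Fin n → Fin k → ℝ) :
    1 / (n : ℝ) ^ 2 * ∑ v, ∑ w, N (f v - f w) ≤
      2 ^ 115 * q ^ 10 * C ^ 2 * K ^ 3 * ((d : ℝ) ^ 25 * L ^ 8 / (α ^ 14 * ε ^ 18)) /
          (G.edgeFinset.card : ℝ) *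
        ∑ e ∈ G.edgeFinset, edgeNorm N f e := by
  rcases Nat.eq_zero_or_pos n with hn | hn
  · subst hn
    have : G.edgeFinset = ∅ := by
      apply Finset.eq_empty_of_forall_notMem
      intro e
      induction e with | _ a b => exact a.elim0
    rw [this]
    simp
  have hneg : ∀ x, N (-x) = N x := fun x => by
    have := hN.2.1 (-1) x
    simpa using this
  choose a ha1 ha2 using fun j : Fin k => aux_median hn (fun v => f v j)
  choose I inst c B hc hB hv he using fun j : Fin k =>
    aux_signed (fun v => f v j - a j) (by simpa only [sub_pos] using ha1 j)
      (by simpa only [sub_neg] using ha2 j)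
  have hlat := aux_alat hN hq hC hK hunc hcot c hc
  have hd3 : (3 : ℝ) ≤ d := by exact_mod_cast hd
  have hmain := aux_main hd G hreg hlat (by linarith) (by positivity) α (ε / (4 * d * q)) ε L
    hα hε hL rfl hExp (fun p => B p.1 p.2) (fun p => hB p.1 p.2)
  set Γ := 256 * (96 * L * d / (α * (ε / (4 * d * q)))) * (C * K) / (α * (ε / (4 * d * q))) /
      (ε / (4 * d * q)) with hΓ
  have hΓ0 : 0 ≤ Γ := by
    have := hα.1
    have := hε.1
    have : 0 < q := by linarith
    positivity
  have hedge : ∀ x y, edgeNorm N f s(x, y) = N (f x - f y) := by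
    intro x y
    change min (N (f x - f y)) (N (f y - f x)) = _
    rw [← hneg (f y - f x), neg_sub, min_self]
  have hV : ∀ v, N (fun j => f v j - a j) ≤
      aRen N (aT c (aInd fun p : (Σ j, I j) => v ∈ B p.1 p.2)) := by
    intro v
    refine (aRen_self N _).trans (aRen_mono hN _ _ fun j => ?_)
    refine le_trans (le_trans (hv j v) (le_of_eq ?_)) (le_abs_self _)
    simp only [aT, aInd]
    refine sum_congr rfl fun i _ => ?_
    congr 1
    by_cases hp : v ∈ B j i
    · rw [if_pos hp, if_pos hp]
    · rw [if_neg hp, if_neg hp]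
  have hEd : ∀ e ∈ G.edgeFinset, aRen N (aT c (aInd fun p : (Σ j, I j) => e ∈ aBd G (B p.1 p.2))) ≤
      K * edgeNorm N f e := by
    intro e hee
    induction e with | _ x y =>
    rw [hedge]
    refine le_trans (aRen_mono hN _ (f x - f y) fun j => ?_) (aRen_K hunc _)
    have hadj : G.Adj x y := by simpa using hee
    have h0 : 0 ≤ aT c (aInd fun p : (Σ j, I j) => s(x, y) ∈ aBd G (B p.1 p.2)) j :=
      sum_nonneg fun i _ => mul_nonneg (hc j i) (aInd_nonneg _ _)
    rw [abs_of_nonneg h0]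
    have h1 := he j x y
    simp only [sub_sub_sub_cancel_right] at h1
    refine le_trans (le_of_eq ?_) h1
    simp only [aT, aInd]
    refine sum_congr rfl fun i _ => ?_
    congr 1
    have : s(x, y) ∈ aBd G (B j i) ↔ ¬ (x ∈ B j i ↔ y ∈ B j i) := by
      rw [aux_mem_aBd]; exact and_iff_right hadj
    by_cases hp : ¬ (x ∈ B j i ↔ y ∈ B j i)
    · rw [if_pos hp, if_pos (this.2 hp)]
    · rw [if_neg hp, if_neg fun h => hp (this.1 h)]
  set g : Fin n → ℝ := fun v => N (fun j => f v j - a j) with hg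
  set S := ∑ e ∈ G.edgeFinset, edgeNorm N f e with hS
  have hS0 : 0 ≤ S := by
    refine sum_nonneg fun e _ => ?_
    induction e with | _ x y =>
    rw [hedge]; exact aux_norm_nonneg hN _
  have hsum : ∑ v, g v ≤ Γ * (K * S) := by
    calc ∑ v, g v ≤ _ := sum_le_sum fun v _ => hV v
      _ ≤ _ := hmain
      _ ≤ Γ * (K * S) := by
        refine mul_le_mul_of_nonneg_left ?_ hΓ0
        rw [hS, mul_sum]
        exact sum_le_sum hEd
  have htri : ∀ v w, N (f v - f w) ≤ g v + g w := by
    intro v w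
    have h1 : f v - f w = (fun j => f v j - a j) + -(fun j => f w j - a j) := by
      funext j; simp
    rw [h1]
    refine (hN.2.2 _ _).trans ?_
    rw [hneg]
  have hdbl : ∑ v, ∑ w, N (f v - f w) ≤ 2 * n * ∑ v, g v := by
    calc ∑ v, ∑ w, N (f v - f w) ≤ ∑ v, ∑ w, (g v + g w) :=
          sum_le_sum fun v _ => sum_le_sum fun w _ => htri v w
      _ = _ := by
          simp only [sum_add_distrib, sum_const, card_univ, Fintype.card_fin, nsmul_eq_mul,
            ← mul_sum]
          ring
  have hhs : (n : ℝ) * d = 2 * G.edgeFinset.card := by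
    have := G.sum_degrees_eq_twice_card_edges
    simp only [hreg, sum_const, card_univ, Fintype.card_fin, smul_eq_mul] at this
    exact_mod_cast this
  have hn0 : (0 : ℝ) < n := by exact_mod_cast hn
  have hE0 : (0 : ℝ) < G.edgeFinset.card := by nlinarith
  have hcst := aux_const q C K α ε L d hq hC hK hd3 hα hε hL
  rw [← hΓ] at hcst
  calc 1 / (n : ℝ) ^ 2 * ∑ v, ∑ w, N (f v - f w) ≤ 1 / (n : ℝ) ^ 2 * (2 * n * (Γ * (K * S))) := by
        refine mul_le_mul_of_nonneg_left (hdbl.trans ?_) (by positivity)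
        exact mul_le_mul_of_nonneg_left hsum (by positivity)
    _ = (d * K * Γ) / G.edgeFinset.card * S := by
        clear_value Γ S
        field_simp
        linear_combination (-Γ * S) * hhs
    _ ≤ _ := by gcongr
end

section
/- Let q ≥ 2, C ≥ 1, K ≥ 1, let d ≥ 3 be an integer, let α, ε ∈ (0,1], let L ≥ 1, let p ≥ 1, and set Γ := 2^115 · q^10 · C^2 · K^3 · d^25 · L^8 / (α^14 · ε^18). Let G be a d-regular simple graph on [n] that satisfies the long-range expansion property Expan(α,ε,L). Then for every k ≥ 1, every norm ‖·‖_X on ℝ^k for which the standard basis is K-unconditional and which has cotype q with constant C, and every map f : [n] → ℝ^k, one has (1/n²)·∑_{v,w∈[n]} ‖f(v)−f(w)‖_X^p ≤ ((pΓ)^p/|E_G|)·∑_{{w,w'}∈E_G} ‖f(w)−f(w')‖_X^p. -/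
open Finset

attribute [local instance] Classical.propDecidable

lemma sum_edges_eq {n : ℕ} (G : SimpleGraph (Fin n)) [DecidableRel G.Adj] (F : Sym2 (Fin n) → ℝ) :
    ∑ v, ∑ w, (if G.Adj v w then F s(v, w) else 0) = 2 * ∑ e ∈ G.edgeFinset, F e := by
  have h1 : ∑ e ∈ G.edgeFinset, (2 * F e) = ∑ x : G.Dart, F x.edge := by
    rw [← Finset.sum_fiberwise_of_maps_to (s := univ) (t := G.edgeFinset) (g := fun x : G.Dart => x.edge)
      (fun x _ => by simp [SimpleGraph.mem_edgeFinset, x.edge_mem])]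
    refine Finset.sum_congr rfl fun e he => ?_
    have h2 := G.dart_edge_fiber_card e (SimpleGraph.mem_edgeFinset.1 he)
    rw [Finset.sum_congr rfl (g := fun _ => F e) (fun x hx => by rw [(Finset.mem_filter.1 hx).2])]
    rw [Finset.sum_const, nsmul_eq_mul]
    congr 1
    have : ((univ.filter fun x : G.Dart => x.edge = e).card) = 2 := by
      convert h2
    rw [this]; norm_num
  rw [Finset.mul_sum, h1, ← Finset.sum_product', ← Finset.sum_filter]
  symm
  refine Finset.sum_bij (fun x _ => x.toProd) ?_ ?_ ?_ ?_
  · intro x _; simp [x.adj]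
  · intro x _ y _ h; exact SimpleGraph.Dart.ext _ _ h
  · intro b hb
    exact ⟨⟨b, (Finset.mem_filter.1 hb).2⟩, by simp, rfl⟩
  · intro x _; rfl

/-- one-directional boundary -/
noncomputable def bdry {n : ℕ} (G : SimpleGraph (Fin n)) (S : Finset (Fin n)) : Finset (Fin n × Fin n) :=
  univ.filter fun p => p.1 ∈ S ∧ p.2 ∉ S ∧ G.Adj p.1 p.2

lemma l1_poincare {n : ℕ} (G : SimpleGraph (Fin n)) (H : ℝ) (hH : 0 ≤ H)
    (hch : ∀ S : Finset (Fin n), 2 * S.card ≤ n → (S.card : ℝ) ≤ H * (bdry G S).card) :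
    ∀ (m : ℕ) (g : Fin n → ℝ), (∀ v, 0 ≤ g v) → (univ.filter fun v => g v ≠ 0).card = m →
      2 * m ≤ n →
      ∑ v, g v ≤ H * ∑ p : Fin n × Fin n, (if G.Adj p.1 p.2 then max (g p.1 - g p.2) 0 else 0) := by
  intro m
  induction m using Nat.strong_induction_on with
  | _ m ih =>
  intro g hg hm hmn
  set S := univ.filter fun v => g v ≠ 0 with hS
  by_cases hne : S.Nonempty
  · obtain ⟨u, huS, hu⟩ := S.exists_min_image g hne
    set c := g u with hc
    have hc0 : 0 < c := lt_of_le_of_ne (hg u) (Ne.symm (by simpa [hS] using huS))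
    set g' : Fin n → ℝ := fun v => if v ∈ S then g v - c else 0 with hg'
    have hg0 : ∀ v, v ∉ S → g v = 0 := by
      intro v hv; by_contra h; exact hv (by simp [hS, h])
    have hlt : (univ.filter fun v => g' v ≠ 0).card < m := by
      rw [← hm]
      apply Finset.card_lt_card
      rw [Finset.ssubset_iff_of_subset]
      · exact ⟨u, huS, by simp [hg', hc]⟩
      · intro v hv
        by_contra h
        simp [hg', h] at hv
    have hg'0 : ∀ v, 0 ≤ g' v := by
      intro v
      by_cases hv : v ∈ S
      · simp only [hg', hv, if_true]; linarith [hu v hv]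
      · simp [hg', hv]
    have key := ih _ hlt g' hg'0 rfl (by omega)
    have h1 : ∑ v, g v = ∑ v, g' v + c * S.card := by
      have : ∀ v, g v = g' v + (if v ∈ S then c else 0) := by
        intro v
        by_cases hv : v ∈ S
        · simp [hg', hv]
        · simp [hg', hv, hg0 v hv]
      rw [Finset.sum_congr rfl fun v _ => this v, Finset.sum_add_distrib]
      congr 1
      rw [Finset.sum_ite_mem]; simp [mul_comm]
    have h2 : ∑ p : Fin n × Fin n, (if G.Adj p.1 p.2 then max (g p.1 - g p.2) 0 else 0)
        = ∑ p : Fin n × Fin n, (if G.Adj p.1 p.2 then max (g' p.1 - g' p.2) 0 else 0)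
          + c * (bdry G S).card := by
      have : ∀ p : Fin n × Fin n, (if G.Adj p.1 p.2 then max (g p.1 - g p.2) 0 else 0)
        = (if G.Adj p.1 p.2 then max (g' p.1 - g' p.2) 0 else 0)
          + (if p ∈ bdry G S then c else 0) := by
        intro p
        by_cases ha : G.Adj p.1 p.2
        · by_cases h1 : p.1 ∈ S
          · by_cases h2 : p.2 ∈ S
            · simp [bdry, ha, h1, h2, hg']
            · have := hu _ h1
              simp only [ha, if_true, bdry, h1, h2, hg', hg0 _ h2, mem_filter, mem_univ,
                true_and, not_false_eq_true, if_false, and_true, sub_zero]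
              rw [max_eq_left (hg _), max_eq_left (by linarith)]; ring
          · have h3 := hg p.2
            have h4 := hg'0 p.2
            have h5 : g' p.1 = 0 := by simp [hg', h1]
            simp only [ha, if_true, bdry, h1, mem_filter, false_and, and_false, if_false, hg0 _ h1, h5]
            rw [max_eq_right (by linarith), max_eq_right (by linarith)]; simp
        · simp [bdry, ha]
      rw [Finset.sum_congr rfl fun v _ => this v, Finset.sum_add_distrib]
      congr 1
      rw [Finset.sum_ite_mem]; simp [mul_comm]
    rw [h1, h2]
    have h3 := hch S (by rw [hm]; exact hmn)
    nlinarith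
  · have : ∀ v, g v = 0 := by
      intro v; by_contra h; exact hne ⟨v, by simp [hS, h]⟩
    simp [this]

lemma ball_step {n : ℕ} (G : SimpleGraph (Fin n)) (S : Finset (Fin n)) (v : Fin n) (i : ℕ)
    (hv : vertexSetDist G v S ≤ ((i + 1 : ℕ) : ℕ∞)) (hvS : v ∉ S) :
    ∃ u, G.Adj u v ∧ vertexSetDist G u S ≤ (i : ℕ∞) := by
  unfold vertexSetDist at hv
  have hne : S.Nonempty := by
    rw [Finset.nonempty_iff_ne_empty]; rintro rfl
    simp at hv
  obtain ⟨w, hw, hwe⟩ := Finset.exists_mem_eq_inf S hne (fun w => G.edist v w)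
  rw [hwe] at hv
  have hnt : G.edist v w ≠ ⊤ := ne_top_of_le_ne_top (ENat.natCast_ne_top _) hv
  obtain ⟨p, hp⟩ := SimpleGraph.exists_walk_of_edist_ne_top hnt
  rw [← hp] at hv
  cases p with
  | nil => exact absurd hw hvS
  | @cons _ u _ h p =>
    refine ⟨u, h.symm, ?_⟩
    refine (Finset.inf_le hw).trans ((SimpleGraph.edist_le p).trans ?_)
    rw [SimpleGraph.Walk.length_cons] at hv
    have : p.length + 1 ≤ i + 1 := by exact_mod_cast hv
    exact_mod_cast (by omega : p.length ≤ i)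

lemma ball_card {n d : ℕ} (G : SimpleGraph (Fin n)) [DecidableRel G.Adj]
    (hreg : ∀ v, G.degree v = d) (S : Finset (Fin n)) (hd : 2 ≤ d) (i : ℕ) :
    ((univ.filter fun v => vertexSetDist G v S ≤ (i : ℕ∞)) \ S).card + (bdry G S).card
      ≤ d ^ i * (bdry G S).card := by
  induction i with
  | zero =>
    have : (univ.filter fun v => vertexSetDist G v S ≤ ((0 : ℕ) : ℕ∞)) \ S = ∅ := by
      rw [Finset.sdiff_eq_empty_iff_subset]
      intro v hv
      simp only [Nat.cast_zero, mem_filter, mem_univ, true_and, nonpos_iff_eq_zero] at hv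
      have hne : S.Nonempty := by
        rw [Finset.nonempty_iff_ne_empty]; rintro rfl
        simp [vertexSetDist] at hv
      obtain ⟨w, hw, hwe⟩ := Finset.exists_mem_eq_inf S hne (fun w => G.edist v w)
      rw [vertexSetDist, hwe, SimpleGraph.edist_eq_zero_iff] at hv
      exact hv ▸ hw
    rw [this]; simp
  | succ i ih =>
    set B := (univ.filter fun v => vertexSetDist G v S ≤ (i : ℕ∞)) \ S with hB
    have hsub : (univ.filter fun v => vertexSetDist G v S ≤ ((i + 1 : ℕ) : ℕ∞)) \ S ⊆
        (bdry G S).image Prod.snd ∪ B.biUnion fun u => G.neighborFinset u := by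
      intro v hv
      simp only [mem_sdiff, mem_filter, mem_univ, true_and] at hv
      obtain ⟨u, hu, hu2⟩ := ball_step G S v i hv.1 hv.2
      by_cases huS : u ∈ S
      · apply Finset.mem_union_left
        exact Finset.mem_image.2 ⟨(u, v), by simp [bdry, huS, hv.2, hu], rfl⟩
      · apply Finset.mem_union_right
        exact Finset.mem_biUnion.2 ⟨u, by simp [hB, hu2, huS], by simpa using hu⟩
    have h1 := Finset.card_le_card hsub
    have h2 := Finset.card_union_le ((bdry G S).image Prod.snd) (B.biUnion fun u => G.neighborFinset u)
    have h3 : ((bdry G S).image Prod.snd).card ≤ (bdry G S).card := Finset.card_image_le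
    have h4 : (B.biUnion fun u => G.neighborFinset u).card ≤ B.card * d :=
      Finset.card_biUnion_le_card_mul _ _ _ (fun u _ => by
        rw [SimpleGraph.card_neighborFinset_eq_degree, hreg])
    have h5 := Nat.mul_le_mul_right d ih
    have h6 : (bdry G S).card * 2 ≤ (bdry G S).card * d := Nat.mul_le_mul_left _ hd
    calc _ ≤ B.card * d + (bdry G S).card * 2 := by omega
      _ ≤ (B.card + (bdry G S).card) * d := by rw [add_mul]; omega
      _ ≤ _ := by rw [pow_succ]; linarith

lemma cheeger {n d : ℕ} (hd : 3 ≤ d) (G : SimpleGraph (Fin n)) [DecidableRel G.Adj]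
    (hreg : ∀ v, G.degree v = d) (α : ℝ) (hα : 0 < α ∧ α ≤ 1) (hA : ExpanA n d G α)
    (S : Finset (Fin n)) (hS : 2 * S.card ≤ n) :
    (S.card : ℝ) ≤ (8 * d ^ 2 / α ^ 2) * (bdry G S).card := by
  have hα0 := hα.1
  rcases S.eq_empty_or_nonempty with rfl | hne
  · simp; positivity
  have hd' : (3 : ℝ) ≤ d := by exact_mod_cast hd
  have hd1 : (1 : ℝ) < (d : ℝ) - 1 := by linarith
  obtain ⟨ℓ, hℓ1, hℓ2⟩ := exists_nat_pow_near (x := 2 / α) (y := (d : ℝ) - 1)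
    (by rw [le_div_iff₀ hα0]; linarith [hα.2]) hd1
  have h := hA S hne (ℓ + 1) (by omega)
  have hbc := ball_card G hreg S (by omega) (ℓ + 1)
  set B := univ.filter fun v => vertexSetDist G v S ≤ ((ℓ + 1 : ℕ) : ℕ∞) with hB
  have h1 : 3 / 2 * (S.card : ℝ) ≤ B.card := by
    refine le_trans (le_min ?_ ?_) h
    · have : (2 * S.card : ℝ) ≤ n := by exact_mod_cast hS
      linarith
    · have : 2 ≤ α * ((d : ℝ) - 1) ^ (ℓ + 1) := by
        rw [div_lt_iff₀ hα0] at hℓ2; linarith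
      have h0 : (0 : ℝ) ≤ S.card := by positivity
      nlinarith
  have h2 : (B.card : ℝ) ≤ (B \ S).card + S.card := by
    exact_mod_cast (by
      have := Finset.le_card_sdiff S B
      omega)
  have h3 : ((B \ S).card : ℝ) ≤ d ^ (ℓ + 1) * (bdry G S).card := by
    exact_mod_cast (le_trans (Nat.le_add_right _ _) hbc)
  have h4 : (d : ℝ) ^ (ℓ + 1) ≤ 4 * d ^ 2 / α ^ 2 := by
    calc (d : ℝ) ^ (ℓ + 1) ≤ (((d : ℝ) - 1) ^ 2) ^ (ℓ + 1) := by
          gcongr; nlinarith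
      _ = (((d : ℝ) - 1) ^ ℓ * ((d : ℝ) - 1)) ^ 2 := by
          rw [← pow_succ, ← pow_mul, ← pow_mul, mul_comm]
      _ ≤ (2 / α * d) ^ 2 := by
          gcongr
          · linarith
      _ = _ := by field_simp; ring
  have h5 : (0 : ℝ) ≤ (bdry G S).card := by positivity
  have h6 := mul_le_mul_of_nonneg_right h4 h5
  have h7 : (8 * (d : ℝ) ^ 2 / α ^ 2) = 2 * (4 * d ^ 2 / α ^ 2) := by ring
  rw [h7]
  linarith

lemma exists_median {n : ℕ} (hn : 0 < n) (g : Fin n → ℝ) :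
    ∃ m : ℝ, 2 * (univ.filter fun v => m < g v).card ≤ n ∧
      2 * (univ.filter fun v => g v < m).card ≤ n := by
  haveI : Nonempty (Fin n) := ⟨⟨0, hn⟩⟩
  set T := univ.filter fun v => 2 * (univ.filter fun w => g v < g w).card ≤ n with hT
  have hTne : T.Nonempty := by
    obtain ⟨v, -, hv⟩ := Finset.exists_max_image univ g univ_nonempty
    refine ⟨v, ?_⟩
    have : (univ.filter fun w => g v < g w) = ∅ := by
      apply Finset.filter_eq_empty_iff.2
      intro w hw; exact not_lt.2 (hv w hw)
    simp [hT, this]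
  obtain ⟨v, hvT, hv⟩ := Finset.exists_min_image T g hTne
  refine ⟨g v, (Finset.mem_filter.1 hvT).2, ?_⟩
  rcases (univ.filter fun w => g w < g v).eq_empty_or_nonempty with h | h
  · rw [h]; simp
  obtain ⟨u, huU, hu⟩ := Finset.exists_max_image _ g h
  have huv : g u < g v := (Finset.mem_filter.1 huU).2
  have huT : u ∉ T := fun h => absurd (hv u h) (not_le.2 huv)
  have h1 : n < 2 * (univ.filter fun w => g u < g w).card := by
    by_contra hh; exact huT (by simp only [hT, mem_filter, mem_univ, true_and]; omega)
  have h2 : (univ.filter fun w => g w < g v) ⊆ (univ.filter fun w => ¬ g u < g w) := by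
    intro w hw
    simp only [mem_filter, mem_univ, true_and, not_lt]
    exact hu w hw
  have h3 := Finset.card_le_card h2
  have h4 := Finset.card_filter_add_card_filter_not (s := (univ : Finset (Fin n))) (fun w => g u < g w)
  simp only [Finset.card_univ, Fintype.card_fin] at h4
  omega

structure LNorm {k : ℕ} (N : (Fin k → ℝ) → ℝ) : Prop where
  nonneg : ∀ x, 0 ≤ N x
  smul : ∀ (c : ℝ) x, N (c • x) = |c| * N x
  add : ∀ x y, N (x + y) ≤ N x + N y
  mono : ∀ x y, (∀ j, |y j| ≤ |x j|) → N y ≤ N x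

def Conc {k : ℕ} (N : (Fin k → ℝ) → ℝ) (s t : ℕ) : Prop :=
  ∀ x a b : Fin k → ℝ, (∀ j, |a j| ^ s + |b j| ^ s ≤ 1) → N (a * x) ^ t + N (b * x) ^ t ≤ N x ^ t

def FamSet {k : ℕ} (N : (Fin k → ℝ) → ℝ) (s t : ℕ) (x : Fin k → ℝ) : Set ℝ :=
  {y | ∃ (m : ℕ) (θ : Fin m → Fin k → ℝ), (∀ j, ∑ i, |θ i j| ^ s ≤ 1) ∧ y = ∑ i, N (θ i * x) ^ t}

theorem renorm {k : ℕ} (N : (Fin k → ℝ) → ℝ) (h0 : ∀ x, 0 ≤ N x)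
    (hsmul : ∀ (c : ℝ) x, N (c • x) = |c| * N x) (hadd : ∀ x y, N (x + y) ≤ N x + N y)
    (s t : ℕ) (hs : 1 ≤ s) (ht : 1 ≤ t) (B : ℝ) (hB : 0 ≤ B)
    (hbound : ∀ (x : Fin k → ℝ) (m : ℕ) (θ : Fin m → Fin k → ℝ), (∀ j, ∑ i, |θ i j| ^ s ≤ 1) →
      ∑ i, N (θ i * x) ^ t ≤ (B * N x) ^ t) :
    ∃ N' : (Fin k → ℝ) → ℝ, LNorm N' ∧ Conc N' s t ∧ (∀ x, N x ≤ N' x) ∧ ∀ x, N' x ≤ B * N x := by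
  have hbdd : ∀ x, BddAbove (FamSet N s t x) := by
    intro x
    refine ⟨(B * N x) ^ t, ?_⟩
    rintro y ⟨m, θ, hθ, rfl⟩
    exact hbound x m θ hθ
  have hne : ∀ x, (FamSet N s t x).Nonempty := fun x => ⟨_, 0, fun _ => 0, by simp, rfl⟩
  set P : (Fin k → ℝ) → ℝ := fun x => sSup (FamSet N s t x) with hP
  have hP1 : ∀ x (m : ℕ) (θ : Fin m → Fin k → ℝ), (∀ j, ∑ i, |θ i j| ^ s ≤ 1) →
      ∑ i, N (θ i * x) ^ t ≤ P x := fun x m θ hθ => le_csSup (hbdd x) ⟨m, θ, hθ, rfl⟩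
  have hP2 : ∀ x c, (∀ (m : ℕ) (θ : Fin m → Fin k → ℝ), (∀ j, ∑ i, |θ i j| ^ s ≤ 1) →
      ∑ i, N (θ i * x) ^ t ≤ c) → P x ≤ c := by
    intro x c h
    apply csSup_le (hne x)
    rintro y ⟨m, θ, hθ, rfl⟩
    exact h m θ hθ
  have hP0 : ∀ x, 0 ≤ P x := fun x => by
    have := hP1 x 0 (fun _ => 0) (by simp)
    simpa using this
  have ht0 : t ≠ 0 := by omega
  set N' : (Fin k → ℝ) → ℝ := fun x => P x ^ ((t : ℝ)⁻¹) with hN'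
  have hN'0 : ∀ x, 0 ≤ N' x := fun x => Real.rpow_nonneg (hP0 x) _
  have hpow : ∀ x, N' x ^ t = P x := fun x => Real.rpow_inv_natCast_pow (hP0 x) ht0
  have hle : ∀ x c, 0 ≤ c → (∀ (m : ℕ) (θ : Fin m → Fin k → ℝ), (∀ j, ∑ i, |θ i j| ^ s ≤ 1) →
      ∑ i, N (θ i * x) ^ t ≤ c ^ t) → N' x ≤ c := by
    intro x c hc h
    refine le_of_pow_le_pow_left₀ ht0 hc ?_
    rw [hpow]; exact hP2 x _ h
  have hge : ∀ x (m : ℕ) (θ : Fin m → Fin k → ℝ), (∀ j, ∑ i, |θ i j| ^ s ≤ 1) →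
      ∑ i, N (θ i * x) ^ t ≤ N' x ^ t := fun x m θ hθ => by rw [hpow]; exact hP1 x m θ hθ
  have hsm : ∀ (c : ℝ) x, N' (c • x) ≤ |c| * N' x := by
    intro c x
    apply hle _ _ (mul_nonneg (abs_nonneg _) (hN'0 _))
    intro m θ hθ
    have h1 := hge x m θ hθ
    have h2 : ∀ i, N (θ i * (c • x)) ^ t = |c| ^ t * N (θ i * x) ^ t := by
      intro i; rw [mul_smul_comm, hsmul, mul_pow]
    rw [Finset.sum_congr rfl fun i _ => h2 i, ← Finset.mul_sum, mul_pow]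
    gcongr
  refine ⟨N', ⟨hN'0, ?_, ?_, ?_⟩, ?_, ?_, ?_⟩
  · intro c x
    apply le_antisymm (hsm c x)
    by_cases hc : c = 0
    · subst hc; simpa using hN'0 0
    have := hsm c⁻¹ (c • x)
    rw [smul_smul, inv_mul_cancel₀ hc, one_smul, abs_inv] at this
    have hc' : 0 < |c| := abs_pos.2 hc
    calc |c| * N' x ≤ |c| * (|c|⁻¹ * N' (c • x)) := by gcongr
      _ = _ := by field_simp
  · intro x y
    apply hle _ _ (add_nonneg (hN'0 _) (hN'0 _))
    intro m θ hθ
    have hx := hge x m θ hθ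
    have hy := hge y m θ hθ
    have ht1 : (1 : ℝ) ≤ t := by exact_mod_cast ht
    have mink := Real.Lp_add_le_of_nonneg (univ : Finset (Fin m)) (p := (t : ℝ))
      (f := fun i => N (θ i * x)) (g := fun i => N (θ i * y)) ht1 (fun i _ => h0 _) (fun i _ => h0 _)
    simp only [Real.rpow_natCast, one_div] at mink
    have h1 : (∑ i, N (θ i * x) ^ t) ^ ((t : ℝ)⁻¹) ≤ N' x := by
      rw [← Real.pow_rpow_inv_natCast (hN'0 x) ht0]
      exact Real.rpow_le_rpow (Finset.sum_nonneg fun i _ => pow_nonneg (h0 _) _) hx (by positivity)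
    have h2 : (∑ i, N (θ i * y) ^ t) ^ ((t : ℝ)⁻¹) ≤ N' y := by
      rw [← Real.pow_rpow_inv_natCast (hN'0 y) ht0]
      exact Real.rpow_le_rpow (Finset.sum_nonneg fun i _ => pow_nonneg (h0 _) _) hy (by positivity)
    have h3 : 0 ≤ ∑ i, (N (θ i * x) + N (θ i * y)) ^ t :=
      Finset.sum_nonneg fun i _ => pow_nonneg (add_nonneg (h0 _) (h0 _)) _
    calc ∑ i, N (θ i * (x + y)) ^ t ≤ ∑ i, (N (θ i * x) + N (θ i * y)) ^ t := by
          refine Finset.sum_le_sum fun i _ => ?_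
          rw [mul_add]
          exact pow_le_pow_left₀ (h0 _) (hadd _ _) _
      _ = ((∑ i, (N (θ i * x) + N (θ i * y)) ^ t) ^ ((t : ℝ)⁻¹)) ^ t :=
          (Real.rpow_inv_natCast_pow h3 ht0).symm
      _ ≤ _ := pow_le_pow_left₀ (Real.rpow_nonneg h3 _) (by linarith) _
  · intro x y hxy
    apply hle _ _ (hN'0 _)
    intro m θ hθ
    have h1 : ∀ i, θ i * y = (fun j => θ i j * (y j / x j)) * x := by
      intro i; funext j
      simp only [Pi.mul_apply]
      by_cases hx : x j = 0
      · have := hxy j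
        rw [hx, abs_zero] at this
        rw [abs_nonpos_iff.1 this, hx]; simp
      · field_simp
    rw [Finset.sum_congr rfl fun i _ => by rw [h1 i]]
    apply hge
    intro j
    refine le_trans (Finset.sum_le_sum fun i _ => ?_) (hθ j)
    refine pow_le_pow_left₀ (abs_nonneg _) ?_ _
    rw [abs_mul, abs_div]
    exact mul_le_of_le_one_right (abs_nonneg _) (div_le_one_of_le₀ (hxy j) (abs_nonneg _))
  · intro x a b hab
    rw [hpow, hpow, hpow]
    rw [← le_sub_iff_add_le]
    apply hP2
    intro m θ hθ
    rw [le_sub_comm]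
    apply hP2
    intro m' θ' hθ'
    rw [le_sub_iff_add_le]
    have := hP1 x (m' + m) (Fin.append (fun i => θ' i * b) (fun i => θ i * a)) ?_
    · rw [Fin.sum_univ_add] at this
      simpa [mul_assoc] using this
    · intro j
      rw [Fin.sum_univ_add]
      simp only [Fin.append_left, Fin.append_right, Pi.mul_apply, abs_mul, mul_pow,
        ← Finset.sum_mul]
      have h1 : (∑ i, |θ' i j| ^ s) * |b j| ^ s ≤ 1 * |b j| ^ s :=
        mul_le_mul_of_nonneg_right (hθ' j) (by positivity)
      have h2 : (∑ i, |θ i j| ^ s) * |a j| ^ s ≤ 1 * |a j| ^ s :=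
        mul_le_mul_of_nonneg_right (hθ j) (by positivity)
      linarith [hab j]
  · intro x
    refine le_of_pow_le_pow_left₀ ht0 (hN'0 x) ?_
    have := hge x 1 (fun _ _ => 1) (by simp)
    have h1 : (fun _ => 1 : Fin k → ℝ) * x = x := by funext j; simp
    simpa [h1] using this
  · intro x
    exact hle _ _ (mul_nonneg hB (h0 x)) (hbound x)

/-- norming functional, stored as `a = φ * x`. -/
theorem norming {k : ℕ} {N : (Fin k → ℝ) → ℝ} (hN : LNorm N) (x : Fin k → ℝ) :
    ∃ a : Fin k → ℝ, (∀ j, 0 ≤ a j) ∧ (∀ j, x j = 0 → a j = 0) ∧ ∑ j, a j = N x ∧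
      ∀ u : Fin k → ℝ, ∑ j, a j * u j ≤ N (u * x) := by
  have h00 : N 0 = 0 := by simpa using hN.smul 0 0
  obtain ⟨φ, hφx, hφ⟩ : ∃ φ : (Fin k → ℝ) →ₗ[ℝ] ℝ, φ x = N x ∧ ∀ z, φ z ≤ N z := by
    by_cases hx : x = 0
    · subst hx
      exact ⟨0, by simp [h00], fun z => by simpa using hN.nonneg z⟩
    obtain ⟨g, hg1, hg2⟩ := exists_extension_of_le_sublinear
      (LinearPMap.mkSpanSingleton (K := ℝ) x (N x) hx) N
      (fun c hc y => by rw [hN.smul, abs_of_pos hc]) hN.add (by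
        rintro ⟨y, hy⟩
        obtain ⟨c, rfl⟩ := Submodule.mem_span_singleton.1 hy
        rw [LinearPMap.mkSpanSingleton'_apply]
        rw [hN.smul, smul_eq_mul]
        exact mul_le_mul_of_nonneg_right (le_abs_self c) (hN.nonneg _))
    refine ⟨g, ?_, hg2⟩
    have := hg1 ⟨x, Submodule.mem_span_singleton_self x⟩
    rw [this]
    exact LinearPMap.mkSpanSingleton_apply ℝ ℝ hx _
  have hsum : ∀ u : Fin k → ℝ, ∑ j, (φ (Pi.single j 1) * x j) * u j = φ (u * x) := by
    intro u
    rw [LinearMap.pi_apply_eq_sum_univ φ (u * x)]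
    refine Finset.sum_congr rfl fun j _ => ?_
    have : (Pi.single j 1 : Fin k → ℝ) = fun i => if j = i then 1 else 0 := by
      funext i; simp [Pi.single_apply, eq_comm]
    rw [this]; simp only [Pi.mul_apply, smul_eq_mul]; ring
  have hs1 : ∑ j, φ (Pi.single j 1) * x j = N x := by
    have := hsum 1
    simpa [hφx] using this
  refine ⟨fun j => φ (Pi.single j 1) * x j, ?_, ?_, hs1, ?_⟩
  · intro j
    have h1 := hsum (fun i => if i = j then -1 else 1)
    have h2 : N ((fun i => if i = j then -1 else 1) * x) ≤ N x := by
      apply hN.mono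
      intro i; simp only [Pi.mul_apply, abs_mul]
      split_ifs <;> simp
    have h3 := hφ ((fun i => if i = j then -1 else 1) * x)
    have h4 : ∑ i, (φ (Pi.single i 1) * x i) * (if i = j then -1 else 1)
        = ∑ i, φ (Pi.single i 1) * x i - 2 * (φ (Pi.single j 1) * x j) := by
      have : ∀ i, (φ (Pi.single i 1) * x i) * (if i = j then -1 else 1)
        = φ (Pi.single i 1) * x i - (if i = j then 2 * (φ (Pi.single j 1) * x j) else 0) := by
        intro i; split_ifs with h
        · subst h; ring
        · ring
      rw [Finset.sum_congr rfl fun i _ => this i, Finset.sum_sub_distrib]; simp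
    rw [h4, hs1] at h1
    linarith
  · intro j hj; simp [hj]
  · intro u; rw [hsum]; exact hφ _

theorem uncond_cube {k : ℕ} {N : (Fin k → ℝ) → ℝ} (hN : IsNorm k N) {K : ℝ}
    (hunc : UncondConst k N K) (x u : Fin k → ℝ) (hu : ∀ j, |u j| ≤ 1) : N (u * x) ≤ K * N x := by
  have hconv : ConvexOn ℝ (Set.univ : Set (Fin k → ℝ)) (fun u => N (u * x)) := by
    refine ⟨convex_univ, ?_⟩
    intro y _ z _ a b ha hb _
    simp only [smul_eq_mul]
    rw [add_mul, smul_mul_assoc, smul_mul_assoc]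
    refine (hN.2.2 _ _).trans ?_
    rw [hN.2.1, hN.2.1, abs_of_nonneg ha, abs_of_nonneg hb]
  have hmem : u ∈ convexHull ℝ (Set.pi Set.univ (fun _ : Fin k => ({-1, 1} : Set ℝ))) := by
    rw [convexHull_pi]
    intro j _
    rw [convexHull_pair, segment_eq_Icc (by norm_num)]
    exact abs_le.1 (hu j)
  obtain ⟨y, hy, hle⟩ := (hconv.subset (Set.subset_univ _) (convex_convexHull ℝ _)).exists_ge_of_mem_convexHull
    (subset_convexHull ℝ _) hmem
  refine hle.trans ?_
  have h2 := hunc (fun j => decide (y j = 1)) x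
  refine le_of_eq_of_le (congrArg N ?_) h2
  funext j
  have := hy j (Set.mem_univ j)
  simp only [Set.mem_insert_iff, Set.mem_singleton_iff] at this
  rcases this with h | h
  · simp [h]; norm_num
  · simp [h]

theorem cotype_bound {k : ℕ} {N : (Fin k → ℝ) → ℝ} (hN : IsNorm k N) (h0 : ∀ x, 0 ≤ N x)
    {K q C : ℝ} (hq : 2 ≤ q) (hC : 1 ≤ C) (hK : 1 ≤ K)
    (hunc : UncondConst k N K) (hcot : HasCotype k N q C) (Q : ℕ) (hQ : q ≤ Q)
    (x : Fin k → ℝ) (m : ℕ) (θ : Fin m → Fin k → ℝ) (hθ : ∀ j, ∑ i, |θ i j| ^ 1 ≤ 1) :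
    ∑ i, N (θ i * x) ^ Q ≤ (C * K * N x) ^ Q := by
  have hC0 : 0 < C := by linarith
  have hKx : 0 ≤ K * N x := mul_nonneg (by linarith) (h0 x)
  have hB : 0 ≤ C * K * N x := by rw [mul_assoc]; exact mul_nonneg hC0.le hKx
  have h1 : ∑ i, N (θ i * x) ^ q ≤ (C * K * N x) ^ q := by
    have h := hcot m (fun i => θ i * x)
    have h2 : 1 / 2 ^ m * ∑ σ : Fin m → Bool,
        N (∑ i, (if σ i then (1 : ℝ) else -1) • (θ i * x)) ^ q ≤ (K * N x) ^ q := by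
      have : ∀ σ : Fin m → Bool, N (∑ i, (if σ i then (1 : ℝ) else -1) • (θ i * x)) ^ q
          ≤ (K * N x) ^ q := by
        intro σ
        refine Real.rpow_le_rpow (h0 _) ?_ (by linarith)
        have e : ∑ i, (if σ i then (1 : ℝ) else -1) • (θ i * x)
            = (∑ i, (if σ i then (1 : ℝ) else -1) • θ i) * x := by
          rw [Finset.sum_mul]; simp only [smul_mul_assoc]
        rw [e]
        apply uncond_cube hN hunc
        intro j
        rw [Finset.sum_apply]
        refine (Finset.abs_sum_le_sum_abs _ _).trans (le_trans (Finset.sum_le_sum fun i _ => ?_) (hθ j))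
        simp only [Pi.smul_apply, smul_eq_mul, abs_mul, pow_one]
        split_ifs <;> simp
      have h3 := Finset.sum_le_sum (s := univ) fun σ _ => this σ
      rw [Finset.sum_const, nsmul_eq_mul] at h3
      have hc : ((univ : Finset (Fin m → Bool)).card : ℝ) = 2 ^ m := by simp
      rw [hc] at h3
      rw [one_div, inv_mul_le_iff₀ (by positivity)]
      exact h3
    have h4 := h.trans h2
    have hCq : 0 < C ^ q := Real.rpow_pos_of_pos hC0 _
    rw [one_div, inv_mul_le_iff₀ hCq] at h4
    rw [mul_assoc, Real.mul_rpow hC0.le hKx]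
    exact h4
  have hq0 : 0 < q := by linarith
  have h2 : ∀ i, N (θ i * x) ≤ C * K * N x := by
    intro i
    have := (Finset.single_le_sum (f := fun i => N (θ i * x) ^ q)
      (fun i _ => Real.rpow_nonneg (h0 _) _) (mem_univ i)).trans h1
    exact (Real.rpow_le_rpow_iff (h0 _) hB hq0).1 this
  have hsplit : ∀ y : ℝ, 0 ≤ y → y ^ Q = y ^ q * y ^ ((Q : ℝ) - q) := by
    intro y hy
    rw [← Real.rpow_add_of_nonneg hy hq0.le (by linarith), ← Real.rpow_natCast]; congr 1; ring
  calc ∑ i, N (θ i * x) ^ Q ≤ ∑ i, N (θ i * x) ^ q * (C * K * N x) ^ ((Q : ℝ) - q) := by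
        refine Finset.sum_le_sum fun i _ => ?_
        rw [hsplit _ (h0 _)]
        exact mul_le_mul_of_nonneg_left (Real.rpow_le_rpow (h0 _) (h2 i) (by linarith))
          (Real.rpow_nonneg (h0 _) _)
    _ = (∑ i, N (θ i * x) ^ q) * (C * K * N x) ^ ((Q : ℝ) - q) := by rw [Finset.sum_mul]
    _ ≤ (C * K * N x) ^ q * (C * K * N x) ^ ((Q : ℝ) - q) :=
        mul_le_mul_of_nonneg_right h1 (Real.rpow_nonneg hB _)
    _ = _ := (hsplit _ hB).symm

lemma bern {Q : ℕ} (hQ : 1 ≤ Q) {X A : ℝ} (hA : 0 ≤ A) (hAX : A ≤ X) :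
    X ^ Q - (X - A) ^ Q ≤ Q * A * X ^ (Q - 1) := by
  rcases hA.eq_or_lt with rfl | hA'
  · simp
  have hX : 0 < X := by linarith
  have h := one_add_mul_le_pow (a := -(A / X)) (by
    have : A / X ≤ 1 := (div_le_one hX).2 hAX
    linarith) Q
  have h2 : (X - A) ^ Q = X ^ Q * (1 + -(A / X)) ^ Q := by
    rw [← mul_pow]; congr 1; field_simp; ring
  have h3 := mul_le_mul_of_nonneg_left h (pow_nonneg hX.le Q)
  have h4 : X ^ Q = X ^ (Q - 1) * X := by rw [← pow_succ]; congr 1; omega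
  have h5 : X ^ Q * (1 + Q * -(A / X)) = X ^ Q - Q * A * X ^ (Q - 1) := by
    rw [h4]; field_simp; ring
  rw [h2]; linarith

theorem pisier_set {k : ℕ} {N : (Fin k → ℝ) → ℝ} (hN : LNorm N) {Q : ℕ} (hQ : 1 ≤ Q)
    (hc : Conc N 1 Q) (x a : Fin k → ℝ) (ha0 : ∀ j, 0 ≤ a j) (hs : ∑ j, a j = N x)
    (ha : ∀ u : Fin k → ℝ, ∑ j, a j * u j ≤ N (u * x)) (g : Fin k → ℝ)
    (hg0 : ∀ j, 0 ≤ g j) (hg1 : ∀ j, g j ≤ 1) :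
    N (g * x) ^ Q ≤ Q * (∑ j, a j * g j) * N x ^ (Q - 1) := by
  have h1 := hc x g (1 - g) (fun j => by
    simp only [Pi.sub_apply, Pi.one_apply, pow_one]
    rw [abs_of_nonneg (hg0 j), abs_of_nonneg (by linarith [hg1 j])]; linarith)
  have h2 := ha (1 - g)
  have h3 : ∑ j, a j * (1 - g) j = N x - ∑ j, a j * g j := by
    rw [← hs, ← Finset.sum_sub_distrib]
    refine Finset.sum_congr rfl fun j _ => ?_
    simp; ring
  rw [h3] at h2
  have hA0 : 0 ≤ ∑ j, a j * g j := Finset.sum_nonneg fun j _ => mul_nonneg (ha0 j) (hg0 j)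
  have hA1 : ∑ j, a j * g j ≤ N x := by
    rw [← hs]; exact Finset.sum_le_sum fun j _ => mul_le_of_le_one_right (ha0 j) (hg1 j)
  have h4 := bern hQ hA0 hA1
  have h5 := pow_le_pow_left₀ (sub_nonneg.2 hA1) h2 Q
  linarith

theorem pisier_level {k : ℕ} {N : (Fin k → ℝ) → ℝ} (hN : LNorm N) {Q : ℕ} (hQ : 1 ≤ Q)
    (hc : Conc N 1 Q) (x a : Fin k → ℝ) (ha0 : ∀ j, 0 ≤ a j) (hs : ∑ j, a j = N x)
    (ha : ∀ u : Fin k → ℝ, ∑ j, a j * u j ≤ N (u * x)) (θ : Fin k → ℝ)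
    (hθ : ∀ j, 0 ≤ θ j) (τ : ℝ) (hτ : 0 < τ)
    (hI : ∑ j, a j * θ j ^ (2 * Q) ≤ N x * τ ^ (2 * Q)) (l : ℕ) :
    N ((fun j => min (θ j) (τ * 2 ^ l)) * x) ≤ N x * τ * (5 - 4 / 2 ^ l) := by
  have hX := hN.nonneg x
  induction l with
  | zero =>
    have h1 : N ((fun j => min (θ j) (τ * 2 ^ 0)) * x) ≤ N (τ • x) := by
      apply hN.mono
      intro j
      simp only [Pi.mul_apply, Pi.smul_apply, smul_eq_mul, abs_mul, pow_zero, mul_one]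
      refine mul_le_mul_of_nonneg_right ?_ (abs_nonneg _)
      rw [abs_of_nonneg (le_min (hθ j) hτ.le), abs_of_pos hτ]
      exact min_le_right _ _
    rw [hN.smul, abs_of_pos hτ] at h1
    refine h1.trans (le_of_eq ?_)
    norm_num; ring
  | succ l ih =>
    set T := τ * 2 ^ l with hT
    have hT0 : 0 < T := by positivity
    set g : Fin k → ℝ := fun j => if T < θ j then 1 else 0 with hg
    have h1 := pisier_set hN hQ hc x a ha0 hs ha g
      (fun j => by simp only [hg]; split_ifs <;> norm_num)
      (fun j => by simp only [hg]; split_ifs <;> norm_num)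
    have h2 : (∑ j, a j * g j) * T ^ (2 * Q) ≤ N x * τ ^ (2 * Q) := by
      refine le_trans ?_ hI
      rw [Finset.sum_mul]
      refine Finset.sum_le_sum fun j _ => ?_
      rw [mul_assoc]
      refine mul_le_mul_of_nonneg_left ?_ (ha0 j)
      simp only [hg]; split_ifs with h
      · rw [one_mul]; exact pow_le_pow_left₀ hT0.le h.le _
      · simp; exact pow_nonneg (hθ j) _
    have h3 : N (g * x) ≤ 2 * N x / (2 ^ l) ^ 2 := by
      have hQ0 : Q ≠ 0 := by omega
      refine le_of_pow_le_pow_left₀ hQ0 (by positivity) (h1.trans ?_)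
      have h5 : ∑ j, a j * g j ≤ N x * (1 / (2 ^ l) ^ 2) ^ Q := by
        have : τ ^ (2 * Q) = (1 / (2 ^ l) ^ 2) ^ Q * T ^ (2 * Q) := by
          rw [pow_mul, pow_mul, ← mul_pow]; congr 1; rw [hT]; field_simp
        rw [this, ← mul_assoc] at h2
        exact le_of_mul_le_mul_right h2 (by positivity)
      have h6 : (Q : ℝ) ≤ 2 ^ Q := by exact_mod_cast Nat.lt_two_pow_self.le
      have h7 : N x ^ Q = N x ^ (Q - 1) * N x := by rw [← pow_succ]; congr 1; omega
      calc Q * (∑ j, a j * g j) * N x ^ (Q - 1)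
          ≤ 2 ^ Q * (N x * (1 / (2 ^ l) ^ 2) ^ Q) * N x ^ (Q - 1) := by
            gcongr
            exact Finset.sum_nonneg fun j _ => mul_nonneg (ha0 j)
              (by simp only [hg]; split_ifs <;> norm_num)
        _ = 2 ^ Q * (N x ^ (Q - 1) * N x) * (1 / (2 ^ l) ^ 2) ^ Q := by ring
        _ = _ := by rw [← h7, ← mul_pow, ← mul_pow]; congr 1; ring
    have h4 : N ((fun j => min (θ j) (τ * 2 ^ (l + 1))) * x) ≤
        N ((fun j => min (θ j) T) * x) + N (T • (g * x)) := by
      refine le_trans (hN.mono ((fun j => min (θ j) T) * x + T • (g * x)) _ ?_) (hN.add _ _)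
      intro j
      simp only [Pi.add_apply, Pi.mul_apply, Pi.smul_apply, smul_eq_mul]
      rw [← mul_assoc, ← add_mul, abs_mul, abs_mul]
      refine mul_le_mul_of_nonneg_right ?_ (abs_nonneg _)
      have e : τ * 2 ^ (l + 1) = T + T := by rw [hT]; ring
      have hm : 0 ≤ min (θ j) T := le_min (hθ j) hT0.le
      rw [e, abs_of_nonneg (le_min (hθ j) (by linarith))]
      simp only [hg]
      split_ifs with h
      · rw [abs_of_nonneg (by linarith), min_eq_right h.le, mul_one]; exact min_le_right _ _
      · rw [mul_zero, add_zero, abs_of_nonneg hm, min_eq_left (not_lt.1 h)]; exact min_le_left _ _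
    rw [hN.smul, abs_of_pos hT0] at h4
    have h5 := mul_le_mul_of_nonneg_left h3 hT0.le
    have h6 : T * (2 * N x / (2 ^ l) ^ 2) = N x * τ * (2 / 2 ^ l) := by
      rw [hT]; field_simp
    have h7 : N x * τ * (5 - 4 / 2 ^ (l + 1)) = N x * τ * (5 - 4 / 2 ^ l) + N x * τ * (2 / 2 ^ l) := by
      rw [pow_succ]; field_simp; ring
    rw [h7]; linarith

theorem pisier_bound {k : ℕ} {N : (Fin k → ℝ) → ℝ} (hN : LNorm N) {Q : ℕ} (hQ : 1 ≤ Q)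
    (hc : Conc N 1 Q) (x : Fin k → ℝ) (m : ℕ) (θ : Fin m → Fin k → ℝ)
    (hθ : ∀ j, ∑ i, |θ i j| ^ (2 * Q) ≤ 1) :
    ∑ i, N (θ i * x) ^ (2 * Q) ≤ (5 * N x) ^ (2 * Q) := by
  obtain ⟨a, ha0, -, hs, ha⟩ := norming hN x
  have hX := hN.nonneg x
  have hr : 2 * Q ≠ 0 := by omega
  have key : ∀ i (τ : ℝ), 0 < τ → ∑ j, a j * |θ i j| ^ (2 * Q) ≤ N x * τ ^ (2 * Q) →
      N (θ i * x) ≤ 5 * N x * τ := by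
    intro i τ hτ hI
    have hle1 : ∀ j, |θ i j| ≤ 1 := by
      intro j
      have := (Finset.single_le_sum (f := fun i => |θ i j| ^ (2 * Q))
        (fun i _ => by positivity) (mem_univ i)).trans (hθ j)
      exact (pow_le_one_iff_of_nonneg (abs_nonneg _) hr).1 this
    obtain ⟨l, hl⟩ := pow_unbounded_of_one_lt (1 / τ) (one_lt_two : (1 : ℝ) < 2)
    rw [div_lt_iff₀ hτ] at hl
    have h := pisier_level hN hQ hc x a ha0 hs ha (fun j => |θ i j|) (fun j => abs_nonneg _) τ hτ hI l
    have h2 : N (θ i * x) ≤ N ((fun j => min |θ i j| (τ * 2 ^ l)) * x) := by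
      apply hN.mono
      intro j
      simp only [Pi.mul_apply, abs_mul]
      rw [min_eq_left (by linarith [hle1 j]), abs_abs]
    have h3 : N x * τ * (5 - 4 / 2 ^ l) ≤ N x * τ * 5 := by
      gcongr
      have : (0 : ℝ) ≤ 4 / 2 ^ l := by positivity
      linarith
    linarith
  rcases hX.eq_or_lt with h0 | hXp
  · have : ∀ i, N (θ i * x) = 0 := by
      intro i
      apply le_antisymm _ (hN.nonneg _)
      have hsum : ∑ j, a j * |θ i j| ^ (2 * Q) ≤ N x * 1 ^ (2 * Q) := by
        rw [one_pow, mul_one, ← hs]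
        refine Finset.sum_le_sum fun j _ => mul_le_of_le_one_right (ha0 j) ?_
        exact (Finset.single_le_sum (f := fun i => |θ i j| ^ (2 * Q))
          (fun i _ => by positivity) (mem_univ i)).trans (hθ j)
      have := key i 1 one_pos hsum
      rw [← h0] at this; linarith
    simp [this, hr]; positivity
  have key2 : ∀ i, N (θ i * x) ^ (2 * Q) ≤
      (5 * N x) ^ (2 * Q) * ((∑ j, a j * |θ i j| ^ (2 * Q)) / N x) := by
    intro i
    set I := ∑ j, a j * |θ i j| ^ (2 * Q) with hI
    have hI0 : 0 ≤ I := Finset.sum_nonneg fun j _ => mul_nonneg (ha0 j) (by positivity)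
    rcases hI0.eq_or_lt with h | h
    · have : N (θ i * x) ≤ 0 := by
        apply le_of_forall_pos_le_add
        intro e he
        have h1 := key i (e / (5 * N x)) (by positivity) (by rw [← hI, ← h]; positivity)
        have h2 : 5 * N x * (e / (5 * N x)) = e := by field_simp
        linarith
      have h3 : N (θ i * x) = 0 := le_antisymm this (hN.nonneg _)
      rw [h3, zero_pow hr]; positivity
    · set τ := (I / N x) ^ (((2 * Q : ℕ) : ℝ)⁻¹) with hτ
      have hIX : 0 < I / N x := by positivity
      have hτ0 : 0 < τ := Real.rpow_pos_of_pos hIX _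
      have hτp : τ ^ (2 * Q) = I / N x := Real.rpow_inv_natCast_pow hIX.le hr
      have h1 := key i τ hτ0 (by rw [hτp, ← hI]; apply le_of_eq; field_simp)
      have h2 := pow_le_pow_left₀ (hN.nonneg _) h1 (2 * Q)
      rwa [mul_pow, hτp] at h2
  calc ∑ i, N (θ i * x) ^ (2 * Q) ≤ ∑ i, (5 * N x) ^ (2 * Q) * ((∑ j, a j * |θ i j| ^ (2 * Q)) / N x) :=
        Finset.sum_le_sum fun i _ => key2 i
    _ = (5 * N x) ^ (2 * Q) * ((∑ j, a j * ∑ i, |θ i j| ^ (2 * Q)) / N x) := by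
        rw [← Finset.mul_sum, ← Finset.sum_div, Finset.sum_comm]
        simp only [Finset.mul_sum]
    _ ≤ (5 * N x) ^ (2 * Q) * 1 := by
        gcongr
        rw [div_le_one hXp, ← hs]
        exact Finset.sum_le_sum fun j _ => mul_le_of_le_one_right (ha0 j) (hθ j)
    _ = _ := mul_one _

theorem smooth {k : ℕ} {N : (Fin k → ℝ) → ℝ} (hN : LNorm N) {r : ℕ} (hr : 1 ≤ r)
    (hc : Conc N r r) (x a : Fin k → ℝ) (ha0 : ∀ j, 0 ≤ a j) (hs : ∑ j, a j = N x)
    (ha : ∀ u : Fin k → ℝ, ∑ j, a j * u j ≤ N (u * x)) (t : Fin k → ℝ)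
    (ht : ∀ j, t j = 1 ∨ t j = -1) (δ : ℝ) (hδ : 0 < δ) (hrδ : r * δ ≤ 1) :
    N ((fun j => 1 + δ * t j) * x) ≤ N x * (1 + 2 * r * δ ^ 2) + δ * ∑ j, a j * t j := by
  have hr' : (1 : ℝ) ≤ r := by exact_mod_cast hr
  have hδ1 : δ ≤ 1 := by nlinarith
  have hX := hN.nonneg x
  have hr0 : r ≠ 0 := by omega
  set A := ∑ j, a j * t j with hA
  have hAabs : |A| ≤ N x := by
    rw [← hs]
    refine (Finset.abs_sum_le_sum_abs _ _).trans (Finset.sum_le_sum fun j _ => ?_)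
    rw [abs_mul, abs_of_nonneg (ha0 j)]
    rcases ht j with h | h <;> simp [h]
  have hA1 := (abs_le.1 hAabs).1
  have hA2 := (abs_le.1 hAabs).2
  set X := N x with hXdef
  set κ := (1 + δ) ^ r + (1 - δ) ^ r with hκ
  have hκ0 : 0 < κ := by
    have h1 : 0 < (1 + δ) ^ r := by positivity
    have h2 : 0 ≤ (1 - δ) ^ r := pow_nonneg (by linarith) _
    linarith
  have hκ2 : κ ≤ 2 * (1 + r ^ 2 * δ ^ 2) := by
    have e1 : (1 + δ) ^ r ≤ Real.exp (r * δ) := by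
      rw [Real.exp_nat_mul]
      exact pow_le_pow_left₀ (by linarith) (by linarith [Real.add_one_le_exp δ]) _
    have e2 : (1 - δ) ^ r ≤ Real.exp (r * (-δ)) := by
      rw [Real.exp_nat_mul]
      exact pow_le_pow_left₀ (by linarith) (by linarith [Real.add_one_le_exp (-δ)]) _
    have hp : 0 ≤ r * δ := by positivity
    have e3 := Real.abs_exp_sub_one_sub_id_le (x := r * δ) (by rw [abs_of_nonneg hp]; exact hrδ)
    have e4 := Real.abs_exp_sub_one_sub_id_le (x := r * (-δ)) (by
      rw [mul_neg, abs_neg, abs_of_nonneg hp]; exact hrδ)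
    have e5 := (abs_le.1 e3).2
    have e6 := (abs_le.1 e4).2
    nlinarith
  set c := κ ^ ((r : ℝ)⁻¹) with hcdef
  have hc0 : 0 < c := Real.rpow_pos_of_pos hκ0 _
  have hcr : c ^ r = κ := Real.rpow_inv_natCast_pow hκ0.le hr0
  have hcon := hc (c • x) (fun j => (1 + δ * t j) / c) (fun j => (1 - δ * t j) / c) (by
    intro j
    rw [abs_div, abs_div, div_pow, div_pow, abs_of_pos hc0, hcr, ← add_div, div_le_one hκ0]
    rcases ht j with h | h
    · rw [h, abs_of_nonneg (by linarith), abs_of_nonneg (by linarith)]; simp [hκ]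
    · rw [h, abs_of_nonneg (by linarith), abs_of_nonneg (by linarith)]
      apply le_of_eq; rw [hκ]; ring)
  have e1 : (fun j => (1 + δ * t j) / c) * (c • x) = (fun j => 1 + δ * t j) * x := by
    funext j; simp only [Pi.mul_apply, Pi.smul_apply, smul_eq_mul]; field_simp
  have e2 : (fun j => (1 - δ * t j) / c) * (c • x) = (fun j => 1 - δ * t j) * x := by
    funext j; simp only [Pi.mul_apply, Pi.smul_apply, smul_eq_mul]; field_simp
  rw [e1, e2, hN.smul, mul_pow, abs_of_pos hc0, hcr, ← hXdef] at hcon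
  have hlow : X - δ * A ≤ N ((fun j => 1 - δ * t j) * x) := by
    refine le_trans (le_of_eq ?_) (ha _)
    rw [← hs, hA, Finset.mul_sum, ← Finset.sum_sub_distrib]
    exact Finset.sum_congr rfl fun j _ => by ring
  have hlow0 : 0 ≤ X - δ * A := by nlinarith
  have hlowp := pow_le_pow_left₀ hlow0 hlow r
  have hmain : N ((fun j => 1 + δ * t j) * x) ^ r ≤ (2 * (1 + r ^ 2 * δ ^ 2)) * X ^ r - (X - δ * A) ^ r := by
    have := mul_le_mul_of_nonneg_right hκ2 (pow_nonneg hX r)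
    linarith
  have hRHS : 0 ≤ X * (1 + 2 * r * δ ^ 2) + δ * A := by
    have : 0 ≤ X * (2 * r * δ ^ 2) := by positivity
    nlinarith
  refine le_of_pow_le_pow_left₀ hr0 hRHS (hmain.trans ?_)
  rcases hX.eq_or_lt with h0 | hXp
  · have hA0 : A = 0 := by rw [← h0] at hA1 hA2; linarith
    rw [← h0, hA0]; simp [hr0]
  have b1 := one_add_mul_le_pow (a := -(δ * A / X)) (by
    have : δ * A / X ≤ 1 := (div_le_one hXp).2 (by linarith)
    linarith) r
  have b2 := one_add_mul_le_pow (a := δ * A / X + 2 * r * δ ^ 2) (by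
    have : -1 ≤ δ * A / X := by rw [le_div_iff₀ hXp]; nlinarith
    have : 0 ≤ 2 * r * δ ^ 2 := by positivity
    linarith) r
  have f1 : (X - δ * A) ^ r = X ^ r * (1 + -(δ * A / X)) ^ r := by
    rw [← mul_pow]; congr 1; field_simp; ring
  have f2 : (X * (1 + 2 * r * δ ^ 2) + δ * A) ^ r = X ^ r * (1 + (δ * A / X + 2 * r * δ ^ 2)) ^ r := by
    rw [← mul_pow]; congr 1; field_simp; ring
  rw [f1, f2]
  have hXr : 0 ≤ X ^ r := pow_nonneg hX r
  have g1 := mul_le_mul_of_nonneg_left b1 hXr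
  have g2 := mul_le_mul_of_nonneg_left b2 hXr
  refine le_trans ?_ g2
  refine le_trans (sub_le_sub_left g1 _) (le_of_eq ?_)
  ring

theorem smooth_diff {k : ℕ} {N : (Fin k → ℝ) → ℝ} (hN : LNorm N) {r : ℕ} (hr : 1 ≤ r)
    (hc : Conc N r r) (x a y b : Fin k → ℝ) (hsa : ∑ j, a j = N x)
    (ha : ∀ u : Fin k → ℝ, ∑ j, a j * u j ≤ N (u * x))
    (hb0 : ∀ j, 0 ≤ b j) (hsb : ∑ j, b j = N y)
    (hb : ∀ u : Fin k → ℝ, ∑ j, b j * u j ≤ N (u * y))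
    (δ : ℝ) (hδ : 0 < δ) (hrδ : r * δ ≤ 1) :
    ∑ j, |a j - b j| ≤ 3 * N (x - y) / δ + 2 * r * δ * N y := by
  set t : Fin k → ℝ := fun j => if 0 ≤ a j - b j then 1 else -1 with htdef
  have ht : ∀ j, t j = 1 ∨ t j = -1 := fun j => by simp only [htdef]; split_ifs <;> simp
  have habs : ∀ j, |a j - b j| = a j * t j - b j * t j := by
    intro j; simp only [htdef]; split_ifs with h
    · rw [abs_of_nonneg h]; ring
    · rw [abs_of_neg (not_le.1 h)]; ring
  have hr' : (1 : ℝ) ≤ r := by exact_mod_cast hr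
  have hδ1 : δ ≤ 1 := by nlinarith
  have h1 := smooth hN hr hc y b hb0 hsb hb t ht δ hδ hrδ
  have h2 : N x + δ * ∑ j, a j * t j ≤ N ((fun j => 1 + δ * t j) * x) := by
    refine le_trans (le_of_eq ?_) (ha _)
    rw [← hsa, Finset.mul_sum, ← Finset.sum_add_distrib]
    exact Finset.sum_congr rfl fun j _ => by ring
  have h3 : N ((fun j => 1 + δ * t j) * x) ≤ N ((fun j => 1 + δ * t j) * y) + 2 * N (x - y) := by
    have e : (fun j => 1 + δ * t j) * x = (fun j => 1 + δ * t j) * y + (fun j => 1 + δ * t j) * (x - y) := by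
      rw [← mul_add]; congr 1; abel
    rw [e]
    refine (hN.add _ _).trans ?_
    have : N ((fun j => 1 + δ * t j) * (x - y)) ≤ N ((2 : ℝ) • (x - y)) := by
      apply hN.mono
      intro j
      simp only [Pi.mul_apply, Pi.smul_apply, smul_eq_mul, abs_mul]
      refine mul_le_mul_of_nonneg_right ?_ (abs_nonneg _)
      rcases ht j with h | h <;> rw [h, abs_of_nonneg (by linarith), abs_of_nonneg (by norm_num)] <;> linarith
    rw [hN.smul, abs_of_pos (by norm_num : (0 : ℝ) < 2)] at this
    linarith
  have h4 : N y ≤ N x + N (x - y) := by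
    have := hN.add x ((-1 : ℝ) • (x - y))
    rw [hN.smul] at this
    have e : x + (-1 : ℝ) • (x - y) = y := by simp
    rw [e] at this; simpa using this
  rw [Finset.sum_congr rfl fun j _ => habs j, Finset.sum_sub_distrib]
  have h5 : 3 * N (x - y) / δ + 2 * r * δ * N y = (3 * N (x - y) + 2 * r * δ ^ 2 * N y) / δ := by
    field_simp
  rw [h5, le_div_iff₀ hδ]
  linarith

lemma rpow_split {X p : ℝ} (hX : 0 ≤ X) (hp : 1 ≤ p) : X ^ (p - 1) * X = X ^ p := by
  have := Real.rpow_add_of_nonneg hX (sub_nonneg.2 hp) zero_le_one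
  rw [Real.rpow_one] at this
  rw [← this]; congr 1; ring

theorem edge_bound_aux {k : ℕ} {N : (Fin k → ℝ) → ℝ} (hN : LNorm N) {r : ℕ} (hr : 1 ≤ r)
    (hc : Conc N r r) (x a y b : Fin k → ℝ) (ha0 : ∀ j, 0 ≤ a j) (hsa : ∑ j, a j = N x)
    (ha : ∀ u : Fin k → ℝ, ∑ j, a j * u j ≤ N (u * x))
    (hb0 : ∀ j, 0 ≤ b j) (hsb : ∑ j, b j = N y)
    (hb : ∀ u : Fin k → ℝ, ∑ j, b j * u j ≤ N (u * y))
    (p η Λ : ℝ) (hp : 1 ≤ p) (hη : 0 < η) (hη1 : η ≤ 1) (hΛ1 : p / η ≤ Λ)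
    (hΛ2 : 24 * r / η ^ 2 ≤ Λ) (hxy : N y ≤ N x) :
    ∑ j, |N x ^ (p - 1) * a j - N y ^ (p - 1) * b j| ≤
      2 * η * (N x ^ p + N y ^ p) + 2 * Λ ^ p * N (x - y) ^ p := by
  have hX := hN.nonneg x
  have hY := hN.nonneg y
  have hD := hN.nonneg (x - y)
  have hr' : (1 : ℝ) ≤ r := by exact_mod_cast hr
  have hp0 : 0 ≤ p := by linarith
  have hΛ0 : 0 < Λ := lt_of_lt_of_le (by positivity) hΛ1
  have hXp := Real.rpow_nonneg hX p
  have hYp := Real.rpow_nonneg hY p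
  have hX1 := Real.rpow_nonneg hX (p - 1)
  have hY1 := Real.rpow_nonneg hY (p - 1)
  have hDp := Real.rpow_nonneg hD p
  have hYX : N y ^ p ≤ N x ^ p := Real.rpow_le_rpow hY hxy hp0
  by_cases hcase : N x ≤ Λ * N (x - y)
  · have h1 : N x ^ p ≤ Λ ^ p * N (x - y) ^ p := by
      rw [← Real.mul_rpow hΛ0.le hD]; exact Real.rpow_le_rpow hX hcase hp0
    have h2 : ∑ j, |N x ^ (p - 1) * a j - N y ^ (p - 1) * b j| ≤ N x ^ p + N y ^ p := by
      rw [← rpow_split hX hp, ← rpow_split hY hp, ← hsa, ← hsb, hsa, hsb]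
      rw [← hsa, ← hsb, Finset.mul_sum, Finset.mul_sum, ← Finset.sum_add_distrib, hsa, hsb]
      refine Finset.sum_le_sum fun j _ => ?_
      refine (abs_sub _ _).trans (le_of_eq ?_)
      rw [abs_of_nonneg (mul_nonneg hX1 (ha0 j)), abs_of_nonneg (mul_nonneg hY1 (hb0 j))]
    have h3 : 0 ≤ 2 * η * (N x ^ p + N y ^ p) := by positivity
    linarith
  · push Not at hcase
    have hXpos : 0 < N x := lt_of_le_of_lt (by positivity) hcase
    have hδ : 0 < η / (4 * r) := by positivity
    have h1 := smooth_diff hN hr hc x a y b hsa ha hb0 hsb hb (η / (4 * r)) hδ (by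
      have : (r : ℝ) * (η / (4 * r)) = η / 4 := by field_simp
      rw [this]; linarith)
    have h2 : ∑ j, |a j - b j| ≤ η * N x := by
      refine h1.trans ?_
      have e1 : 2 * r * (η / (4 * r)) * N y = η / 2 * N y := by field_simp; ring
      have e2 : 3 * N (x - y) / (η / (4 * r)) = η / 2 * (24 * r / η ^ 2 * N (x - y)) := by
        field_simp; ring
      rw [e1, e2]
      have e3 : 24 * r / η ^ 2 * N (x - y) ≤ N x :=
        (mul_le_mul_of_nonneg_right hΛ2 hD).trans hcase.le
      have e4 := mul_le_mul_of_nonneg_left e3 (by positivity : 0 ≤ η / 2)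
      have e5 := mul_le_mul_of_nonneg_left hxy (by positivity : 0 ≤ η / 2)
      linarith
    have h3 : N y ^ (p - 1) ≤ N x ^ (p - 1) := Real.rpow_le_rpow hY hxy (by linarith)
    have h4 : ∑ j, |N x ^ (p - 1) * a j - N y ^ (p - 1) * b j| ≤
        N x ^ (p - 1) * ∑ j, |a j - b j| + (N x ^ (p - 1) - N y ^ (p - 1)) * ∑ j, b j := by
      rw [Finset.mul_sum, Finset.mul_sum, ← Finset.sum_add_distrib]
      refine Finset.sum_le_sum fun j _ => ?_
      have e : N x ^ (p - 1) * a j - N y ^ (p - 1) * b j =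
        N x ^ (p - 1) * (a j - b j) + (N x ^ (p - 1) - N y ^ (p - 1)) * b j := by ring
      rw [e]
      refine (abs_add_le _ _).trans (le_of_eq ?_)
      rw [abs_mul, abs_of_nonneg hX1, abs_of_nonneg (mul_nonneg (sub_nonneg.2 h3) (hb0 j))]
    rw [hsb] at h4
    have h5 : N x ^ (p - 1) * ∑ j, |a j - b j| ≤ η * N x ^ p := by
      rw [← rpow_split hX hp]
      have := mul_le_mul_of_nonneg_left h2 hX1
      linarith
    have h6 : N x ^ (p - 1) * N y ≤ N x ^ p := by
      rw [← rpow_split hX hp]; exact mul_le_mul_of_nonneg_left hxy hX1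
    have h7 : N y ^ (p - 1) * N y = N y ^ p := rpow_split hY hp
    have h8 : N x ^ p - N y ^ p ≤ η * N x ^ p := by
      have t1 : N x ≤ N y + N (x - y) := by
        have := hN.add y (x - y)
        simpa using this
      have t2 : N x * (1 + -(1 / Λ)) ≤ N y := by
        have : N (x - y) ≤ N x / Λ := by rw [le_div_iff₀ hΛ0]; linarith
        have e : N x * (1 + -(1 / Λ)) = N x - N x / Λ := by ring
        rw [e]; linarith
      have hΛone : 1 ≤ Λ := le_trans (by rw [le_div_iff₀ hη]; linarith) hΛ1
      have hinv : 1 / Λ ≤ 1 := by rw [div_le_one hΛ0]; exact hΛone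
      have t3 := one_add_mul_self_le_rpow_one_add (s := -(1 / Λ)) (by linarith) hp
      have t4 : (N x * (1 + -(1 / Λ))) ^ p ≤ N y ^ p :=
        Real.rpow_le_rpow (mul_nonneg hX (by linarith)) t2 hp0
      rw [Real.mul_rpow hX (by linarith)] at t4
      have t5 := mul_le_mul_of_nonneg_left t3 hXp
      have t6 : p * (1 / Λ) ≤ η := by
        rw [mul_one_div, div_le_iff₀ hΛ0]
        rw [div_le_iff₀ hη] at hΛ1; linarith
      have t7 := mul_le_mul_of_nonneg_left t6 hXp
      have e : N x ^ p * (1 + p * -(1 / Λ)) = N x ^ p - N x ^ p * (p * (1 / Λ)) := by ring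
      rw [e] at t5
      linarith
    have h9 : 0 ≤ Λ ^ p := Real.rpow_nonneg hΛ0.le _
    have h10 : 0 ≤ 2 * Λ ^ p * N (x - y) ^ p := by positivity
    have h11 : 0 ≤ η * N y ^ p := by positivity
    have h12 : (N x ^ (p - 1) - N y ^ (p - 1)) * N y ≤ N x ^ p - N y ^ p := by
      rw [sub_mul, h7]; linarith
    linarith

lemma LNorm.symm {k : ℕ} {N : (Fin k → ℝ) → ℝ} (hN : LNorm N) (x y : Fin k → ℝ) :
    N (x - y) = N (y - x) := by
  have := hN.smul (-1) (x - y)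
  simpa using this.symm

theorem edge_bound {k : ℕ} {N : (Fin k → ℝ) → ℝ} (hN : LNorm N) {r : ℕ} (hr : 1 ≤ r)
    (hc : Conc N r r) (x a y b : Fin k → ℝ) (ha0 : ∀ j, 0 ≤ a j) (hsa : ∑ j, a j = N x)
    (ha : ∀ u : Fin k → ℝ, ∑ j, a j * u j ≤ N (u * x))
    (hb0 : ∀ j, 0 ≤ b j) (hsb : ∑ j, b j = N y)
    (hb : ∀ u : Fin k → ℝ, ∑ j, b j * u j ≤ N (u * y))
    (p η Λ : ℝ) (hp : 1 ≤ p) (hη : 0 < η) (hη1 : η ≤ 1) (hΛ1 : p / η ≤ Λ)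
    (hΛ2 : 24 * r / η ^ 2 ≤ Λ) :
    ∑ j, |N x ^ (p - 1) * a j - N y ^ (p - 1) * b j| ≤
      2 * η * (N x ^ p + N y ^ p) + 2 * Λ ^ p * N (x - y) ^ p := by
  rcases le_total (N y) (N x) with h | h
  · exact edge_bound_aux hN hr hc x a y b ha0 hsa ha hb0 hsb hb p η Λ hp hη hη1 hΛ1 hΛ2 h
  · have := edge_bound_aux hN hr hc y b x a hb0 hsb hb ha0 hsa ha p η Λ hp hη hη1 hΛ1 hΛ2 h
    rw [hN.symm x y, add_comm (N x ^ p)]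
    refine le_trans (le_of_eq (Finset.sum_congr rfl fun j _ => abs_sub_comm _ _)) this

theorem half_poincare {n d k : ℕ} (G : SimpleGraph (Fin n)) [DecidableRel G.Adj]
    (hreg : ∀ v, G.degree v = d) (H : ℝ) (hH : 0 ≤ H)
    (hch : ∀ S : Finset (Fin n), 2 * S.card ≤ n → (S.card : ℝ) ≤ H * (bdry G S).card)
    {N : (Fin k → ℝ) → ℝ} (hN : LNorm N) {r : ℕ} (hr : 1 ≤ r)
    (hc : Conc N r r) (p η Λ : ℝ) (hp : 1 ≤ p) (hη : 0 < η) (hη1 : η ≤ 1) (hΛ1 : p / η ≤ Λ)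
    (hΛ2 : 24 * r / η ^ 2 ≤ Λ) (hηH : 8 * H * d * η ≤ 1)
    (F : Fin n → Fin k → ℝ) (hF : ∀ j, 2 * (univ.filter fun v => F v j ≠ 0).card ≤ n) :
    ∑ v, N (F v) ^ p ≤ 4 * H * Λ ^ p *
      ∑ v, ∑ w, (if G.Adj v w then N (F v - F w) ^ p else 0) := by
  choose a ha0 hax hsa ha using fun v => norming hN (F v)
  set M : Fin n → Fin k → ℝ := fun v j => N (F v) ^ (p - 1) * a v j with hM
  have hM0 : ∀ v j, 0 ≤ M v j := fun v j =>
    mul_nonneg (Real.rpow_nonneg (hN.nonneg _) _) (ha0 v j)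
  have h1 : ∑ v, N (F v) ^ p = ∑ j, ∑ v, M v j := by
    rw [Finset.sum_comm]
    refine Finset.sum_congr rfl fun v _ => ?_
    rw [← rpow_split (hN.nonneg _) hp, ← Finset.mul_sum, hsa]
  have h2 : ∀ j, ∑ v, M v j ≤ H * ∑ q : Fin n × Fin n,
      (if G.Adj q.1 q.2 then max (M q.1 j - M q.2 j) 0 else 0) := by
    intro j
    refine le_of_le_of_eq (l1_poincare G H hH hch _ (fun v => M v j) (fun v => hM0 v j) rfl
      (le_trans ?_ (hF j))) (by congr!)
    refine Nat.mul_le_mul_left 2 (Finset.card_le_card ?_)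
    intro v hv
    simp only [mem_filter, mem_univ, true_and] at hv ⊢
    intro h
    exact hv (by simp [hM, hax v j h])
  have h3 : ∀ v w, ∑ j, max (M v j - M w j) 0 ≤
      2 * η * (N (F v) ^ p + N (F w) ^ p) + 2 * Λ ^ p * N (F v - F w) ^ p := by
    intro v w
    refine le_trans (Finset.sum_le_sum fun j _ => max_le (le_abs_self _) (abs_nonneg _))
      (edge_bound hN hr hc (F v) (a v) (F w) (a w) (ha0 v) (hsa v) (ha v) (ha0 w) (hsa w) (ha w)
        p η Λ hp hη hη1 hΛ1 hΛ2)
  set T := ∑ v, N (F v) ^ p with hT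
  set E := ∑ v, ∑ w, (if G.Adj v w then N (F v - F w) ^ p else 0) with hE
  have hdeg : ∀ v, ∑ w, (if G.Adj v w then (1 : ℝ) else 0) = d := by
    intro v
    rw [← hreg v, Finset.sum_boole, ← SimpleGraph.card_neighborFinset_eq_degree]
    congr 2
    ext w; simp
  have hdeg' : ∀ w, ∑ v, (if G.Adj v w then (1 : ℝ) else 0) = d := by
    intro w
    rw [← hdeg w]
    refine Finset.sum_congr rfl fun v _ => by simp only [G.adj_comm v w]
  have h4 : T ≤ H * (4 * η * d * T + 2 * Λ ^ p * E) := by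
    calc T = ∑ j, ∑ v, M v j := h1
      _ ≤ ∑ j, H * ∑ q : Fin n × Fin n,
          (if G.Adj q.1 q.2 then max (M q.1 j - M q.2 j) 0 else 0) :=
          Finset.sum_le_sum fun j _ => h2 j
      _ = H * ∑ q : Fin n × Fin n,
          (if G.Adj q.1 q.2 then ∑ j, max (M q.1 j - M q.2 j) 0 else 0) := by
          rw [← Finset.mul_sum, Finset.sum_comm]
          congr 1
          refine Finset.sum_congr rfl fun q _ => ?_
          split_ifs
          · rfl
          · simp
      _ ≤ H * ∑ q : Fin n × Fin n, (if G.Adj q.1 q.2 then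
            2 * η * (N (F q.1) ^ p + N (F q.2) ^ p) + 2 * Λ ^ p * N (F q.1 - F q.2) ^ p else 0) := by
          refine mul_le_mul_of_nonneg_left (Finset.sum_le_sum fun q _ => ?_) hH
          split_ifs
          · exact h3 _ _
          · exact le_rfl
      _ = _ := by
          congr 1
          rw [Fintype.sum_prod_type]
          have e : ∀ v w, (if G.Adj v w then
            2 * η * (N (F v) ^ p + N (F w) ^ p) + 2 * Λ ^ p * N (F v - F w) ^ p else 0)
            = 2 * η * (N (F v) ^ p * (if G.Adj v w then (1 : ℝ) else 0))
              + 2 * η * (N (F w) ^ p * (if G.Adj v w then (1 : ℝ) else 0))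
              + 2 * Λ ^ p * (if G.Adj v w then N (F v - F w) ^ p else 0) := by
            intro v w; split_ifs <;> ring
          simp only [e, Finset.sum_add_distrib, ← Finset.mul_sum]
          have e1 : ∑ v, N (F v) ^ p * ∑ w, (if G.Adj v w then (1 : ℝ) else 0) = T * d := by
            simp only [hdeg, ← Finset.sum_mul]; rw [hT]
          have e2 : ∑ v, ∑ w, N (F w) ^ p * (if G.Adj v w then (1 : ℝ) else 0) = T * d := by
            rw [Finset.sum_comm]
            simp only [← Finset.mul_sum, hdeg', ← Finset.sum_mul]; rw [hT]
          rw [e1, e2, ← hE]; ring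
  have hT0 : 0 ≤ T := Finset.sum_nonneg fun v _ => Real.rpow_nonneg (hN.nonneg _) _
  have h5 := mul_le_mul_of_nonneg_right hηH hT0
  nlinarith

lemma four_rpow {a b c e p : ℝ} (ha : 0 ≤ a) (hb : 0 ≤ b) (hc : 0 ≤ c) (he : 0 ≤ e) (hp : 1 ≤ p) :
    (a + b + c + e) ^ p ≤ 4 ^ p * (a ^ p + b ^ p + c ^ p + e ^ p) := by
  have ha' := Real.rpow_nonneg ha p
  have hb' := Real.rpow_nonneg hb p
  have hc' := Real.rpow_nonneg hc p
  have he' := Real.rpow_nonneg he p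
  obtain ⟨M, h1, h2, h3, h4, h5⟩ : ∃ M, a ≤ M ∧ b ≤ M ∧ c ≤ M ∧ e ≤ M ∧
      M ^ p ≤ a ^ p + b ^ p + c ^ p + e ^ p := by
    refine ⟨max (max a b) (max c e), by simp, by simp, by simp, by simp, ?_⟩
    rcases max_choice (max a b) (max c e) with h | h <;> rw [h]
    · rcases max_choice a b with h | h <;> rw [h] <;> linarith
    · rcases max_choice c e with h | h <;> rw [h] <;> linarith
  calc (a + b + c + e) ^ p ≤ (4 * M) ^ p :=
        Real.rpow_le_rpow (by linarith) (by linarith) (by linarith)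
    _ = 4 ^ p * M ^ p := Real.mul_rpow (by norm_num) (by linarith)
    _ ≤ _ := mul_le_mul_of_nonneg_left h5 (by positivity)

theorem full_poincare {n d k : ℕ} (hn : 0 < n) (G : SimpleGraph (Fin n)) [DecidableRel G.Adj]
    (hreg : ∀ v, G.degree v = d) (H : ℝ) (hH : 0 ≤ H)
    (hch : ∀ S : Finset (Fin n), 2 * S.card ≤ n → (S.card : ℝ) ≤ H * (bdry G S).card)
    {N : (Fin k → ℝ) → ℝ} (hN : LNorm N) {r : ℕ} (hr : 1 ≤ r)
    (hc : Conc N r r) (p η Λ : ℝ) (hp : 1 ≤ p) (hη : 0 < η) (hη1 : η ≤ 1) (hΛ1 : p / η ≤ Λ)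
    (hΛ2 : 24 * r / η ^ 2 ≤ Λ) (hηH : 8 * H * d * η ≤ 1)
    (f : Fin n → Fin k → ℝ) :
    ∑ v, ∑ w, N (f v - f w) ^ p ≤ 4 ^ p * (2 * n * (2 * (4 * H * Λ ^ p *
      ∑ v, ∑ w, (if G.Adj v w then N (f v - f w) ^ p else 0)))) := by
  have hΛ0 : 0 ≤ Λ := le_trans (by positivity) hΛ1
  choose m hm1 hm2 using fun j => exists_median hn (fun v => f v j)
  set A : Fin n → Fin k → ℝ := fun v j => max (f v j - m j) 0 with hA
  set B : Fin n → Fin k → ℝ := fun v j => max (m j - f v j) 0 with hB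
  set E := ∑ v, ∑ w, (if G.Adj v w then N (f v - f w) ^ p else 0) with hE
  have hpA : ∑ v, N (A v) ^ p ≤ 4 * H * Λ ^ p * E := by
    refine le_trans (half_poincare G hreg H hH hch hN hr hc p η Λ hp hη hη1 hΛ1 hΛ2 hηH A ?_) ?_
    · intro j
      refine le_trans (Nat.mul_le_mul_left 2 (Finset.card_le_card ?_)) (hm1 j)
      intro v hv
      simp only [mem_filter, mem_univ, true_and, hA] at hv ⊢
      by_contra h
      exact hv (max_eq_right (by linarith))
    · refine mul_le_mul_of_nonneg_left (Finset.sum_le_sum fun v _ => Finset.sum_le_sum fun w _ => ?_)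
        (by positivity)
      split_ifs
      · refine Real.rpow_le_rpow (hN.nonneg _) (hN.mono _ _ fun j => ?_) (by linarith)
        simp only [Pi.sub_apply, hA]
        refine le_trans (abs_max_sub_max_le_abs _ _ _) (le_of_eq (by congr 1; ring))
      · exact le_rfl
  have hpB : ∑ v, N (B v) ^ p ≤ 4 * H * Λ ^ p * E := by
    refine le_trans (half_poincare G hreg H hH hch hN hr hc p η Λ hp hη hη1 hΛ1 hΛ2 hηH B ?_) ?_
    · intro j
      refine le_trans (Nat.mul_le_mul_left 2 (Finset.card_le_card ?_)) (hm2 j)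
      intro v hv
      simp only [mem_filter, mem_univ, true_and, hB] at hv ⊢
      by_contra h
      exact hv (max_eq_right (by linarith))
    · refine mul_le_mul_of_nonneg_left (Finset.sum_le_sum fun v _ => Finset.sum_le_sum fun w _ => ?_)
        (by positivity)
      split_ifs
      · refine Real.rpow_le_rpow (hN.nonneg _) (hN.mono _ _ fun j => ?_) (by linarith)
        simp only [Pi.sub_apply, hB]
        refine le_trans (abs_max_sub_max_le_abs _ _ _) (le_of_eq ?_)
        rw [abs_sub_comm (f v j)]; congr 1; ring
      · exact le_rfl
  have hneg : ∀ x, N (-x) = N x := by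
    intro x
    have := hN.smul (-1) x
    simpa using this
  have hpt : ∀ v w, N (f v - f w) ^ p ≤
      4 ^ p * (N (A v) ^ p + N (B v) ^ p + N (A w) ^ p + N (B w) ^ p) := by
    intro v w
    refine le_trans (Real.rpow_le_rpow (hN.nonneg _) ?_ (by linarith))
      (four_rpow (hN.nonneg _) (hN.nonneg _) (hN.nonneg _) (hN.nonneg _) hp)
    have hfA : ∀ v j, f v j - m j = A v j - B v j := by
      intro v j
      simp only [hA, hB]
      rcases le_total (f v j) (m j) with h | h
      · rw [max_eq_right (by linarith), max_eq_left (by linarith)]; ring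
      · rw [max_eq_left (by linarith), max_eq_right (by linarith)]; ring
    have e : f v - f w = ((A v + -B v) + -A w) + B w := by
      ext j
      have h1 := hfA v j
      have h2 := hfA w j
      simp only [Pi.sub_apply, Pi.add_apply, Pi.neg_apply]
      linarith
    rw [e]
    have i1 := hN.add ((A v + -B v) + -A w) (B w)
    have i2 := hN.add (A v + -B v) (-A w)
    have i3 := hN.add (A v) (-B v)
    rw [hneg] at i2 i3
    linarith
  calc ∑ v, ∑ w, N (f v - f w) ^ p ≤ ∑ v : Fin n, ∑ w : Fin n,
        4 ^ p * (N (A v) ^ p + N (B v) ^ p + N (A w) ^ p + N (B w) ^ p) :=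
        Finset.sum_le_sum fun v _ => Finset.sum_le_sum fun w _ => hpt v w
    _ = 4 ^ p * (2 * n * (∑ v, N (A v) ^ p + ∑ v, N (B v) ^ p)) := by
        simp only [← Finset.mul_sum, Finset.sum_add_distrib, Finset.sum_const, Finset.card_univ,
          Fintype.card_fin, nsmul_eq_mul]
        ring
    _ ≤ _ := by
        refine mul_le_mul_of_nonneg_left (mul_le_mul_of_nonneg_left ?_ (by positivity))
          (by positivity)
        linarith

lemma const_bound (q C K α ε L p D r : ℝ)
    (hq : 2 ≤ q) (hC : 1 ≤ C) (hK : 1 ≤ K) (hD : 1 ≤ D) (hr : r ≤ 3 * q)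
    (hα : 0 < α ∧ α ≤ 1) (hε : 0 < ε ∧ ε ≤ 1) (hL : 1 ≤ L) (hp : 1 ≤ p) :
    128 * D ^ 3 / α ^ 2 * (20 * C * K * (24 * r * p * (4096 * D ^ 6 / α ^ 4))) ≤
      p * (2 ^ 115 * q ^ 10 * C ^ 2 * K ^ 3 * (D ^ 25 * L ^ 8 / (α ^ 14 * ε ^ 18))) := by
  obtain ⟨hα0, hα1⟩ := hα
  obtain ⟨hε0, hε1⟩ := hε
  have e1 : 128 * D ^ 3 / α ^ 2 * (20 * C * K * (24 * r * p * (4096 * D ^ 6 / α ^ 4)))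
      = p * ((128 * 20 * 24 * 4096) * r * C * K * (D ^ 9 / α ^ 6)) := by
    field_simp
  rw [e1]
  refine mul_le_mul_of_nonneg_left ?_ (by linarith)
  have h1 : D ^ 9 / α ^ 6 ≤ D ^ 25 * L ^ 8 / (α ^ 14 * ε ^ 18) := by
    have hnum : D ^ 9 ≤ D ^ 25 * L ^ 8 := by
      calc D ^ 9 ≤ D ^ 25 := pow_le_pow_right₀ hD (by norm_num)
        _ ≤ D ^ 25 * L ^ 8 := le_mul_of_one_le_right (by positivity) (one_le_pow₀ hL)
    have hden : α ^ 14 * ε ^ 18 ≤ α ^ 6 := by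
      calc α ^ 14 * ε ^ 18 ≤ α ^ 14 := mul_le_of_le_one_right (by positivity) (pow_le_one₀ hε0.le hε1)
        _ ≤ α ^ 6 := pow_le_pow_of_le_one hα0.le hα1 (by norm_num)
    exact div_le_div₀ (by positivity) hnum (by positivity) hden
  have h2 : C ≤ C ^ 2 := by nlinarith
  have h3 : K ≤ K ^ 3 := le_self_pow₀ hK (by norm_num)
  have h4 : (128 * 20 * 24 * 4096) * r ≤ 2 ^ 115 * q ^ 10 := by
    have h5 : q ≤ q ^ 10 := le_self_pow₀ (by linarith) (by norm_num)
    have : (128 * 20 * 24 * 4096) * r ≤ (128 * 20 * 24 * 4096) * (3 * q) := by linarith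
    nlinarith
  have hA : (128 * 20 * 24 * 4096) * r * C * K ≤ 2 ^ 115 * q ^ 10 * C ^ 2 * K ^ 3 := by
    have hC0 : (0:ℝ) ≤ C := by linarith
    have hK0 : (0:ℝ) ≤ K := by linarith
    have hq0 : (0:ℝ) ≤ q := by linarith
    gcongr
  have hX : (0:ℝ) ≤ D ^ 9 / α ^ 6 := by positivity
  have hq0 : (0:ℝ) ≤ q := by linarith
  have hC0 : (0:ℝ) ≤ C := by linarith
  have hK0 : (0:ℝ) ≤ K := by linarith
  exact mul_le_mul hA h1 hX (by positivity)

/-- Theorem 1.5 (nonlinear spectral gap via long-range expansion), general `p ≥ 1`. -/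
theorem stmt_1 {n d k : ℕ} (q C K α ε L p : ℝ)
    (hq : 2 ≤ q) (hC : 1 ≤ C) (hK : 1 ≤ K) (hd : 3 ≤ d)
    (hα : 0 < α ∧ α ≤ 1) (hε : 0 < ε ∧ ε ≤ 1) (hL : 1 ≤ L) (hp : 1 ≤ p)
    (G : SimpleGraph (Fin n)) [DecidableRel G.Adj]
    (hreg : ∀ v, G.degree v = d)
    (hExp : Expan n d G α ε L)
    (hk : 1 ≤ k) (N : (Fin k → ℝ) → ℝ)
    (hN : IsNorm k N) (hunc : UncondConst k N K) (hcot : HasCotype k N q C)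
    (f : Fin n → Fin k → ℝ) :
    1 / (n : ℝ) ^ 2 * ∑ v, ∑ w, N (f v - f w) ^ p ≤
      (p * (2 ^ 115 * q ^ 10 * C ^ 2 * K ^ 3 *
            ((d : ℝ) ^ 25 * L ^ 8 / (α ^ 14 * ε ^ 18)))) ^ p /
          (G.edgeFinset.card : ℝ) *
        ∑ e ∈ G.edgeFinset, edgeNorm N f e ^ p := by
  rcases Nat.eq_zero_or_pos n with hn | hn
  · subst hn
    simp only [Finset.univ_eq_empty, Finset.sum_empty, mul_zero]
    have : G.edgeFinset = ∅ := by
      ext e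
      induction e using Sym2.ind with
      | _ a b => exact a.elim0
    rw [this]; simp
  have hn0 : (0:ℝ) < n := by exact_mod_cast hn
  have hsymm : ∀ x, N (-x) = N x := by
    intro x
    have := hN.2.1 (-1) x
    simpa using this
  have hN0 : ∀ x, 0 ≤ N x := by
    intro x
    have h1 := hN.2.2 x (-x)
    rw [add_neg_cancel, hsymm, (hN.1 0).2 rfl] at h1
    linarith
  have hD : (1:ℝ) ≤ d := by exact_mod_cast (by omega : 1 ≤ d)
  have hα0 := hα.1
  have hC0 : (0:ℝ) < C := by linarith
  have hK0 : (0:ℝ) < K := by linarith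
  have hp0 : (0:ℝ) < p := by linarith
  set Q := ⌈q⌉₊ with hQ
  have hqQ : q ≤ Q := Nat.le_ceil q
  have hQq : (Q:ℝ) < q + 1 := Nat.ceil_lt_add_one (by linarith)
  have hQ1 : 1 ≤ Q := by
    have : (1:ℝ) ≤ Q := by linarith
    exact_mod_cast this
  obtain ⟨N1, hL1, hc1, hle1, hge1⟩ := renorm N hN0 hN.2.1 hN.2.2 1 Q le_rfl hQ1 (C * K)
    (by positivity) (cotype_bound hN hN0 hq hC hK hunc hcot Q hqQ)
  obtain ⟨N2, hL2, hc2, hle2, hge2⟩ := renorm N1 hL1.nonneg hL1.smul hL1.add (2 * Q) (2 * Q)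
    (by omega) (by omega) 5 (by norm_num) (pisier_bound hL1 hQ1 hc1)
  have hlow : ∀ x, N x ≤ N2 x := fun x => (hle1 x).trans (hle2 x)
  have hupp : ∀ x, N2 x ≤ 5 * C * K * N x := by
    intro x
    have h1 := hge1 x
    have h2 := hge2 x
    linarith
  set H : ℝ := 8 * d ^ 2 / α ^ 2 with hH
  set η : ℝ := α ^ 2 / (64 * d ^ 3) with hη
  set r : ℝ := 2 * (Q : ℝ) with hr
  set Λ : ℝ := 24 * r * p * (4096 * d ^ 6 / α ^ 4) with hΛ
  have hr1 : 1 ≤ r := by linarith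
  have hH0 : 0 ≤ H := by positivity
  have hη0 : 0 < η := by positivity
  have hη1 : η ≤ 1 := by
    rw [hη, div_le_one (by positivity)]
    have h1 : α ^ 2 ≤ 1 := pow_le_one₀ hα0.le hα.2
    have h2 : (1:ℝ) ≤ (d:ℝ) ^ 3 := one_le_pow₀ hD
    linarith
  have hΛη : Λ = 24 * r * p / η ^ 2 := by
    rw [hΛ, hη]; field_simp; norm_num
  have hΛ1 : p / η ≤ Λ := by
    rw [hΛη, div_le_div_iff₀ hη0 (by positivity)]
    have h1 : η ^ 2 ≤ η := by nlinarith
    have h2 : p ≤ 24 * r * p := by nlinarith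
    exact mul_le_mul h2 h1 (by positivity) (by positivity)
  have hΛ2 : 24 * ((2 * Q : ℕ) : ℝ) / η ^ 2 ≤ Λ := by
    rw [hΛη]
    push_cast
    refine div_le_div_of_nonneg_right ?_ (by positivity)
    rw [← hr]
    exact le_mul_of_one_le_right (by positivity) hp
  have hηH : 8 * H * d * η ≤ 1 := by
    refine le_of_eq ?_
    rw [hH, hη]; field_simp; norm_num
  have main := full_poincare hn G hreg H hH0 (cheeger hd G hreg α hα hExp.1) hL2 (by omega) hc2
    p η Λ hp hη0 hη1 hΛ1 hΛ2 hηH f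
  set S := ∑ e ∈ G.edgeFinset, edgeNorm N f e ^ p with hS
  have hedge : ∀ v w, edgeNorm N f s(v, w) = N (f v - f w) := by
    intro v w
    have : N (f w - f v) = N (f v - f w) := by rw [← hsymm, neg_sub]
    simp [edgeNorm, this]
  have hS0 : 0 ≤ S := by
    refine Finset.sum_nonneg fun e _ => Real.rpow_nonneg ?_ _
    induction e using Sym2.ind with
    | _ a b => rw [hedge]; exact hN0 _
  have hES : ∑ v, ∑ w, (if G.Adj v w then N2 (f v - f w) ^ p else 0)
      ≤ (5 * C * K) ^ p * (2 * S) := by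
    rw [hS, ← sum_edges_eq G (fun e => edgeNorm N f e ^ p)]
    simp only [Finset.mul_sum]
    refine Finset.sum_le_sum fun v _ => Finset.sum_le_sum fun w _ => ?_
    split_ifs
    · rw [hedge, ← Real.mul_rpow (by positivity) (hN0 _)]
      exact Real.rpow_le_rpow (hL2.nonneg _) (hupp _) hp0.le
    · simp
  have hcard : (n:ℝ) * d = 2 * (G.edgeFinset.card : ℝ) := by
    have h := G.sum_degrees_eq_twice_card_edges
    simp only [hreg, Finset.sum_const, Finset.card_univ, Fintype.card_fin, smul_eq_mul] at h
    exact_mod_cast h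
  set m : ℝ := (G.edgeFinset.card : ℝ) with hm
  have hm0 : 0 < m := by nlinarith
  have hΛ0 : 0 ≤ Λ := by positivity
  set Θ : ℝ := p * (2 ^ 115 * q ^ 10 * C ^ 2 * K ^ 3 *
            ((d : ℝ) ^ 25 * L ^ 8 / (α ^ 14 * ε ^ 18))) with hΘ
  have hconst : 128 * (d:ℝ) ^ 3 / α ^ 2 * (20 * C * K * Λ) ≤ Θ :=
    const_bound q C K α ε L p d r hq hC hK hD (by linarith) hα hε hL hp
  have hU1 : 1 ≤ 128 * (d:ℝ) ^ 3 / α ^ 2 := by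
    rw [le_div_iff₀ (by positivity)]
    have h1 : α ^ 2 ≤ 1 := pow_le_one₀ hα0.le hα.2
    have h2 : (1:ℝ) ≤ (d:ℝ) ^ 3 := one_le_pow₀ hD
    linarith
  set U : ℝ := 128 * (d:ℝ) ^ 3 / α ^ 2 with hU
  have hUH : U = 16 * H * d := by rw [hU, hH]; field_simp; norm_num
  have hΘp : U * (20 * C * K * Λ) ^ p ≤ Θ ^ p := by
    calc U * (20 * C * K * Λ) ^ p ≤ U ^ p * (20 * C * K * Λ) ^ p :=
          mul_le_mul_of_nonneg_right (Real.self_le_rpow_of_one_le hU1 hp) (by positivity)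
      _ = (U * (20 * C * K * Λ)) ^ p := (Real.mul_rpow (by positivity) (by positivity)).symm
      _ ≤ Θ ^ p := Real.rpow_le_rpow (by positivity) hconst hp0.le
  have e20 : (20 * C * K * Λ) ^ p = 4 ^ p * (5 * C * K) ^ p * Λ ^ p := by
    rw [← Real.mul_rpow (by norm_num) (by positivity), ← Real.mul_rpow (by positivity) hΛ0]
    congr 1; ring
  have hfin : ∑ v, ∑ w, N (f v - f w) ^ p ≤ 2 * n / d * (Θ ^ p * S) := by
    calc ∑ v, ∑ w, N (f v - f w) ^ p ≤ ∑ v, ∑ w, N2 (f v - f w) ^ p :=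
          Finset.sum_le_sum fun v _ => Finset.sum_le_sum fun w _ =>
            Real.rpow_le_rpow (hN0 _) (hlow _) hp0.le
      _ ≤ _ := main
      _ ≤ 4 ^ p * (2 * n * (2 * (4 * H * Λ ^ p * ((5 * C * K) ^ p * (2 * S))))) := by
          gcongr
      _ = 2 * n / d * (U * (20 * C * K * Λ) ^ p * S) := by
          rw [e20, hUH]; field_simp; ring
      _ ≤ _ := by gcongr
  calc 1 / (n : ℝ) ^ 2 * ∑ v, ∑ w, N (f v - f w) ^ p
      ≤ 1 / (n : ℝ) ^ 2 * (2 * n / d * (Θ ^ p * S)) := by gcongr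
    _ = Θ ^ p / m * S := by
        have : m = n * d / 2 := by linarith
        rw [this]; field_simp
end
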